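/- Infeasibility certificate for a single constraint: Let s ∈ Sym TT_n. Then there is no A ∈ (M_n(ℝ))^g with s(A) positive semidefinite if and only if −1 = Σ_i ω_i Π_j tr(h_{ij} s h_{ij}ᵀ) for some finitely many ω_i ∈ Ω_n and h_{ij} ∈ TT_n (an identity in C_n ⊆ ℝ[ξ]). -/

import Mathlib

noncomputable section

open Matrix

/-- The polynomial ring ℝ[ξ] in the g·n² commuting variables ξ_{jıȷ}. -/
abbrev PolyRing (n g : ℕ) : Type := MvPolynomial (Fin g × Fin n × Fin n) ℝ

/-- n×n matrices over ℝ[ξ]. -/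
abbrev MatP (n g : ℕ) : Type := Matrix (Fin n) (Fin n) (PolyRing n g)

/-- The generic matrices Ξ_j = (ξ_{jıȷ})_{ıȷ}. -/
def genMat (n g : ℕ) (j : Fin g) : MatP n g :=
  Matrix.of fun a b => MvPolynomial.X (j, a, b)

/-- The set of generic matrices together with their transposes. -/
def genSet (n g : ℕ) : Set (MatP n g) :=
  Set.range (genMat n g) ∪ Set.range (fun j => (genMat n g j)ᵀ)

/-- The trace ring TT_n: the ℝ-subalgebra of M_n(ℝ[ξ]) generated by the Ξ_j, their
transposes, and the scalar matrices tr(w)·1 for all products w of the Ξ_j, Ξ_jᵀ. -/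
def traceRing (n g : ℕ) : Subalgebra ℝ (MatP n g) :=
  Algebra.adjoin ℝ
    (genSet n g ∪
      {m | ∃ w ∈ Submonoid.closure (genSet n g), m = (Matrix.trace w) • (1 : MatP n g)})

/-- The center C_n of the trace ring: the scalar matrices in TT_n. -/
def centerSet (n g : ℕ) : Set (MatP n g) :=
  {c | c ∈ traceRing n g ∧ ∃ p : PolyRing n g, c = p • (1 : MatP n g)}

/-- Evaluation of a matrix of polynomials at a g-tuple X of n×n real matrices. -/
def evalMat (n g : ℕ) (X : Fin g → Matrix (Fin n) (Fin n) ℝ) (h : MatP n g) :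
    Matrix (Fin n) (Fin n) ℝ :=
  h.map (MvPolynomial.eval fun v => X v.1 v.2.1 v.2.2)

/-- The semialgebraic set K_S determined by S. -/
def KSet (n g : ℕ) (S : Set (MatP n g)) : Set (Fin g → Matrix (Fin n) (Fin n) ℝ) :=
  {X | ∀ s ∈ S, (evalMat n g X s).PosSemidef}

/-- Cyclic quadratic module in Sym TT_n. -/
def IsCyclicQM (n g : ℕ) (Q : Set (MatP n g)) : Prop :=
  (∀ q ∈ Q, q ∈ traceRing n g ∧ qᵀ = q) ∧
  (1 : MatP n g) ∈ Q ∧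
  (∀ a ∈ Q, ∀ b ∈ Q, a + b ∈ Q) ∧
  (∀ h ∈ traceRing n g, ∀ q ∈ Q, h * q * hᵀ ∈ Q) ∧
  (∀ q ∈ Q, (Matrix.trace q) • (1 : MatP n g) ∈ Q)

/-- Cyclic preordering: a cyclic quadratic module whose intersection with the center
is closed under multiplication. -/
def IsCyclicPreordering (n g : ℕ) (T : Set (MatP n g)) : Prop :=
  IsCyclicQM n g T ∧
  ∀ a ∈ T ∩ centerSet n g, ∀ b ∈ T ∩ centerSet n g, a * b ∈ T

/-- The smallest cyclic preordering T_S^tr containing S. -/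
def TtrS (n g : ℕ) (S : Set (MatP n g)) : Set (MatP n g) :=
  {a | ∀ T : Set (MatP n g), IsCyclicPreordering n g T → S ⊆ T → a ∈ T}

/-- Ω_n: finite sums of finite products of elements tr(hhᵀ)·1 with h ∈ TT_n. -/
def OmegaSet (n g : ℕ) : Set (MatP n g) :=
  (AddSubmonoid.closure
    ((Submonoid.closure
        {c : MatP n g | ∃ h ∈ traceRing n g,
          c = (Matrix.trace (h * hᵀ)) • (1 : MatP n g)} : Submonoid (MatP n g)) :
      Set (MatP n g)) : AddSubmonoid (MatP n g))

section PolynomialIVT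

open Polynomial

/-- The intermediate value property for polynomials over an ordered field. -/
def PolyIVT (R : Type*) [Field R] [LinearOrder R] : Prop :=
  ∀ (p : R[X]) (a b : R), a < b → p.eval a < 0 → 0 < p.eval b → ∃ c, a < c ∧ c < b ∧ p.eval c = 0

variable {R : Type*} [Field R] [LinearOrder R] [IsStrictOrderedRing R]

theorem PolyIVT.exists_root_of_mul_neg (hR : PolyIVT R) (p : R[X]) {a b : R} (hab : a < b)
    (h : p.eval a * p.eval b < 0) : ∃ c, a < c ∧ c < b ∧ p.eval c = 0 := by
  rcases mul_neg_iff.1 h with ⟨h1, h2⟩ | ⟨h1, h2⟩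
  · obtain ⟨c, h3, h4, h5⟩ := hR (-p) a b hab (by simpa using h1) (by simpa using h2)
    exact ⟨c, h3, h4, by simpa using h5⟩
  · exact hR p a b hab h1 h2

/-- A polynomial without zeros on `[a, b]` has the same sign at `a` and `b`. -/
theorem PolyIVT.sign_eq_of_lt (hR : PolyIVT R) (p : R[X]) {a b : R} (hab : a < b)
    (h : ∀ c, a ≤ c → c ≤ b → p.eval c ≠ 0) :
    SignType.sign (p.eval a) = SignType.sign (p.eval b) := by
  have ha := h a le_rfl hab.le
  have hb := h b hab.le le_rfl
  have hn : ¬ p.eval a * p.eval b < 0 := fun hlt => by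
    obtain ⟨c, h1, h2, h3⟩ := hR.exists_root_of_mul_neg p hab hlt
    exact h c h1.le h2.le h3
  rcases lt_or_gt_of_ne ha with h1 | h1 <;> rcases lt_or_gt_of_ne hb with h2 | h2
  · simp [h1, h2]
  · exact absurd (mul_neg_of_neg_of_pos h1 h2) hn
  · exact absurd (mul_neg_of_pos_of_neg h1 h2) hn
  · simp [h1, h2]

theorem PolyIVT.rolle_zero (hR : PolyIVT R) (p : R[X]) {a b : R} (hab : a < b)
    (ha : p.eval a = 0) (hb : p.eval b = 0) :
    ∃ c, a < c ∧ c < b ∧ (derivative p).eval c = 0 := by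
  classical
  by_cases hp : p = 0
  · exact ⟨(a + b) / 2, by linarith, by linarith, by simp [hp]⟩
  have hne : (p.roots.toFinset.filter (a < ·)).Nonempty :=
    ⟨b, by simp [hp, hb, hab]⟩
  obtain ⟨b', hb', hmin⟩ := Finset.exists_min_image _ id hne
  simp only [Finset.mem_filter, Multiset.mem_toFinset, mem_roots hp, IsRoot.def] at hb' hmin
  obtain ⟨hb'0, hab'⟩ := hb'
  have hb'b : b' ≤ b := hmin b ⟨hb, hab⟩
  have hno : ∀ c, a < c → c < b' → p.eval c ≠ 0 := fun c h1 h2 h3 =>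
    absurd (hmin c ⟨h3, h1⟩) (not_le.2 h2)
  obtain ⟨q1, hq1, hq1a⟩ := exists_eq_pow_rootMultiplicity_mul_and_not_dvd p hp a
  set m := p.rootMultiplicity a
  have hm : 0 < m := (rootMultiplicity_pos hp).2 ha
  have hq10 : q1 ≠ 0 := by rintro rfl; simp at hq1a
  obtain ⟨q, hq, hqb⟩ := exists_eq_pow_rootMultiplicity_mul_and_not_dvd q1 hq10 b'
  set k := q1.rootMultiplicity b'
  have hba : b' - a ≠ 0 := sub_ne_zero.2 hab'.ne'
  have hq1b : q1.eval b' = 0 := by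
    rw [hq1] at hb'0
    simpa [hba] using hb'0
  have hk : 0 < k := (rootMultiplicity_pos hq10).2 hq1b
  have hqa0 : q.eval a ≠ 0 := by
    intro h
    apply hq1a
    rw [hq]
    exact dvd_mul_of_dvd_right (dvd_iff_isRoot.2 h) _
  have hqb0 : q.eval b' ≠ 0 := fun h => hqb (dvd_iff_isRoot.2 h)
  have hpe : p = (X - C a) ^ m * ((X - C b') ^ k * q) := by rw [← hq, ← hq1]
  have hsign := hR.sign_eq_of_lt q hab' (fun c h1 h2 h3 => by
    rcases h1.eq_or_lt with rfl | h1
    · exact hqa0 h3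
    rcases h2.eq_or_lt with rfl | h2
    · exact hqb0 h3
    exact hno c h1 h2 (by rw [hpe]; simp [h3]))
  obtain ⟨m', hm'⟩ : ∃ m', m = m' + 1 := ⟨m - 1, by omega⟩
  obtain ⟨k', hk'⟩ : ∃ k', k = k' + 1 := ⟨k - 1, by omega⟩
  set r : R[X] := C (m : R) * (X - C b') * q + C (k : R) * (X - C a) * q
      + (X - C a) * (X - C b') * derivative q with hr
  have hder : derivative p = (X - C a) ^ m' * (X - C b') ^ k' * r := by
    rw [hpe, hr, hm', hk']
    simp only [derivative_mul, derivative_X_sub_C_pow]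
    simp
    ring
  have hra : r.eval a = m * (a - b') * q.eval a := by simp [hr]
  have hrb : r.eval b' = k * (b' - a) * q.eval b' := by simp [hr]
  have hmR : (0 : R) < m := by exact_mod_cast hm
  have hkR : (0 : R) < k := by exact_mod_cast hk
  have hprod : 0 < q.eval a * q.eval b' := by
    rcases lt_or_gt_of_ne hqa0 with h1 | h1
    · rw [sign_neg h1, eq_comm, sign_eq_neg_one_iff] at hsign
      exact mul_pos_of_neg_of_neg h1 hsign
    · rw [sign_pos h1, eq_comm, sign_eq_one_iff] at hsign
      exact mul_pos h1 hsign
  obtain ⟨c, h1, h2, h3⟩ := hR.exists_root_of_mul_neg r hab' (by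
    rw [hra, hrb]
    have h4 : 0 < b' - a := sub_pos.2 hab'
    have : m * (a - b') * q.eval a * (k * (b' - a) * q.eval b')
      = - (m * k * ((b' - a) * (b' - a)) * (q.eval a * q.eval b')) := by ring
    rw [this]
    have : 0 < m * k * ((b' - a) * (b' - a)) * (q.eval a * q.eval b') := by positivity
    linarith)
  exact ⟨c, h1, h2.trans_le hb'b, by rw [hder]; simp [h3]⟩

theorem PolyIVT.mean_value (hR : PolyIVT R) (p : R[X]) {a b : R} (hab : a < b) :
    ∃ c, a < c ∧ c < b ∧ p.eval b - p.eval a = (derivative p).eval c * (b - a) := by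
  have hba : b - a ≠ 0 := sub_ne_zero.2 hab.ne'
  set m := (p.eval b - p.eval a) / (b - a) with hm
  have hmul : m * (b - a) = p.eval b - p.eval a := div_mul_cancel₀ _ hba
  obtain ⟨c, h1, h2, h3⟩ := hR.rolle_zero (p - C m * (X - C a) - C (p.eval a)) hab
    (by simp) (by simp [hmul])
  refine ⟨c, h1, h2, ?_⟩
  have : (derivative p).eval c = m := by
    simp at h3
    linarith
  rw [this, hmul]

theorem Polynomial.exists_forall_ge_pos_le_eval (p : R[X]) (hp : 0 < p.leadingCoeff) :
    ∃ c M : R, 0 < c ∧ ∀ x, M ≤ x → c ≤ p.eval x := by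
  induction hn : p.natDegree using Nat.strong_induction_on generalizing p with
  | _ n ih =>
  rcases Nat.eq_zero_or_pos n with h0 | h0
  · rw [h0] at hn
    rw [eq_C_of_natDegree_eq_zero hn] at hp ⊢
    exact ⟨p.coeff 0, 0, by simpa using hp, by simp⟩
  · have hdeg : p.divX.natDegree = n - 1 := by rw [natDegree_divX_eq_natDegree_tsub_one, hn]
    have hlc : p.divX.leadingCoeff = p.leadingCoeff := by
      rw [leadingCoeff, leadingCoeff, hdeg, coeff_divX, hn]
      congr 1
      omega
    obtain ⟨c, M, hc, h⟩ := ih (n - 1) (by omega) p.divX (by rwa [hlc]) hdeg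
    refine ⟨c, max M (max 0 ((c - p.coeff 0) / c)), hc, fun x hx => ?_⟩
    simp only [max_le_iff] at hx
    have h1 := h x hx.1
    have h2 : c - p.coeff 0 ≤ x * c := (div_le_iff₀ hc).1 hx.2.2
    have h3 : x * c ≤ x * p.divX.eval x := mul_le_mul_of_nonneg_left h1 hx.2.1
    have h4 : p.eval x = p.divX.eval x * x + p.coeff 0 := by
      conv_lhs => rw [← p.divX_mul_X_add]
      simp
    rw [h4]
    linarith

theorem Polynomial.exists_forall_ge_sign_eval (p : R[X]) :
    ∃ M : R, ∀ x, M ≤ x → SignType.sign (p.eval x) = SignType.sign p.leadingCoeff := by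
  rcases lt_trichotomy p.leadingCoeff 0 with h | h | h
  · obtain ⟨c, M, hc, hM⟩ := (-p).exists_forall_ge_pos_le_eval (by simpa using h)
    refine ⟨M, fun x hx => ?_⟩
    have := hM x hx
    rw [eval_neg] at this
    rw [sign_neg h, sign_neg (by linarith)]
  · exact ⟨0, fun x _ => by rw [leadingCoeff_eq_zero.1 h]; simp⟩
  · obtain ⟨c, M, hc, hM⟩ := p.exists_forall_ge_pos_le_eval h
    exact ⟨M, fun x hx => by rw [sign_pos h, sign_pos (hc.trans_le (hM x hx))]⟩

end PolynomialIVT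

section SignTransfer

set_option linter.unusedSectionVars false

open Polynomial

variable {k R S : Type*} [Field k] [Field R] [LinearOrder R] [IsStrictOrderedRing R]
  [Field S] [LinearOrder S] [IsStrictOrderedRing S]

theorem PolyIVT.strictMonoOn (hR : PolyIVT R) (p : R[X]) {a b : R}
    (h : ∀ c, a < c → c < b → 0 < (derivative p).eval c) :
    StrictMonoOn p.eval (Set.Icc a b) := by
  intro x hx y hy hxy
  obtain ⟨c, h1, h2, h3⟩ := hR.mean_value p hxy
  have := mul_pos (h c (hx.1.trans_lt h1) (h2.trans_le hy.2)) (sub_pos.2 hxy)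
  change p.eval x < p.eval y
  linarith

theorem exists_between_sign_eval_eq_of_pos (hR : PolyIVT R) (hS : PolyIVT S) (p : R[X]) (q : S[X])
    {a₁ a a₂ : R} {b₁ b₂ : S} (ha₁ : a₁ < a) (ha₂ : a < a₂) (hb : b₁ < b₂)
    (h₁ : SignType.sign (q.eval b₁) = SignType.sign (p.eval a₁))
    (h₂ : SignType.sign (q.eval b₂) = SignType.sign (p.eval a₂))
    (hp : ∀ c, a₁ < c → c < a₂ → 0 < (derivative p).eval c)
    (hq : ∀ c, b₁ < c → c < b₂ → 0 < (derivative q).eval c) :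
    ∃ b, b₁ < b ∧ b < b₂ ∧ SignType.sign (q.eval b) = SignType.sign (p.eval a) := by
  have mp := hR.strictMonoOn p hp
  have mq := hS.strictMonoOn q hq
  have l1 : p.eval a₁ < p.eval a :=
    mp ⟨le_rfl, (ha₁.trans ha₂).le⟩ ⟨ha₁.le, ha₂.le⟩ ha₁
  have l2 : p.eval a < p.eval a₂ :=
    mp ⟨ha₁.le, ha₂.le⟩ ⟨(ha₁.trans ha₂).le, le_rfl⟩ ha₂
  have lq : ∀ x y, b₁ ≤ x → x < y → y ≤ b₂ → q.eval x < q.eval y := fun x y h1 h2 h3 =>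
    mq ⟨h1, h2.le.trans h3⟩ ⟨h1.trans h2.le, h3⟩ h2
  rcases lt_trichotomy (p.eval a) 0 with h | h | h
  · rw [sign_neg (l1.trans h), sign_eq_neg_one_iff] at h₁
    rw [sign_neg h]
    by_cases hb2 : q.eval b₂ ≤ 0
    · exact ⟨(b₁ + b₂) / 2, by linarith, by linarith,
        sign_neg ((lq _ _ (by linarith) (by linarith) le_rfl).trans_le hb2)⟩
    · obtain ⟨c, c1, c2, c3⟩ := hS q b₁ b₂ hb h₁ (not_le.1 hb2)
      exact ⟨(b₁ + c) / 2, by linarith, by linarith,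
        sign_neg ((lq _ c (by linarith) (by linarith) c2.le).trans_eq c3)⟩
  · rw [sign_neg (l1.trans_eq h), sign_eq_neg_one_iff] at h₁
    rw [sign_pos (h.symm.trans_lt l2), sign_eq_one_iff] at h₂
    obtain ⟨c, c1, c2, c3⟩ := hS q b₁ b₂ hb h₁ h₂
    exact ⟨c, c1, c2, by rw [c3, h, sign_zero, sign_zero]⟩
  · rw [sign_pos (h.trans l2), sign_eq_one_iff] at h₂
    rw [sign_pos h]
    by_cases hb1 : 0 ≤ q.eval b₁
    · exact ⟨(b₁ + b₂) / 2, by linarith, by linarith,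
        sign_pos (hb1.trans_lt (lq _ _ le_rfl (by linarith) (by linarith)))⟩
    · obtain ⟨c, c1, c2, c3⟩ := hS q b₁ b₂ hb (not_le.1 hb1) h₂
      exact ⟨(c + b₂) / 2, by linarith, by linarith,
        sign_pos (c3.symm.trans_lt (lq c _ c1.le (by linarith) (by linarith)))⟩

theorem exists_between_sign_eval_eq (hR : PolyIVT R) (hS : PolyIVT S) (p : R[X]) (q : S[X])
    {a₁ a a₂ : R} {b₁ b₂ : S} (ha₁ : a₁ < a) (ha₂ : a < a₂) (hb : b₁ < b₂)
    (h₁ : SignType.sign (q.eval b₁) = SignType.sign (p.eval a₁))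
    (h₂ : SignType.sign (q.eval b₂) = SignType.sign (p.eval a₂))
    (e : SignType) (he : e ≠ 0)
    (hp : ∀ c, a₁ < c → c < a₂ → SignType.sign ((derivative p).eval c) = e)
    (hq : ∀ c, b₁ < c → c < b₂ → SignType.sign ((derivative q).eval c) = e) :
    ∃ b, b₁ < b ∧ b < b₂ ∧ SignType.sign (q.eval b) = SignType.sign (p.eval a) := by
  rcases e.trichotomy with rfl | rfl | rfl
  · obtain ⟨b, h3, h4, h5⟩ := exists_between_sign_eval_eq_of_pos hR hS (-p) (-q) ha₁ ha₂ hb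
      (by simp [Left.sign_neg, h₁]) (by simp [Left.sign_neg, h₂])
      (fun c h1 h2 => by simpa using sign_eq_neg_one_iff.1 (hp c h1 h2))
      (fun c h1 h2 => by simpa using sign_eq_neg_one_iff.1 (hq c h1 h2))
    exact ⟨b, h3, h4, by simpa [Left.sign_neg] using h5⟩
  · exact absurd rfl he
  · exact exists_between_sign_eval_eq_of_pos hR hS p q ha₁ ha₂ hb h₁ h₂
      (fun c h1 h2 => sign_eq_one_iff.1 (hp c h1 h2))
      (fun c h1 h2 => sign_eq_one_iff.1 (hq c h1 h2))

/-- Every finite set of points of `R` can be mapped into `S` preserving the order and the signs of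
the polynomials in `P`. -/
def SignEmb (i : k →+* R) (j : k →+* S) (P : Finset k[X]) : Prop :=
  ∀ A : Finset R, ∃ f : R → S, StrictMonoOn f A ∧ ∀ a ∈ A, ∀ p ∈ P,
    SignType.sign ((p.map j).eval (f a)) = SignType.sign ((p.map i).eval a)

open Classical in
/-- The roots in `R` of the nonzero members of a finite set of polynomials. -/
def rootsIn (i : k →+* R) (P : Finset k[X]) : Finset R :=
  P.biUnion fun p => (p.map i).roots.toFinset

theorem mem_rootsIn (i : k →+* R) (P : Finset k[X]) (x : R) :
    x ∈ rootsIn i P ↔ ∃ p ∈ P, p ≠ 0 ∧ (p.map i).eval x = 0 := by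
  classical
  simp [rootsIn, Polynomial.map_ne_zero_iff i.injective]

theorem SignEmb.mono {i : k →+* R} {j : k →+* S} {P Q : Finset k[X]} (h : SignEmb i j Q)
    (hPQ : P ⊆ Q) : SignEmb i j P := fun A => by
  obtain ⟨f, h1, h2⟩ := h A
  exact ⟨f, h1, fun a ha p hp => h2 a ha p (hPQ hp)⟩

theorem map_mem_rootsIn {i : k →+* R} {j : k →+* S} {P : Finset k[X]} {a : R} {b : S}
    (h : ∀ p ∈ P, SignType.sign ((p.map j).eval b) = SignType.sign ((p.map i).eval a))
    (ha : a ∈ rootsIn i P) : b ∈ rootsIn j P := by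
  rw [mem_rootsIn] at ha ⊢
  obtain ⟨p, hp, hp0, h0⟩ := ha
  refine ⟨p, hp, hp0, ?_⟩
  have := h p hp
  rwa [h0, sign_zero, sign_eq_zero_iff] at this

theorem SignEmb.card_rootsIn_le {i : k →+* R} {j : k →+* S} {P : Finset k[X]}
    (h : SignEmb i j P) : (rootsIn i P).card ≤ (rootsIn j P).card := by
  obtain ⟨f, h1, h2⟩ := h (rootsIn i P)
  exact Finset.card_le_card_of_injOn f (fun a ha => map_mem_rootsIn (h2 a ha) ha) h1.injOn

theorem SignEmb.exists_surjOn_rootsIn {i : k →+* R} {j : k →+* S} {P Q : Finset k[X]}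
    (h : SignEmb i j Q) (h' : SignEmb j i Q) (hPQ : P ⊆ Q) (A : Finset R) :
    ∃ f : R → S, StrictMonoOn f (A ∪ rootsIn i P : Set R) ∧
      (∀ a ∈ (A ∪ rootsIn i P : Set R), ∀ p ∈ Q,
        SignType.sign ((p.map j).eval (f a)) = SignType.sign ((p.map i).eval a)) ∧
      Set.SurjOn f (rootsIn i P) (rootsIn j P) := by
  classical
  obtain ⟨f, h1, h2⟩ := h (A ∪ rootsIn i P)
  refine ⟨f, by simpa using h1, by simpa using h2, ?_⟩
  have h3 : ((rootsIn i P).image f) = rootsIn j P := by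
    apply Finset.eq_of_subset_of_card_le
    · intro b hb
      obtain ⟨a, ha, rfl⟩ := Finset.mem_image.1 hb
      exact map_mem_rootsIn (fun p hp => h2 a (Finset.mem_union_right _ ha) p (hPQ hp)) ha
    · rw [Finset.card_image_of_injOn (h1.injOn.mono (by simp))]
      exact (h'.mono hPQ).card_rootsIn_le
  intro b hb
  rw [← h3] at hb
  simpa using hb

theorem sign_eval_mod (i : k →+* R) (p q : k[X]) {x : R} (hx : (q.map i).eval x = 0) :
    (p.map i).eval x = ((p % q).map i).eval x := by
  conv_lhs => rw [← EuclideanDomain.div_add_mod p q]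
  simp [hx]

/-- Far away from the origin, signs are determined by the leading coefficients. -/
theorem exists_bounds_sign_eval (i : k →+* R) (j : k →+* S)
    (hij : ∀ c, SignType.sign (j c) = SignType.sign (i c)) (P : Finset k[X]) :
    ∃ (M : R) (N : S), ∀ x y, M ≤ x → N ≤ y → ∀ p ∈ P,
      SignType.sign ((p.map j).eval y) = SignType.sign ((p.map i).eval x) ∧
      SignType.sign ((p.map j).eval (-y)) = SignType.sign ((p.map i).eval (-x)) := by
  classical
  induction P using Finset.induction_on with
  | empty => exact ⟨0, 0, by simp⟩
  | insert p P _ ih =>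
    obtain ⟨M, N, h⟩ := ih
    obtain ⟨M1, hM1⟩ := (p.map i).exists_forall_ge_sign_eval
    obtain ⟨N1, hN1⟩ := (p.map j).exists_forall_ge_sign_eval
    obtain ⟨M2, hM2⟩ := ((p.comp (-X)).map i).exists_forall_ge_sign_eval
    obtain ⟨N2, hN2⟩ := ((p.comp (-X)).map j).exists_forall_ge_sign_eval
    refine ⟨max M (max M1 M2), max N (max N1 N2), fun x y hx hy q hq => ?_⟩
    simp only [max_le_iff] at hx hy
    rcases Finset.mem_insert.1 hq with rfl | hq
    · constructor
      · rw [hM1 x hx.2.1, hN1 y hy.2.1, leadingCoeff_map, leadingCoeff_map, hij]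
      · have h1 := hM2 x hx.2.2
        have h2 := hN2 y hy.2.2
        rw [leadingCoeff_map] at h1 h2
        rw [hij, ← h1] at h2
        simpa [Polynomial.map_comp] using h2
    · exact h x y hx.1 hy.1 q hq

end SignTransfer

section SignTransferStep

set_option linter.unusedSectionVars false

open Polynomial

variable {k R S : Type*} [Field k] [Field R] [LinearOrder R] [IsStrictOrderedRing R]
  [Field S] [LinearOrder S] [IsStrictOrderedRing S]

theorem PolyIVT.sign_eq (hR : PolyIVT R) (p : R[X]) {a b : R}
    (h : ∀ c, min a b ≤ c → c ≤ max a b → p.eval c ≠ 0) :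
    SignType.sign (p.eval a) = SignType.sign (p.eval b) := by
  rcases lt_trichotomy a b with hab | rfl | hab
  · exact hR.sign_eq_of_lt p hab (by simpa [hab.le] using h)
  · rfl
  · exact (hR.sign_eq_of_lt p hab (by simpa [hab.le] using h)).symm

/-- If no root of a member of `P` lies between `a` and `b`, the members of `P` have the same signs
at `a` and `b`. -/
theorem PolyIVT.sign_eq_of_rootsIn (hR : PolyIVT R) (i : k →+* R) {P : Finset k[X]} {a b : R}
    (h : ∀ c ∈ rootsIn i P, min a b ≤ c → c ≤ max a b → False) {p : k[X]} (hp : p ∈ P) :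
    SignType.sign ((p.map i).eval a) = SignType.sign ((p.map i).eval b) := by
  by_cases hp0 : p = 0
  · simp [hp0]
  · exact hR.sign_eq _ fun c h1 h2 h3 => h c ((mem_rootsIn i P c).2 ⟨p, hp, hp0, h3⟩) h1 h2

/-- A sign preserving map on a finite set containing the relevant roots extends to one more
point. -/
theorem exists_extend_sign_preserving (hR : PolyIVT R) (hS : PolyIVT S) (i : k →+* R) (j : k →+* S)
    {P : Finset k[X]} {p : k[X]} (hder : derivative p ∈ P) (hder0 : derivative p ≠ 0)
    {D : Finset R} {f g : R → S} {a : R} (hZ : rootsIn i P ⊆ D) (ha : a ∉ D)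
    (hlo : ∃ x ∈ D, x < a) (hhi : ∃ x ∈ D, a < x)
    (hf : StrictMonoOn f D) (hfp : ∀ x ∈ D,
      SignType.sign ((p.map j).eval (f x)) = SignType.sign ((p.map i).eval x))
    (hg : StrictMonoOn g (insert a (rootsIn i P : Set R)))
    (hgs : ∀ q ∈ P, SignType.sign ((q.map j).eval (g a)) = SignType.sign ((q.map i).eval a))
    (hfg : ∀ x ∈ rootsIn i P, f x = g x)
    (hsurj : Set.SurjOn g (rootsIn i P) (rootsIn j P)) :
    ∃ b, (∀ x ∈ D, x < a → f x < b) ∧ (∀ x ∈ D, a < x → b < f x) ∧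
      ∀ q ∈ insert p (P : Set k[X]),
        SignType.sign ((q.map j).eval b) = SignType.sign ((q.map i).eval a) := by
  classical
  obtain ⟨a₁, ha₁, hmax⟩ := Finset.exists_max_image (D.filter (· < a)) id
    (by obtain ⟨x, h1, h2⟩ := hlo; exact ⟨x, by simp [h1, h2]⟩)
  obtain ⟨a₂, ha₂, hmin⟩ := Finset.exists_min_image (D.filter (a < ·)) id
    (by obtain ⟨x, h1, h2⟩ := hhi; exact ⟨x, by simp [h1, h2]⟩)
  simp only [Finset.mem_filter, id_eq, and_imp] at ha₁ ha₂ hmax hmin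
  have hmem : ∀ z ∈ rootsIn i P, z ≤ a₁ ∨ a₂ ≤ z := fun z hz => by
    rcases lt_trichotomy z a with h | rfl | h
    · exact Or.inl (hmax z (hZ hz) h)
    · exact absurd (hZ hz) ha
    · exact Or.inr (hmin z (hZ hz) h)
  have hb : f a₁ < f a₂ := hf ha₁.1 ha₂.1 (ha₁.2.trans ha₂.2)
  have hsR : ∀ c, a₁ < c → c < a₂ → ∀ q ∈ P,
      SignType.sign ((q.map i).eval c) = SignType.sign ((q.map i).eval a) := by
    intro c h1 h2 q hq
    refine hR.sign_eq_of_rootsIn i (fun z hz h3 h4 => ?_) hq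
    rcases hmem z hz with h5 | h5
    · exact absurd (h3.trans h5) (not_le.2 (lt_min h1 ha₁.2))
    · exact absurd (h5.trans h4) (not_le.2 (max_lt h2 ha₂.2))
  have hsS : ∀ c, f a₁ < c → c < f a₂ → ∀ q ∈ P,
      SignType.sign ((q.map j).eval c) = SignType.sign ((q.map i).eval a) := by
    intro c h1 h2 q hq
    rw [← hgs q hq]
    refine hS.sign_eq_of_rootsIn j (fun w hw h3 h4 => ?_) hq
    obtain ⟨z, hz, rfl⟩ := hsurj hw
    have hz' : z ∈ rootsIn i P := hz
    rcases hmem z hz' with h5 | h5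
    · have h6 : g z < g a := hg (Set.mem_insert_of_mem _ hz) (Set.mem_insert _ _)
        (h5.trans_lt ha₁.2)
      have h7 : g z ≤ f a₁ := by
        rw [← hfg z hz']
        exact hf.monotoneOn (hZ hz') ha₁.1 h5
      exact absurd h3 (not_le.2 (lt_min (h7.trans_lt h1) h6))
    · have h6 : g a < g z := hg (Set.mem_insert _ _) (Set.mem_insert_of_mem _ hz)
        (ha₂.2.trans_le h5)
      have h7 : f a₂ ≤ g z := by
        rw [← hfg z hz']
        exact hf.monotoneOn ha₂.1 (hZ hz') h5
      exact absurd h4 (not_le.2 (max_lt (h2.trans_le h7) h6))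
  have he : SignType.sign (((derivative p).map i).eval a) ≠ 0 := by
    intro h
    exact ha (hZ ((mem_rootsIn i P a).2 ⟨_, hder, hder0, sign_eq_zero_iff.1 h⟩))
  obtain ⟨b, h1, h2, h3⟩ := exists_between_sign_eval_eq hR hS (p.map i) (p.map j) ha₁.2 ha₂.2 hb
    (hfp _ ha₁.1) (hfp _ ha₂.1) _ he
    (fun c h1 h2 => by rw [derivative_map]; exact hsR c h1 h2 _ hder)
    (fun c h1 h2 => by rw [derivative_map]; exact hsS c h1 h2 _ hder)
  refine ⟨b, fun x hx hxa => ?_, fun x hx hxa => ?_, fun q hq => ?_⟩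
  · exact (hf.monotoneOn hx ha₁.1 (hmax x hx hxa)).trans_lt h1
  · exact h2.trans_le (hf.monotoneOn ha₂.1 hx (hmin x hx hxa))
  · rcases hq with rfl | hq
    · exact h3
    · exact hsS b h1 h2 q hq

theorem SignEmb.insert_of_derivative [DecidableEq k[X]] (hR : PolyIVT R) (hS : PolyIVT S)
    {i : k →+* R} {j : k →+* S}
    (hij : ∀ c, SignType.sign (j c) = SignType.sign (i c)) {P Q : Finset k[X]} {p : k[X]}
    (hder : derivative p ∈ P) (hder0 : derivative p ≠ 0) (hPQ : P ⊆ Q)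
    (hmod : ∀ q ∈ P, q ≠ 0 → p % q ∈ Q) (h : SignEmb i j Q) (h' : SignEmb j i Q) :
    SignEmb i j (insert p P) := by
  classical
  intro A
  obtain ⟨M₀, N₀, hMN⟩ := exists_bounds_sign_eval i j hij (insert p P)
  obtain ⟨g, hg, hgs, hsurj⟩ := h.exists_surjOn_rootsIn h' hPQ A
  set Z := rootsIn i P with hZ
  obtain ⟨M, hM⟩ : ∃ M, M₀ ≤ M ∧ 0 < M ∧ ∀ x ∈ A ∪ Z, |x| < M := by
    obtain ⟨M1, hM1⟩ := ((A ∪ Z).image fun x => |x|).bddAbove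
    refine ⟨max M₀ (max 0 M1) + 1, ?_, ?_, fun x hx => ?_⟩
    · linarith [le_max_left M₀ (max 0 M1)]
    · linarith [le_max_right M₀ (max 0 M1), le_max_left 0 M1]
    · have : |x| ≤ M1 := hM1 (by simpa using ⟨x, by simpa using hx, rfl⟩)
      linarith [le_max_right M₀ (max 0 M1), le_max_right 0 M1]
  obtain ⟨N, hN⟩ : ∃ N, N₀ ≤ N ∧ 0 < N ∧ ∀ x ∈ Z, |g x| < N := by
    obtain ⟨M1, hM1⟩ := (Z.image fun x => |g x|).bddAbove
    refine ⟨max N₀ (max 0 M1) + 1, ?_, ?_, fun x hx => ?_⟩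
    · linarith [le_max_left N₀ (max 0 M1)]
    · linarith [le_max_right N₀ (max 0 M1), le_max_left 0 M1]
    · have : |g x| ≤ M1 := hM1 (by simpa using ⟨x, by simpa using hx, rfl⟩)
      linarith [le_max_right N₀ (max 0 M1), le_max_right 0 M1]
  obtain ⟨hM0, hMpos, hMA⟩ := hM
  obtain ⟨hN0, hNpos, hNZ⟩ := hN
  suffices H : ∀ B : Finset R, B ⊆ A → ∃ f : R → S,
      StrictMonoOn f (insert M (insert (-M) (Z ∪ B)) : Finset R) ∧
      (∀ x ∈ (insert M (insert (-M) (Z ∪ B)) : Finset R), ∀ q ∈ insert p P,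
        SignType.sign ((q.map j).eval (f x)) = SignType.sign ((q.map i).eval x)) ∧
      ∀ x ∈ Z, f x = g x by
    obtain ⟨f, h1, h2, -⟩ := H A subset_rfl
    exact ⟨f, h1.mono fun x hx => by simp at hx; simp [hx],
      fun a ha => h2 a (by simp [ha])⟩
  intro B
  induction B using Finset.induction_on with
  | empty =>
    intro _
    have hZM : ∀ x ∈ Z, -M < x ∧ x < M := fun x hx =>
      abs_lt.1 (hMA x (Finset.mem_union_right _ hx))
    have hZN : ∀ x ∈ Z, -N < g x ∧ g x < N := fun x hx => abs_lt.1 (hNZ x hx)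
    have hMM : -M ≠ M := by linarith
    let f : R → S := fun x => if x = M then N else if x = -M then -N else g x
    have fM : f M = N := if_pos rfl
    have fM' : f (-M) = -N := by simp [f, hMM]
    have fZ : ∀ x ∈ Z, f x = g x := fun x hx => by
      have := hZM x hx
      simp [f, this.1.ne', this.2.ne]
    refine ⟨f, ?_, ?_, fZ⟩
    · intro x hx y hy hxy
      simp only [Finset.union_empty, Finset.coe_insert, Set.mem_insert_iff, Finset.mem_coe]
        at hx hy
      rcases hx with rfl | rfl | hx <;> rcases hy with rfl | rfl | hy
      · exact absurd hxy (lt_irrefl _)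
      · linarith
      · linarith [hZM y hy]
      · rw [fM, fM']; linarith
      · exact absurd hxy (lt_irrefl _)
      · rw [fM', fZ y hy]; exact (hZN y hy).1
      · rw [fM, fZ x hx]; exact (hZN x hx).2
      · linarith [hZM x hx]
      · rw [fZ x hx, fZ y hy]
        exact hg (by simp [hx]) (by simp [hy]) hxy
    · intro x hx q hq
      simp only [Finset.union_empty, Finset.mem_insert] at hx
      rcases hx with rfl | rfl | hx
      · rw [fM]; exact (hMN _ _ hM0 hN0 q hq).1
      · rw [fM']; exact (hMN _ _ hM0 hN0 q hq).2
      · rw [fZ x hx]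
        have hxA : x ∈ (A ∪ Z : Set R) := by simp [hx]
        rcases Finset.mem_insert.1 hq with rfl | hq
        · obtain ⟨r, hr, hr0, hrx⟩ := (mem_rootsIn i P x).1 hx
          have hgr : (r.map j).eval (g x) = 0 := by
            have := hgs x hxA r (hPQ hr)
            rwa [hrx, sign_zero, sign_eq_zero_iff] at this
          rw [sign_eval_mod i q r hrx, sign_eval_mod j q r hgr]
          exact hgs x hxA _ (hmod r hr hr0)
        · exact hgs x hxA q (hPQ hq)
  | insert a B _ ih =>
    intro hBA
    obtain ⟨f, hf, hfs, hfg⟩ := ih fun x hx => hBA (Finset.mem_insert_of_mem hx)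
    set D : Finset R := insert M (insert (-M) (Z ∪ B)) with hD
    have hDa : (insert M (insert (-M) (Z ∪ insert a B)) : Finset R) = insert a D := by
      ext x; simp [hD]; tauto
    rw [hDa]
    by_cases haD : a ∈ D
    · rw [Finset.insert_eq_of_mem haD]
      exact ⟨f, hf, hfs, hfg⟩
    have haA : a ∈ A := hBA (Finset.mem_insert_self _ _)
    have haM := abs_lt.1 (hMA a (Finset.mem_union_left _ haA))
    have hZD : Z ⊆ D := fun x hx => by simp [hD, hx]
    obtain ⟨b, hb1, hb2, hb3⟩ := exists_extend_sign_preserving hR hS i j hder hder0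
      (D := D) (f := f) (g := g) (a := a)
      hZD haD ⟨-M, by simp [hD], haM.1⟩ ⟨M, by simp [hD], haM.2⟩ hf
      (fun x hx => hfs x hx p (Finset.mem_insert_self _ _))
      (hg.mono (by
        intro x hx
        rcases hx with rfl | hx
        · simp [haA]
        · exact Or.inr hx))
      (fun q hq => hgs a (by simp [haA]) q (hPQ hq)) hfg hsurj
    have hne : ∀ x ∈ D, x ≠ a := fun x hx h => haD (h ▸ hx)
    refine ⟨Function.update f a b, ?_, ?_, ?_⟩
    · intro x hx y hy hxy
      simp only [Finset.coe_insert, Set.mem_insert_iff, Finset.mem_coe] at hx hy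
      rcases hx with rfl | hx <;> rcases hy with rfl | hy
      · exact absurd hxy (lt_irrefl _)
      · rw [Function.update_self, Function.update_of_ne (hne y hy)]
        exact hb2 y hy hxy
      · rw [Function.update_self, Function.update_of_ne (hne x hx)]
        exact hb1 x hx hxy
      · rw [Function.update_of_ne (hne x hx), Function.update_of_ne (hne y hy)]
        exact hf hx hy hxy
    · intro x hx q hq
      rcases Finset.mem_insert.1 hx with rfl | hx
      · rw [Function.update_self]
        exact hb3 q (by simpa using hq)
      · rw [Function.update_of_ne (hne x hx)]
        exact hfs x hx q hq
    · intro x hx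
      rw [Function.update_of_ne (hne x (hZD hx))]
      exact hfg x hx

theorem signEmb_of_natDegree_eq_zero (i : k →+* R) (j : k →+* S)
    (hij : ∀ c, SignType.sign (j c) = SignType.sign (i c)) (P : Finset k[X])
    (hP : ∀ p ∈ P, p.natDegree = 0) : SignEmb i j P := by
  intro A
  obtain ⟨e⟩ := Order.embedding_from_countable_to_dense (α := A) (β := S)
  refine ⟨fun x => if h : x ∈ A then e ⟨x, h⟩ else 0, ?_, ?_⟩
  · intro x hx y hy hxy
    have hx' : x ∈ A := hx
    have hy' : y ∈ A := hy
    simp only [hx', hy', dif_pos]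
    exact e.strictMono hxy
  · intro a _ p hp
    rw [eq_C_of_natDegree_eq_zero (hP p hp)]
    simp [hij]

/-- Finite sets of points can be transferred between ordered fields with the intermediate value
property, preserving the signs of finitely many polynomials. -/
theorem PolyIVT.signEmb [CharZero k] (hR : PolyIVT R) (hS : PolyIVT S) (i : k →+* R) (j : k →+* S)
    (hij : ∀ c, SignType.sign (j c) = SignType.sign (i c)) (P : Finset k[X]) :
    SignEmb i j P := by
  classical
  suffices H : ∀ n : ℕ, ∀ P : Finset k[X], (∀ p ∈ P, p.natDegree ≤ n) →
      SignEmb i j P ∧ SignEmb j i P from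
    (H (P.sup natDegree) P fun p hp => Finset.le_sup hp).1
  intro n
  induction n with
  | zero =>
    intro P hP
    exact ⟨signEmb_of_natDegree_eq_zero i j hij P fun p hp => by simpa using hP p hp,
      signEmb_of_natDegree_eq_zero j i (fun c => (hij c).symm) P fun p hp => by simpa using hP p hp⟩
  | succ n ih =>
    suffices H : ∀ H L : Finset k[X], (∀ p ∈ H, p.natDegree = n + 1) → (∀ p ∈ L, p.natDegree ≤ n) →
        SignEmb i j (H ∪ L) ∧ SignEmb j i (H ∪ L) by
      intro P hP
      have := H (P.filter fun p => p.natDegree = n + 1) (P.filter fun p => ¬ p.natDegree = n + 1)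
        (by simp) (by
          intro p hp
          rw [Finset.mem_filter] at hp
          have := hP p hp.1
          omega)
      rwa [Finset.filter_union_filter_not_eq] at this
    intro H
    induction H using Finset.induction_on with
    | empty => intro L _ hL; simpa using ih L hL
    | insert p H hpH ihH =>
      intro L hH hL
      have hp : p.natDegree = n + 1 := hH p (Finset.mem_insert_self _ _)
      have hH' : ∀ q ∈ H, q.natDegree = n + 1 := fun q hq => hH q (Finset.mem_insert_of_mem hq)
      set Q : Finset k[X] := H ∪ insert (derivative p) L with hQ
      have hdeg : ∀ q ∈ Q, q.natDegree ≤ n + 1 := by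
        intro q hq
        simp only [hQ, Finset.mem_union, Finset.mem_insert] at hq
        rcases hq with hq | rfl | hq
        · exact (hH' q hq).le
        · have := natDegree_derivative_le p
          omega
        · exact (hL q hq).trans (Nat.le_succ n)
      obtain ⟨h1, h2⟩ := ihH (insert (derivative p) L ∪ (Q.erase 0).image (p % ·)) hH' (by
        intro q hq
        simp only [Finset.mem_union, Finset.mem_insert, Finset.mem_image, Finset.mem_erase] at hq
        rcases hq with (rfl | hq) | ⟨r, ⟨hr0, hr⟩, rfl⟩
        · have := natDegree_derivative_le p
          omega
        · exact hL q hq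
        · by_cases hr1 : r.natDegree = 0
          · have hu : IsUnit r := by
              rw [eq_C_of_natDegree_eq_zero hr1] at hr0 ⊢
              exact isUnit_C.2 (isUnit_iff_ne_zero.2 (by simpa using hr0))
            rw [(EuclideanDomain.mod_eq_zero).2 hu.dvd]
            simp
          · have := natDegree_mod_lt p hr1
            have := hdeg r hr
            omega)
      have hder0 : derivative p ≠ 0 := fun h0 => by
        have := derivative_eq_zero.1 h0
        omega
      have hsub : insert p H ∪ L ⊆ insert p Q := by
        intro q hq
        simp only [hQ, Finset.mem_union, Finset.mem_insert] at hq ⊢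
        tauto
      have hQsub : Q ⊆ H ∪ (insert (derivative p) L ∪ (Q.erase 0).image (p % ·)) := by
        intro q hq
        rw [hQ] at hq
        simp only [Finset.mem_union] at hq ⊢
        tauto
      have hmod : ∀ q ∈ Q, q ≠ 0 →
          p % q ∈ H ∪ (insert (derivative p) L ∪ (Q.erase 0).image (p % ·)) := fun q hq hq0 => by
        refine Finset.mem_union_right _ (Finset.mem_union_right _ ?_)
        exact Finset.mem_image_of_mem _ (Finset.mem_erase.2 ⟨hq0, hq⟩)
      have hdQ : derivative p ∈ Q := by simp [hQ]
      exact ⟨(SignEmb.insert_of_derivative hR hS hij hdQ hder0 hQsub hmod h1 h2).mono hsub,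
        (SignEmb.insert_of_derivative hS hR (fun c => (hij c).symm) hdQ hder0 hQsub hmod
          h2 h1).mono hsub⟩

end SignTransferStep

section RealClosure

open Polynomial

/-- An ordering of a field in which the nonnegative elements are exactly the squares. -/
theorem exists_linearOrder_of_isSquare {E : Type*} [Field E]
    (hadd : ∀ a b : E, IsSquare a → IsSquare b → IsSquare (a + b))
    (htot : ∀ a : E, IsSquare a ∨ IsSquare (-a)) (hneg : ¬ IsSquare (-1 : E)) :
    ∃ (_ : LinearOrder E), IsStrictOrderedRing E ∧ ∀ x : E, 0 ≤ x ↔ IsSquare x := by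
  classical
  let C : RingCone E :=
    { carrier := {x | IsSquare x}
      mul_mem' := fun ha hb => IsSquare.mul ha hb
      one_mem' := IsSquare.one
      add_mem' := fun ha hb => hadd _ _ ha hb
      zero_mem' := IsSquare.zero
      eq_zero_of_mem_of_neg_mem' := by
        intro a ha hb
        by_contra h0
        apply hneg
        have : (-1 : E) = -a * a / (a * a) := by field_simp
        rw [this]
        exact (IsSquare.mul hb ha).div ⟨a, rfl⟩ }
  have : HasMemOrNegMem C := ⟨fun a => htot a⟩
  let o : LinearOrder E := LinearOrder.mkOfAddGroupCone C
  have : IsOrderedRing E := IsOrderedRing.mkOfCone C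
  refine ⟨o, IsOrderedRing.toIsStrictOrderedRing E, fun x => ?_⟩
  change x - 0 ∈ C ↔ _
  rw [sub_zero]
  rfl

variable {Ω : Type*} [Field Ω]

/-- The quadratic module generated by `T` in the subfield `E`. -/
def sqCone (T : Submonoid Ω) (E : Subfield Ω) : AddSubmonoid Ω :=
  AddSubmonoid.closure {y | ∃ t ∈ T, ∃ x ∈ E, y = t * x ^ 2}

theorem sqCone_mul_mem {T : Submonoid Ω} {E : Subfield Ω} {a b : Ω} (ha : a ∈ sqCone T E)
    (hb : b ∈ sqCone T E) : a * b ∈ sqCone T E := by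
  unfold sqCone at ha hb
  induction ha using AddSubmonoid.closure_induction with
  | mem x hx =>
    obtain ⟨t, ht, x, hx, rfl⟩ := hx
    induction hb using AddSubmonoid.closure_induction with
    | mem y hy =>
      obtain ⟨u, hu, y, hy, rfl⟩ := hy
      exact AddSubmonoid.subset_closure ⟨t * u, T.mul_mem ht hu, x * y, E.mul_mem hx hy, by ring⟩
    | zero => simp
    | add y z _ _ h1 h2 => rw [mul_add]; exact add_mem h1 h2
  | zero => simp
  | add y z _ _ h1 h2 => rw [add_mul]; exact add_mem h1 h2

theorem sq_mem_sqCone {T : Submonoid Ω} {E : Subfield Ω} {x : Ω} (hx : x ∈ E) :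
    x ^ 2 ∈ sqCone T E :=
  AddSubmonoid.subset_closure ⟨1, T.one_mem, x, hx, by ring⟩

theorem mem_sqCone_of_mem {T : Submonoid Ω} {E : Subfield Ω} {t : Ω} (ht : t ∈ T) :
    t ∈ sqCone T E :=
  AddSubmonoid.subset_closure ⟨t, ht, 1, E.one_mem, by ring⟩

theorem sqCone_mono {T : Submonoid Ω} {E F : Subfield Ω} (h : E ≤ F) : sqCone T E ≤ sqCone T F :=
  AddSubmonoid.closure_mono (by
    rintro _ ⟨t, ht, x, hx, rfl⟩
    exact ⟨t, ht, x, h hx, rfl⟩)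

/-- The polynomial analogue of `sqCone`, with a degree bound. -/
def polyCone (T : Submonoid Ω) (E : Subfield Ω) (d : ℕ) : AddSubmonoid E[X] :=
  AddSubmonoid.closure {y | ∃ t : E, (t : Ω) ∈ T ∧ ∃ g : E[X], g.natDegree ≤ d ∧ y = C t * g ^ 2}

theorem natDegree_le_of_mem_polyCone {T : Submonoid Ω} {E : Subfield Ω} {d : ℕ} {G : E[X]}
    (hG : G ∈ polyCone T E d) : G.natDegree ≤ 2 * d := by
  unfold polyCone at hG
  induction hG using AddSubmonoid.closure_induction with
  | mem y hy =>
    obtain ⟨t, -, g, hg, rfl⟩ := hy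
    refine (natDegree_C_mul_le _ _).trans (natDegree_pow_le.trans ?_)
    omega
  | zero => simp
  | add y z _ _ h1 h2 => exact (natDegree_add_le _ _).trans (max_le h1 h2)

theorem eval_mem_of_mem_polyCone {T : Submonoid Ω} {E : Subfield Ω} {d : ℕ} {G : E[X]}
    (hG : G ∈ polyCone T E d) (x : E) : ((G.eval x : E) : Ω) ∈ sqCone T E := by
  unfold polyCone at hG
  induction hG using AddSubmonoid.closure_induction with
  | mem y hy =>
    obtain ⟨t, ht, g, hg, rfl⟩ := hy
    exact AddSubmonoid.subset_closure ⟨t, ht, _, (g.eval x).2, by simp⟩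
  | zero => simp
  | add y z _ _ h1 h2 => simpa using add_mem h1 h2

theorem coeff_mem_of_mem_polyCone {T : Submonoid Ω} {E : Subfield Ω} {d : ℕ} {G : E[X]}
    (hG : G ∈ polyCone T E d) : ((G.coeff (2 * d) : E) : Ω) ∈ sqCone T E := by
  unfold polyCone at hG
  induction hG using AddSubmonoid.closure_induction with
  | mem y hy =>
    obtain ⟨t, ht, g, hg, rfl⟩ := hy
    refine AddSubmonoid.subset_closure ⟨t, ht, _, (g.coeff d).2, ?_⟩
    rw [coeff_C_mul, coeff_pow_of_natDegree_le hg]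
    simp
  | zero => simp
  | add y z _ _ h1 h2 => simpa using add_mem h1 h2

/-- `E` is maximal among the subfields whose quadratic module generated by `T` is proper. -/
structure IsMaxProper (T : Submonoid Ω) (E : Subfield Ω) : Prop where
  mem : ∀ t ∈ T, t ∈ E
  neg_one_notMem : (-1 : Ω) ∉ sqCone T E
  le_of_ge : ∀ F : Subfield Ω, E ≤ F → (-1 : Ω) ∉ sqCone T F → F ≤ E

namespace IsMaxProper

variable {T : Submonoid Ω} {E : Subfield Ω}

theorem exists_dvd (hE : IsMaxProper T E) [IsAlgClosed Ω] {p : E[X]} (hp : Irreducible p) {d : ℕ}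
    (hd : p.natDegree = d + 1) (hd0 : 0 < d) : ∃ G ∈ polyCone T E d, p ∣ 1 + G := by
  obtain ⟨θ, hθ⟩ := IsAlgClosed.exists_aeval_eq_zero Ω p
    (by rw [degree_eq_natDegree hp.ne_zero, hd]; exact_mod_cast (Nat.succ_ne_zero d))
  have hdvd : ∀ q : E[X], aeval θ q = 0 → p ∣ q := by
    intro q hq
    have h1 := minpoly.dvd E θ hq
    have h2 := minpoly.dvd E θ hθ
    have h3 : ¬ IsUnit (minpoly E θ) :=
      minpoly.not_isUnit E θ
    exact ((hp.dvd_iff.1 h2).resolve_left h3).dvd.trans h1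
  have hθalg : IsAlgebraic E θ := ⟨p, hp.ne_zero, hθ⟩
  have hθE : θ ∉ E := by
    intro h
    have h1 : p ∣ X - C ⟨θ, h⟩ := hdvd _ (by simp [Subfield.algebraMap_ofSubfield])
    have h2 := natDegree_le_of_dvd h1 (X_sub_C_ne_zero _)
    rw [natDegree_X_sub_C] at h2
    omega
  let F := (IntermediateField.adjoin E {θ}).toSubfield
  have hEF : E ≤ F := by
    intro x hx
    exact (IntermediateField.adjoin E {θ}).algebraMap_mem ⟨x, hx⟩
  have hF : (-1 : Ω) ∈ sqCone T F := by
    by_contra h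
    exact hθE (hE.le_of_ge F hEF h (IntermediateField.mem_adjoin_simple_self E θ))
  have key : ∀ y ∈ sqCone T F, ∃ G ∈ polyCone T E d, aeval θ G = y := by
    intro y hy
    unfold sqCone at hy
    induction hy using AddSubmonoid.closure_induction with
    | mem y hy =>
      obtain ⟨t, ht, x, hx, rfl⟩ := hy
      have hx' : x ∈ (IntermediateField.adjoin E {θ}).toSubalgebra := hx
      rw [IntermediateField.adjoin_simple_toSubalgebra_of_isAlgebraic hθalg,
        Algebra.adjoin_singleton_eq_range_aeval] at hx'
      obtain ⟨g, rfl⟩ := hx'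
      have hgm : aeval θ (g % p) = aeval θ g := by
        conv_rhs => rw [← EuclideanDomain.div_add_mod g p]
        simp [hθ]
      refine ⟨C ⟨t, hE.mem t ht⟩ * (g % p) ^ 2, AddSubmonoid.subset_closure
        ⟨_, ht, g % p, ?_, rfl⟩, ?_⟩
      · have := natDegree_mod_lt g (q := p) (by omega)
        omega
      · rw [map_mul, map_pow, aeval_C, hgm]
        rfl
    | zero => exact ⟨0, zero_mem _, by simp⟩
    | add y z _ _ h1 h2 =>
      obtain ⟨G, hG, rfl⟩ := h1
      obtain ⟨H, hH, rfl⟩ := h2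
      exact ⟨G + H, add_mem hG hH, by simp⟩
  obtain ⟨G, hG, h⟩ := key _ hF
  exact ⟨G, hG, hdvd _ (by simp [h])⟩

theorem exists_of_not_isSquare (hE : IsMaxProper T E) [IsAlgClosed Ω] {a : E} (ha : ¬ IsSquare a) :
    ∃ u v : Ω, u ∈ sqCone T E ∧ v ∈ sqCone T E ∧ 1 + v = -(a * u) := by
  have hdeg : (X ^ 2 - C a : E[X]).natDegree = 2 := natDegree_X_pow_sub_C
  have hirr : Irreducible (X ^ 2 - C a : E[X]) := by
    refine irreducible_of_degree_le_three_of_not_isRoot (by rw [hdeg]; simp) fun x hx => ?_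
    refine ha ⟨x, ?_⟩
    simp only [IsRoot.def, eval_sub, eval_pow, eval_X, eval_C] at hx
    rw [← sub_eq_zero.1 hx, sq]
  obtain ⟨G, hG, h, hh⟩ := hE.exists_dvd hirr (d := 1) hdeg one_pos
  have hGdeg := natDegree_le_of_mem_polyCone hG
  have hX : (X ^ 2 - C a : E[X]) ≠ 0 := hirr.ne_zero
  have hh0 : h.natDegree = 0 := by
    by_cases h0 : h = 0
    · simp [h0]
    have h1 := natDegree_mul hX h0
    rw [← hh, hdeg] at h1
    have h2 : (1 + G).natDegree ≤ 2 := (natDegree_add_le _ _).trans (by simpa using hGdeg)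
    omega
  rw [eq_C_of_natDegree_eq_zero hh0] at hh
  set w := h.coeff 0
  have h2 : G.coeff 2 = w := by
    have := congrArg (fun q => q.coeff 2) hh
    simpa [sub_mul, coeff_one] using this
  have h0 : 1 + G.eval 0 = - (a * w) := by
    have := congrArg (fun q => q.eval 0) hh
    simpa using this
  refine ⟨(w : Ω), ((G.eval 0 : E) : Ω), ?_, eval_mem_of_mem_polyCone hG 0, ?_⟩
  · rw [← h2]
    exact coeff_mem_of_mem_polyCone hG
  · exact_mod_cast congrArg (fun x : E => (x : Ω)) h0

theorem isSquare_or (hE : IsMaxProper T E) [IsAlgClosed Ω] (a : E) :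
    IsSquare a ∨ IsSquare (-a) := by
  by_contra! h
  obtain ⟨u, v, hu, hv, h1⟩ := hE.exists_of_not_isSquare h.1
  obtain ⟨u', v', hu', hv', h2⟩ := hE.exists_of_not_isSquare h.2
  apply hE.neg_one_notMem
  have h3 : (-1 : Ω) = v + v' + v * v' + (a : Ω) ^ 2 * (u * u') := by
    have : (1 + v) * (1 + v') = -((a : Ω) ^ 2 * (u * u')) := by
      rw [h1, h2]
      push_cast
      ring
    linear_combination -this
  rw [h3]
  exact add_mem (add_mem (add_mem hv hv') (sqCone_mul_mem hv hv'))
    (sqCone_mul_mem (sq_mem_sqCone a.2) (sqCone_mul_mem hu hu'))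

theorem isSquare_of_mem_sqCone (hE : IsMaxProper T E) [IsAlgClosed Ω] (a : E)
    (ha : (a : Ω) ∈ sqCone T E) :
    IsSquare a := by
  rcases hE.isSquare_or a with h | ⟨b, hb⟩
  · exact h
  by_cases hb0 : b = 0
  · have : a = 0 := by simpa [hb0] using hb
    rw [this]
    exact IsSquare.zero
  exfalso
  apply hE.neg_one_notMem
  have hb0' : (b : Ω) ≠ 0 := by simpa using hb0
  have h1 : -(a : Ω) = b * b := by exact_mod_cast congrArg (fun x : E => (x : Ω)) hb
  have : (-1 : Ω) = a * ((b⁻¹ : E) : Ω) ^ 2 := by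
    push_cast
    field_simp
    linear_combination h1
  rw [this]
  exact sqCone_mul_mem ha (sq_mem_sqCone (b⁻¹).2)

theorem exists_polyIVT (hE : IsMaxProper T E) [IsAlgClosed Ω] :
    ∃ (_ : LinearOrder E) (_ : IsStrictOrderedRing E), PolyIVT E ∧
      ∀ t : E, (t : Ω) ∈ sqCone T E → 0 ≤ t := by
  have hmem : ∀ a : E, IsSquare a → (a : Ω) ∈ sqCone T E := by
    rintro _ ⟨b, rfl⟩
    have := sq_mem_sqCone (T := T) b.2
    simpa [sq] using this
  obtain ⟨o, hord, hle⟩ := exists_linearOrder_of_isSquare (E := E)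
    (fun a b ha hb => hE.isSquare_of_mem_sqCone _ (by
      simpa using add_mem (hmem a ha) (hmem b hb))) hE.isSquare_or
    (fun h => hE.neg_one_notMem (by simpa using hmem _ h))
  have hnn : ∀ t : E, (t : Ω) ∈ sqCone T E → 0 ≤ t := fun t ht =>
    (hle t).2 (hE.isSquare_of_mem_sqCone t ht)
  refine ⟨o, hord, ?_, hnn⟩
  suffices H : ∀ (n : ℕ) (p : E[X]) (a b : E), p.natDegree = n → a < b → p.eval a * p.eval b < 0 →
      ∃ c, a < c ∧ c < b ∧ p.eval c = 0 from
    fun p a b hab h1 h2 => H _ p a b rfl hab (mul_neg_of_neg_of_pos h1 h2)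
  intro n
  induction n using Nat.strong_induction_on with
  | _ n ih =>
  intro p a b hn hab hlt
  have hp0 : p ≠ 0 := by rintro rfl; simp at hlt
  have hpu : ¬ IsUnit p := by
    intro hu
    rw [eq_C_of_natDegree_eq_zero (natDegree_eq_zero_of_isUnit hu)] at hlt
    simp only [eval_C] at hlt
    exact absurd hlt (not_lt.2 (mul_self_nonneg _))
  by_cases hirr : Irreducible p
  · have hpos := hirr.natDegree_pos
    obtain ⟨d, hd⟩ : ∃ d, p.natDegree = d + 1 := ⟨p.natDegree - 1, by omega⟩
    rcases Nat.eq_zero_or_pos d with rfl | hd0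
    · obtain ⟨u, hu, v, rfl⟩ := natDegree_eq_one.1 hd
      have h1 : (a + v / u) * (b + v / u) < 0 := by
        have h2 : (C u * X + C v).eval a * (C u * X + C v).eval b =
            u ^ 2 * ((a + v / u) * (b + v / u)) := by
          simp
          field_simp
        rw [h2] at hlt
        exact neg_of_mul_neg_right hlt (sq_nonneg u)
      refine ⟨-(v / u), ?_, ?_, by simp; field_simp; ring⟩
      · by_contra h
        have := mul_nonneg (show 0 ≤ a + v / u by linarith) (show 0 ≤ b + v / u by linarith)
        linarith
      · by_contra h
        have := mul_nonneg_of_nonpos_of_nonpos (show a + v / u ≤ 0 by linarith)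
          (show b + v / u ≤ 0 by linarith)
        linarith
    · obtain ⟨G, hG, h, hh⟩ := hE.exists_dvd hirr hd hd0
      have hGdeg := natDegree_le_of_mem_polyCone hG
      have hGpos : ∀ x, 0 < p.eval x * h.eval x := by
        intro x
        have h1 := hnn _ (eval_mem_of_mem_polyCone hG x)
        have h2 : 1 + G.eval x = p.eval x * h.eval x := by
          simpa using congrArg (fun q => q.eval x) hh
        linarith
      have hh0 : h ≠ 0 := by
        rintro rfl
        simpa using hGpos a
      have hhdeg : h.natDegree < n := by
        have h1 := natDegree_mul hp0 hh0
        rw [← hh] at h1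
        have h2 : (1 + G).natDegree ≤ 2 * d := (natDegree_add_le _ _).trans (by simpa using hGdeg)
        omega
      obtain ⟨c, -, -, h3⟩ := ih _ hhdeg h a b rfl hab (by
        have h1 := mul_pos (hGpos a) (hGpos b)
        have h2 : (h.eval a * h.eval b) * (p.eval a * p.eval b) =
          p.eval a * h.eval a * (p.eval b * h.eval b) := by ring
        rw [← h2] at h1
        exact neg_of_mul_pos_left h1 hlt.le)
      have := hGpos c
      rw [h3, mul_zero] at this
      exact absurd this (lt_irrefl _)
  · obtain ⟨q, r, hq, hr, hqr⟩ : ∃ q r, ¬ IsUnit q ∧ ¬ IsUnit r ∧ p = q * r := by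
      rw [irreducible_iff] at hirr
      push Not at hirr
      obtain ⟨q, r, h1, h2, h3⟩ := hirr hpu
      exact ⟨q, r, h2, h3, h1⟩
    have hq0 : q ≠ 0 := by rintro rfl; simp at hqr; exact hp0 hqr
    have hr0 : r ≠ 0 := by rintro rfl; simp at hqr; exact hp0 hqr
    have hqd : 0 < q.natDegree :=
      natDegree_pos_iff_degree_pos.2 (degree_pos_of_ne_zero_of_nonunit hq0 hq)
    have hrd : 0 < r.natDegree :=
      natDegree_pos_iff_degree_pos.2 (degree_pos_of_ne_zero_of_nonunit hr0 hr)
    have hdeg := natDegree_mul hq0 hr0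
    rw [← hqr] at hdeg
    have h1 : (q.eval a * q.eval b) * (r.eval a * r.eval b) < 0 := by
      have : (q.eval a * q.eval b) * (r.eval a * r.eval b) = p.eval a * p.eval b := by
        rw [hqr]; simp; ring
      rwa [this]
    rcases mul_neg_iff.1 h1 with ⟨-, h2⟩ | ⟨h2, -⟩
    · obtain ⟨c, h3, h4, h5⟩ := ih _ (by omega) r a b rfl hab h2
      exact ⟨c, h3, h4, by rw [hqr]; simp [h5]⟩
    · obtain ⟨c, h3, h4, h5⟩ := ih _ (by omega) q a b rfl hab h2
      exact ⟨c, h3, h4, by rw [hqr]; simp [h5]⟩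

end IsMaxProper

end RealClosure

section RealPlace

variable {C : Type*} [CommRing C]

/-- A maximal ideal among those disjoint from `1 + T` is a `T`-radical prime. -/
theorem exists_prime_of_neg_one_notMem (T : Subsemiring C) (hsq : ∀ a, a * a ∈ T)
    (hneg : -1 ∉ T) :
    ∃ p : Ideal C, p.IsPrime ∧ ∀ b, ∀ t ∈ T, b * b + t ∈ p → b ∈ p := by
  let S : Submonoid C :=
    { carrier := {x | ∃ t ∈ T, x = 1 + t}
      one_mem' := ⟨0, zero_mem _, by simp⟩
      mul_mem' := by
        rintro _ _ ⟨t, ht, rfl⟩ ⟨u, hu, rfl⟩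
        exact ⟨t + u + t * u, add_mem (add_mem ht hu) (mul_mem ht hu), by ring⟩ }
  have h0 : Disjoint ((⊥ : Ideal C) : Set C) S := by
    rw [Set.disjoint_left]
    rintro x hx ⟨t, ht, hxt⟩
    have hx0 : x = 0 := by simpa using hx
    apply hneg
    rwa [show (-1 : C) = t by linear_combination hxt - hx0]
  obtain ⟨p, -, hp⟩ := zorn_le_nonempty₀ {p : Ideal C | Disjoint (p : Set C) S}
    (fun c hc hc' x hx ↦ by
      refine ⟨sSup c, Set.disjoint_left.mpr fun y hy ↦ ?_, fun _ ↦ le_sSup⟩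
      obtain ⟨q, hq, hyq⟩ := (Submodule.mem_sSup_of_directed ⟨x, hx⟩ hc'.directedOn).1 hy
      exact Set.disjoint_left.mp (hc hq) hyq) ⊥ h0
  refine ⟨p, Ideal.isPrime_of_maximally_disjoint _ _ hp.1 (fun _ ↦ hp.not_prop_of_gt), ?_⟩
  intro b t ht hb
  by_contra hbp
  have h1 : p < p ⊔ Ideal.span {b} := by
    refine lt_of_le_of_ne le_sup_left fun h => hbp ?_
    rw [h]
    exact Ideal.mem_sup_right (Ideal.mem_span_singleton_self b)
  have h2 : ¬ Disjoint ((p ⊔ Ideal.span {b} : Ideal C) : Set C) S := hp.not_prop_of_gt h1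
  rw [Set.not_disjoint_iff] at h2
  obtain ⟨x, hx, t', ht', rfl⟩ := h2
  obtain ⟨q, hq, y, hy, hqy⟩ := Submodule.mem_sup.1 hx
  obtain ⟨c, rfl⟩ := Ideal.mem_span_singleton'.1 hy
  refine Set.disjoint_left.1 hp.1 (?_ : (1 + t') * (1 + t') + t * (c * c) ∈ p) ?_
  · have : (1 + t') * (1 + t') + t * (c * c) = q * (q + 2 * (c * b)) + c * c * (b * b + t) := by
      rw [← hqy]; ring
    rw [this]
    exact p.add_mem (p.mul_mem_right _ hq) (p.mul_mem_left _ hb)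
  · exact ⟨t' + t' + t' * t' + t * (c * c),
      add_mem (add_mem (add_mem ht' ht') (mul_mem ht' ht')) (mul_mem ht (hsq c)), by ring⟩

theorem exists_isMaxProper {Ω : Type*} [Field Ω] (T : Submonoid Ω) (E : Subfield Ω)
    (hT : ∀ t ∈ T, t ∈ E) (hE : (-1 : Ω) ∉ sqCone T E) :
    ∃ F, E ≤ F ∧ IsMaxProper T F := by
  obtain ⟨F, hEF, hF⟩ := zorn_le_nonempty₀ {F : Subfield Ω | (-1 : Ω) ∉ sqCone T F}
    (fun c hc hc' x hx ↦ by
      refine ⟨sSup c, fun hmem ↦ ?_, fun _ ↦ le_sSup⟩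
      have key : ∀ y ∈ sqCone T (sSup c), ∃ F ∈ c, y ∈ sqCone T F := by
        intro y hy
        unfold sqCone at hy
        induction hy using AddSubmonoid.closure_induction with
        | mem y hy =>
          obtain ⟨t, ht, z, hz, rfl⟩ := hy
          obtain ⟨F, hF, hzF⟩ := (Subfield.mem_sSup_of_directedOn ⟨x, hx⟩ hc'.directedOn).1 hz
          exact ⟨F, hF, AddSubmonoid.subset_closure ⟨t, ht, z, hzF, rfl⟩⟩
        | zero => exact ⟨x, hx, zero_mem _⟩
        | add y z _ _ h1 h2 =>
          obtain ⟨F, hF, hyF⟩ := h1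
          obtain ⟨G, hG, hzG⟩ := h2
          rcases hc'.total hF hG with h | h
          · exact ⟨G, hG, add_mem (sqCone_mono h hyF) hzG⟩
          · exact ⟨F, hF, add_mem hyF (sqCone_mono h hzG)⟩
      obtain ⟨F, hF, h⟩ := key _ hmem
      exact hc hF h) E hE
  refine ⟨F, hEF, fun t ht => hEF (hT t ht), hF.1, fun G hFG hG => hF.2 hG hFG⟩

/-- A preordering not containing `-1` becomes nonnegative in some ordered field with the
intermediate value property. -/
theorem exists_hom_polyIVT.{u} {C : Type u} [CommRing C] (T : Subsemiring C)
    (hsq : ∀ a, a * a ∈ T) (hneg : -1 ∉ T) :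
    ∃ (R : Type u) (_ : Field R) (_ : LinearOrder R) (_ : IsStrictOrderedRing R) (f : C →+* R),
      PolyIVT R ∧ ∀ t ∈ T, 0 ≤ f t := by
  obtain ⟨p, hp, hrad⟩ := exists_prime_of_neg_one_notMem T hsq hneg
  let K := FractionRing (C ⧸ p)
  let Ω := AlgebraicClosure K
  let f₀ : C →+* K := (algebraMap (C ⧸ p) K).comp (Ideal.Quotient.mk p)
  have hf₀ : ∀ a, f₀ a = 0 ↔ a ∈ p := fun a => by
    simp [f₀, Ideal.Quotient.eq_zero_iff_mem]
  let f : C →+* Ω := (algebraMap K Ω).comp f₀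
  have hf : ∀ a, f a = 0 ↔ a ∈ p := fun a => by
    rw [← hf₀]
    exact map_eq_zero (algebraMap K Ω)
  let TΩ : Submonoid Ω := T.toSubmonoid.map (f : C →* Ω)
  let E₀ : Subfield Ω := (algebraMap K Ω).fieldRange
  have hfE : ∀ a, f a ∈ E₀ := fun a => ⟨f₀ a, rfl⟩
  have hE₀ : ∀ x ∈ E₀, ∃ a b, b ∉ p ∧ x * f b = f a := by
    rintro _ ⟨y, rfl⟩
    obtain ⟨a, b, hb, rfl⟩ := IsFractionRing.div_surjective (A := C ⧸ p) y
    obtain ⟨a, rfl⟩ := Ideal.Quotient.mk_surjective a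
    obtain ⟨b, rfl⟩ := Ideal.Quotient.mk_surjective b
    have hb0 : f₀ b ≠ 0 := by
      intro h
      rw [hf₀, ← Ideal.Quotient.eq_zero_iff_mem] at h
      exact nonZeroDivisors.ne_zero hb h
    refine ⟨a, b, fun h => hb0 ((hf₀ b).2 h), ?_⟩
    change algebraMap K Ω (f₀ a / f₀ b) * algebraMap K Ω (f₀ b) = algebraMap K Ω (f₀ a)
    rw [← map_mul, div_mul_cancel₀ _ hb0]
  have hcone : ∀ y ∈ sqCone TΩ E₀, ∃ t ∈ T, ∃ b, b ∉ p ∧ y * f b ^ 2 = f t := by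
    intro y hy
    unfold sqCone at hy
    induction hy using AddSubmonoid.closure_induction with
    | mem y hy =>
      obtain ⟨_, ⟨t, ht, rfl⟩, z, hz, rfl⟩ := hy
      obtain ⟨a, b, hb, hab⟩ := hE₀ z hz
      refine ⟨t * (a * a), mul_mem ht (hsq a), b, hb, ?_⟩
      change f t * z ^ 2 * f b ^ 2 = _
      rw [map_mul, map_mul, ← hab]
      ring
    | zero => exact ⟨0, zero_mem _, 1, fun h => hp.ne_top ((Ideal.eq_top_iff_one p).2 h), by simp⟩
    | add y z _ _ h1 h2 =>
      obtain ⟨t, ht, b, hb, h1⟩ := h1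
      obtain ⟨u, hu, c, hc, h2⟩ := h2
      refine ⟨t * (c * c) + u * (b * b), add_mem (mul_mem ht (hsq c)) (mul_mem hu (hsq b)), b * c,
        fun h => (hp.mem_or_mem h).elim hb hc, ?_⟩
      simp only [map_add, map_mul, ← h1, ← h2]
      ring
  obtain ⟨E, hE₀E, hE⟩ := exists_isMaxProper TΩ E₀
    (by rintro _ ⟨t, -, rfl⟩; exact hfE t) (fun h => by
      obtain ⟨t, ht, b, hb, h⟩ := hcone _ h
      refine hb (hrad b t ht ((hf _).1 ?_))
      rw [map_add, map_mul, ← h]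
      ring)
  obtain ⟨o, ho, hivt, hnn⟩ := hE.exists_polyIVT
  refine ⟨E, inferInstance, o, ho, f.codRestrict E fun a => hE₀E (hfE a), hivt, fun t ht => ?_⟩
  exact hnn _ (mem_sqCone_of_mem ⟨t, ht, rfl⟩)

end RealPlace

section Ultrapower

open Polynomial Filter

theorem exists_ultrafilter_of_finset {ι β : Type*} (P : ι → β → Prop)
    (h : ∀ s : Finset ι, ∃ b, ∀ i ∈ s, P i b) :
    ∃ U : Ultrafilter β, ∀ i, ∀ᶠ b in (U : Filter β), P i b := by
  classical
  obtain ⟨U, hU⟩ := Ultrafilter.exists_ultrafilter_of_finite_inter_nonempty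
    (Set.range fun i => {b | P i b}) (by
      intro T hT
      choose g hg using fun t : T => hT t.2
      obtain ⟨b, hb⟩ := h (T.attach.image g)
      refine ⟨b, fun t ht => ?_⟩
      have h2 : {b | P (g ⟨t, ht⟩) b} = t := hg ⟨t, ht⟩
      rw [← h2]
      exact hb _ (Finset.mem_image_of_mem g (Finset.mem_attach T ⟨t, ht⟩)))
  exact ⟨U, fun i => hU ⟨i, rfl⟩⟩

variable {ι : Type*} (U : Ultrafilter ι)

theorem germ_sign_eq_iff (f : ι → ℝ) (s : SignType) :
    SignType.sign (f : (U : Filter ι).Germ ℝ) = s ↔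
      ∀ᶠ a in (U : Filter ι), SignType.sign (f a) = s := by
  rcases s.trichotomy with rfl | rfl | rfl
  · simp only [sign_eq_neg_one_iff]
    exact Germ.coe_lt (g := fun _ => 0)
  · simp only [sign_eq_zero_iff]
    exact Germ.coe_eq (g := fun _ => 0)
  · simp only [sign_eq_one_iff]
    exact Germ.coe_lt (f := fun _ => 0)

theorem exists_germ_eval (p : ((U : Filter ι).Germ ℝ)[X]) :
    ∃ P : ι → ℝ[X], ∀ y : ι → ℝ,
      p.eval (y : (U : Filter ι).Germ ℝ) =
        ((fun a => (P a).eval (y a) : ι → ℝ) : (U : Filter ι).Germ ℝ) := by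
  induction p using Polynomial.induction_on with
  | C c =>
    induction c using Germ.inductionOn with
    | _ c => exact ⟨fun a => C (c a), fun y => by simp⟩
  | add p q hp hq =>
    obtain ⟨P, hP⟩ := hp
    obtain ⟨Q, hQ⟩ := hq
    refine ⟨fun a => P a + Q a, fun y => ?_⟩
    rw [eval_add, hP, hQ, ← Germ.coe_add]
    simp [Pi.add_def]
  | monomial n c h =>
    obtain ⟨P, hP⟩ := h
    refine ⟨fun a => P a * X, fun y => ?_⟩
    rw [pow_succ, ← mul_assoc, eval_mul, hP, eval_X, ← Germ.coe_mul]
    simp [Pi.mul_def]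

theorem polyIVT_germ : PolyIVT ((U : Filter ι).Germ ℝ) := by
  intro p a b
  obtain ⟨P, hP⟩ := exists_germ_eval U p
  induction a using Germ.inductionOn with
  | _ a =>
  induction b using Germ.inductionOn with
  | _ b =>
  intro hab ha hb
  rw [hP, ← Germ.coe_zero, Germ.coe_lt] at ha hb
  rw [Germ.coe_lt] at hab
  have h : ∀ᶠ x in (U : Filter ι), ∃ c, a x < c ∧ c < b x ∧ (P x).eval c = 0 := by
    filter_upwards [hab, ha, hb] with x h1 h2 h3
    obtain ⟨c, hc, hc0⟩ := intermediate_value_Ioo h1.le ((P x).continuous.continuousOn) ⟨h2, h3⟩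
    exact ⟨c, hc.1, hc.2, hc0⟩
  obtain ⟨c, hc⟩ := h.choice
  refine ⟨(c : (U : Filter ι).Germ ℝ), ?_, ?_, ?_⟩
  · rw [Germ.coe_lt]
    exact hc.mono fun _ h => h.1
  · rw [Germ.coe_lt]
    exact hc.mono fun _ h => h.2.1
  · rw [hP, ← Germ.coe_zero, Germ.coe_eq]
    exact hc.mono fun _ h => h.2.2

/-- Two homomorphisms to ordered fields with the same signs factor through a common field. -/
theorem exists_common_field.{u, v, w} {Z : Type u} {R : Type v} {S : Type w} [CommRing Z] [Field R]
    [LinearOrder R] [IsStrictOrderedRing R] [Field S] [LinearOrder S] [IsStrictOrderedRing S]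
    (α : Z →+* R) (β : Z →+* S) (h : ∀ z, SignType.sign (β z) = SignType.sign (α z)) :
    ∃ (K : Type u) (_ : Field K) (π : Z →+* K) (i : K →+* R) (j : K →+* S),
      (∀ z, i (π z) = α z) ∧ (∀ z, j (π z) = β z) ∧
      (∀ c, SignType.sign (j c) = SignType.sign (i c)) ∧
      ∀ c, ∃ a b, π b ≠ 0 ∧ c * π b = π a := by
  let I := RingHom.ker α
  have hI : RingHom.ker β = I := by
    ext z
    rw [RingHom.mem_ker, RingHom.mem_ker, ← sign_eq_zero_iff, h, sign_eq_zero_iff]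
  have : I.IsPrime := RingHom.ker_isPrime α
  let α' : Z ⧸ I →+* R := RingHom.kerLift α
  let β' : Z ⧸ I →+* S := Ideal.Quotient.lift I β (fun a ha => by rw [← hI] at ha; exact ha)
  have hα' : Function.Injective α' := RingHom.kerLift_injective α
  have hβ' : Function.Injective β' :=
    RingHom.lift_injective_of_ker_le_ideal I _ hI.le
  let K := FractionRing (Z ⧸ I)
  let π : Z →+* K := (algebraMap (Z ⧸ I) K).comp (Ideal.Quotient.mk I)
  let i : K →+* R := IsFractionRing.lift hα'
  let j : K →+* S := IsFractionRing.lift hβ'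
  have hi : ∀ z, i (π z) = α z := fun z => by
    simp [i, π, IsFractionRing.lift_algebraMap, α']
    rfl
  have hj : ∀ z, j (π z) = β z := fun z => by
    simp [j, π, IsFractionRing.lift_algebraMap, β']
    rfl
  have hfrac : ∀ c : K, ∃ a b, π b ≠ 0 ∧ c * π b = π a := by
    intro y
    obtain ⟨a, b, hb, rfl⟩ := IsFractionRing.div_surjective (A := Z ⧸ I) y
    obtain ⟨a, rfl⟩ := Ideal.Quotient.mk_surjective a
    obtain ⟨b, rfl⟩ := Ideal.Quotient.mk_surjective b
    have hb0 : π b ≠ 0 := by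
      intro h
      exact nonZeroDivisors.ne_zero hb ((FaithfulSMul.algebraMap_injective (Z ⧸ I) K)
        (h.trans (map_zero _).symm))
    exact ⟨a, b, hb0, div_mul_cancel₀ _ hb0⟩
  refine ⟨K, inferInstance, π, i, j, hi, hj, fun c => ?_, hfrac⟩
  obtain ⟨a, b, hb, hab⟩ := hfrac c
  have h1 : SignType.sign (i c) * SignType.sign (α b) = SignType.sign (α a) := by
    rw [← sign_mul, ← hi, ← hi, ← map_mul, hab]
  have h2 : SignType.sign (j c) * SignType.sign (α b) = SignType.sign (α a) := by
    rw [← h, ← h, ← sign_mul, ← hj, ← hj, ← map_mul, hab]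
  have h3 : SignType.sign (α b) ≠ 0 := by
    rw [Ne, sign_eq_zero_iff, ← hi]
    exact (map_ne_zero i).2 hb
  rw [← h1] at h2
  revert h2 h3
  generalize SignType.sign (i c) = u
  generalize SignType.sign (j c) = v
  generalize SignType.sign (α b) = w
  revert u v w
  decide

theorem sign_ringHom_real {R : Type*} [Field R] [LinearOrder R] [IsStrictOrderedRing R]
    (f : ℝ →+* R) (c : ℝ) : SignType.sign (f c) = SignType.sign c := by
  have key : ∀ c : ℝ, 0 < c → 0 < f c := fun c hc => by
    have h1 : f c = f (√c) * f (√c) := by rw [← map_mul, Real.mul_self_sqrt hc.le]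
    have h2 : f (√c) ≠ 0 := (map_ne_zero f).2 (Real.sqrt_ne_zero'.2 hc)
    rw [h1]
    exact mul_self_pos.2 h2
  rcases lt_trichotomy c 0 with h | rfl | h
  · rw [sign_neg h, sign_neg]
    have := key (-c) (by linarith)
    rw [map_neg] at this
    linarith
  · simp
  · rw [sign_pos h, sign_pos (key c h)]

/-- The signs of real polynomials at a point of an ordered field with the intermediate value
property are realised along an ultrafilter of real points. -/
theorem PolyIVT.exists_ultrafilter {R : Type*} [Field R] [LinearOrder R] [IsStrictOrderedRing R]
    [Algebra ℝ R] (hR : PolyIVT R) : ∀ (k : ℕ) (x : Fin k → R),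
    ∃ U : Ultrafilter (Fin k → ℝ), ∀ F : MvPolynomial (Fin k) ℝ, ∀ᶠ a in (U : Filter (Fin k → ℝ)),
      SignType.sign (MvPolynomial.eval a F) = SignType.sign (MvPolynomial.aeval x F)
  | 0, x => by
    refine ⟨pure default, fun F => ?_⟩
    rw [F.eq_C_of_isEmpty]
    simp [sign_ringHom_real]
  | k + 1, x => by
    classical
    obtain ⟨U, hU⟩ := PolyIVT.exists_ultrafilter hR k (Fin.tail x)
    let S := (U : Filter (Fin k → ℝ)).Germ ℝ
    let α : MvPolynomial (Fin k) ℝ →+* R := (MvPolynomial.aeval (Fin.tail x)).toRingHom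
    let β : MvPolynomial (Fin k) ℝ →+* S :=
      { toFun := fun F => ((fun a => MvPolynomial.eval a F : (Fin k → ℝ) → ℝ) : S)
        map_one' := by simp; rfl
        map_mul' := fun F G => by rw [← Germ.coe_mul]; simp [Pi.mul_def]
        map_zero' := by simp; rfl
        map_add' := fun F G => by rw [← Germ.coe_add]; simp [Pi.add_def] }
    obtain ⟨K, _, π, i, j, hi, hj, hij, -⟩ := exists_common_field α β
      fun F => (germ_sign_eq_iff U _ _).2 (hU F)
    have : CharZero K := (RingHom.charZero_iff i.injective).2 inferInstance
    refine exists_ultrafilter_of_finset _ fun s => ?_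
    let p : MvPolynomial (Fin (k + 1)) ℝ → K[X] := fun F => (MvPolynomial.finSuccEquiv ℝ k F).map π
    obtain ⟨f, -, hf⟩ := hR.signEmb (polyIVT_germ U) i j hij (s.image p) {x 0}
    obtain ⟨y, hy⟩ : ∃ y : (Fin k → ℝ) → ℝ, (y : S) = f (x 0) := by
      induction f (x 0) using Germ.inductionOn with
      | _ y => exact ⟨y, rfl⟩
    have hα : ∀ F, ((p F).map i).eval (x 0) = MvPolynomial.aeval x F := by
      intro F
      have h1 : i.comp π = α := RingHom.ext hi
      rw [Polynomial.map_map, h1, eval_map]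
      have : (eval₂RingHom α (x 0)).comp (MvPolynomial.finSuccEquiv ℝ k).toRingEquiv.toRingHom
          = (MvPolynomial.aeval x).toRingHom := by
        apply MvPolynomial.ringHom_ext
        · intro c
          simp [α, MvPolynomial.finSuccEquiv_apply]
        · intro v
          refine Fin.cases ?_ (fun v => ?_) v
          · simp [α, MvPolynomial.finSuccEquiv_apply]
          · simp [α, MvPolynomial.finSuccEquiv_apply, Fin.tail]
      exact congrArg (fun g => g F) this
    have hβ : ∀ F, ((p F).map j).eval (y : S) =
        ((fun a => MvPolynomial.eval (Fin.cons (y a) a : Fin (k + 1) → ℝ) F :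
          (Fin k → ℝ) → ℝ) : S) := by
      intro F
      have h1 : j.comp π = β := RingHom.ext hj
      rw [Polynomial.map_map, h1, eval_map]
      let γ : MvPolynomial (Fin (k + 1)) ℝ →+* S :=
        { toFun := fun F => ((fun a => MvPolynomial.eval (Fin.cons (y a) a : Fin (k + 1) → ℝ) F :
            (Fin k → ℝ) → ℝ) : S)
          map_one' := by simp; rfl
          map_mul' := fun F G => by rw [← Germ.coe_mul]; simp [Pi.mul_def]
          map_zero' := by simp; rfl
          map_add' := fun F G => by rw [← Germ.coe_add]; simp [Pi.add_def] }
      have : (eval₂RingHom β (y : S)).comp (MvPolynomial.finSuccEquiv ℝ k).toRingEquiv.toRingHom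
          = γ := by
        apply MvPolynomial.ringHom_ext
        · intro c
          simp [β, γ, MvPolynomial.finSuccEquiv_apply]
        · intro v
          refine Fin.cases ?_ (fun v => ?_) v
          · simp [β, γ, MvPolynomial.finSuccEquiv_apply]
          · simp [β, γ, MvPolynomial.finSuccEquiv_apply]
      exact congrArg (fun g => g F) this
    have hall : ∀ᶠ a in (U : Filter (Fin k → ℝ)), ∀ F ∈ s,
        SignType.sign (MvPolynomial.eval (Fin.cons (y a) a : Fin (k + 1) → ℝ) F) =
          SignType.sign (MvPolynomial.aeval x F) := by
      rw [Filter.eventually_all_finset]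
      intro F hF
      rw [← germ_sign_eq_iff U, ← hβ, ← hα, hy]
      exact hf (x 0) (by simp) (p F) (Finset.mem_image_of_mem p hF)
    obtain ⟨a, ha⟩ := hall.exists
    exact ⟨_, ha⟩

end Ultrapower

section PosSemidefTransfer

open Filter

theorem exists_diagonalization {K : Type*} [Field K] [Invertible (2 : K)] {m : ℕ}
    (M : Matrix (Fin m) (Fin m) K) (hM : Mᵀ = M) :
    ∃ (d : ℕ) (w P : Fin d → Fin m → K), ∀ i j,
      M i j = ∑ a, (∑ k, ∑ l, w a k * M k l * w a l) * (P a i * P a j) := by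
  obtain ⟨v, hv⟩ := LinearMap.BilinForm.exists_orthogonal_basis (B := Matrix.toBilin' M)
    ⟨fun x y => by
      simp only [Matrix.toBilin'_apply, RingHom.id_apply]
      rw [Finset.sum_comm]
      refine Finset.sum_congr rfl fun i _ => Finset.sum_congr rfl fun j _ => ?_
      rw [← congrFun (congrFun hM i) j, transpose_apply]
      ring⟩
  refine ⟨_, fun a => v a, fun a i => v.repr (Pi.single i 1) a, fun i j => ?_⟩
  simp only [← Matrix.toBilin'_apply]
  have h1 := Matrix.toBilin'_single M i j
  rw [← v.sum_repr (Pi.single i 1), ← v.sum_repr (Pi.single j 1)] at h1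
  rw [← h1]
  simp only [map_sum, LinearMap.sum_apply, map_smul, LinearMap.smul_apply, smul_eq_mul]
  refine Finset.sum_congr rfl fun a _ => ?_
  rw [Finset.sum_eq_single a]
  · ring
  · intro b _ hb
    rw [LinearMap.isOrthoᵢ_def.1 hv b a hb]
    ring
  · simp

theorem exists_common_denominator {Z K : Type*} [CommRing Z] [Field K] (π : Z →+* K)
    (h : ∀ c, ∃ a b, π b ≠ 0 ∧ c * π b = π a) {m : ℕ} (w : Fin m → K) :
    ∃ (b : Z) (a : Fin m → Z), π b ≠ 0 ∧ ∀ l, w l * π b = π (a l) := by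
  choose a b hb hab using fun l => h (w l)
  refine ⟨∏ l, b l, fun l => a l * ∏ l' ∈ Finset.univ.erase l, b l', ?_, fun l => ?_⟩
  · rw [map_prod]
    exact Finset.prod_ne_zero_iff.2 fun l _ => hb l
  · rw [← Finset.mul_prod_erase _ _ (Finset.mem_univ l), map_mul, map_mul, ← mul_assoc, hab]

/-- Positive semidefiniteness of a symmetric matrix over the common field can be transferred
between ordered fields. -/
theorem sum_nonneg_of_common_field {Z K R S : Type*} [CommRing Z] [Field K] [Field R]
    [LinearOrder R] [IsStrictOrderedRing R] [Field S] [LinearOrder S] [IsStrictOrderedRing S]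
    (π : Z →+* K) (i : K →+* R) (j : K →+* S)
    (hij : ∀ c, SignType.sign (j c) = SignType.sign (i c))
    (hfrac : ∀ c, ∃ a b, π b ≠ 0 ∧ c * π b = π a) {m : ℕ} (G : Matrix (Fin m) (Fin m) Z)
    (hsymm : ∀ k l, π (G k l) = π (G l k))
    (hG : ∀ c : Fin m → Z, 0 ≤ i (π (∑ k, ∑ l, c k * G k l * c l))) (v : Fin m → S) :
    0 ≤ ∑ k, ∑ l, v k * j (π (G k l)) * v l := by
  have hnn : ∀ c, 0 ≤ i c → 0 ≤ j c := fun c hc => by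
    rw [← not_lt, ← sign_eq_neg_one_iff, hij, sign_eq_neg_one_iff]
    exact not_lt.2 hc
  have : CharZero K := (RingHom.charZero_iff i.injective).2 inferInstance
  have : Invertible (2 : K) := invertibleOfNonzero two_ne_zero
  obtain ⟨d, w, P, hP⟩ := exists_diagonalization (G.map π) (by ext k l; exact hsymm l k)
  have hd : ∀ a, 0 ≤ i (∑ k, ∑ l, w a k * G.map π k l * w a l) := by
    intro a
    obtain ⟨b, c, hb, hc⟩ := exists_common_denominator π hfrac (w a)
    have h1 := hG c
    have h2 : π (∑ k, ∑ l, c k * G k l * c l)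
        = (∑ k, ∑ l, w a k * G.map π k l * w a l) * π b ^ 2 := by
      simp only [map_sum, map_mul, Finset.sum_mul, ← hc, map_apply]
      refine Finset.sum_congr rfl fun k _ => Finset.sum_congr rfl fun l _ => ?_
      ring
    rw [h2, map_mul, map_pow] at h1
    exact nonneg_of_mul_nonneg_left h1 (by have := (map_ne_zero i).2 hb; positivity)
  have hsum : ∑ k, ∑ l, v k * j (π (G k l)) * v l =
      ∑ a, j (∑ k, ∑ l, w a k * G.map π k l * w a l) * (∑ k, v k * j (P a k)) ^ 2 := by
    have h1 : ∀ k l, v k * j (π (G k l)) * v l = ∑ a, j (∑ k, ∑ l, w a k * G.map π k l * w a l) *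
        ((v k * j (P a k)) * (v l * j (P a l))) := by
      intro k l
      have := hP k l
      rw [map_apply] at this
      rw [this, map_sum, Finset.mul_sum, Finset.sum_mul]
      refine Finset.sum_congr rfl fun a _ => ?_
      simp only [map_mul]
      ring
    calc _ = ∑ k, ∑ l, ∑ a, j (∑ k, ∑ l, w a k * G.map π k l * w a l) *
          ((v k * j (P a k)) * (v l * j (P a l))) := by simp only [h1]
      _ = ∑ k, ∑ a, ∑ l, j (∑ k, ∑ l, w a k * G.map π k l * w a l) *
          ((v k * j (P a k)) * (v l * j (P a l))) :=
        Finset.sum_congr rfl fun k _ => Finset.sum_comm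
      _ = ∑ a, ∑ k, ∑ l, j (∑ k, ∑ l, w a k * G.map π k l * w a l) *
          ((v k * j (P a k)) * (v l * j (P a l))) := Finset.sum_comm
      _ = _ := Finset.sum_congr rfl fun a _ => by
        rw [sq, Finset.sum_mul_sum, Finset.mul_sum]
        simp only [Finset.mul_sum]
  rw [hsum]
  exact Finset.sum_nonneg fun a _ => mul_nonneg (hnn _ (hd a)) (sq_nonneg _)

/-- If a preordering of a finitely generated real algebra does not contain `-1`, then there is a
real point at which given symmetric matrices with values in the preordering are positive
semidefinite. -/
theorem exists_real_point_posSemidef {C : Type} [CommRing C] [Algebra ℝ C]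
    [hC : Algebra.FiniteType ℝ C] (T : Subsemiring C) (hsq : ∀ a, a * a ∈ T) (hneg : -1 ∉ T)
    {κ : Type} [Finite κ] {m : ℕ} (G : κ → Matrix (Fin m) (Fin m) C)
    (hsymm : ∀ κ k l, G κ k l = G κ l k)
    (hG : ∀ κ (c : Fin m → C), ∑ k, ∑ l, c k * G κ k l * c l ∈ T) :
    ∃ φ : C →ₐ[ℝ] ℝ, ∀ κ (v : Fin m → ℝ), 0 ≤ ∑ k, ∑ l, v k * φ (G κ k l) * v l := by
  obtain ⟨R, _, _, _, f, hR, hf⟩ := exists_hom_polyIVT T hsq hneg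
  let _ : Algebra ℝ R := (f.comp (algebraMap ℝ C)).toAlgebra
  obtain ⟨N, q, hq⟩ := Algebra.FiniteType.iff_quotient_mvPolynomial''.1 hC
  let fA : C →ₐ[ℝ] R := { f with commutes' := fun r => rfl }
  let x : Fin N → R := fun i => f (q (MvPolynomial.X i))
  have hx : ∀ F, MvPolynomial.aeval x F = f (q F) := by
    have : MvPolynomial.aeval x = fA.comp q := by
      apply MvPolynomial.algHom_ext
      intro i
      rw [MvPolynomial.aeval_X]
      rfl
    exact fun F => congrArg (fun g => g F) this
  obtain ⟨U, hU⟩ := hR.exists_ultrafilter N x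
  choose lift hlift using hq
  let S := (U : Filter (Fin N → ℝ)).Germ ℝ
  let α : MvPolynomial (Fin N) ℝ →+* R := (MvPolynomial.aeval x).toRingHom
  let β : MvPolynomial (Fin N) ℝ →+* S :=
    { toFun := fun F => ((fun a => MvPolynomial.eval a F : (Fin N → ℝ) → ℝ) : S)
      map_one' := by simp; rfl
      map_mul' := fun F G => by rw [← Germ.coe_mul]; simp [Pi.mul_def]
      map_zero' := by simp; rfl
      map_add' := fun F G => by rw [← Germ.coe_add]; simp [Pi.add_def] }
  obtain ⟨K, _, π, i, j, hi, hj, hij, hfrac⟩ := exists_common_field α β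
    fun F => (germ_sign_eq_iff U _ _).2 (hU F)
  have hα : ∀ F, i (π F) = f (q F) := fun F => (hi F).trans (hx F)
  have hpsd : ∀ κ, ∀ᶠ a in (U : Filter (Fin N → ℝ)), ∀ v : Fin m → ℝ,
      0 ≤ ∑ k, ∑ l, v k * MvPolynomial.eval a (lift (G κ k l)) * v l := by
    intro κ
    by_contra hcon
    rw [← Ultrafilter.eventually_not] at hcon
    have hcon2 : ∀ᶠ a in (U : Filter (Fin N → ℝ)), ∃ v : Fin m → ℝ,
        ∑ k, ∑ l, v k * MvPolynomial.eval a (lift (G κ k l)) * v l < 0 := by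
      refine hcon.mono fun a ha => ?_
      push Not at ha
      exact ha
    obtain ⟨v, hv⟩ := hcon2.choice
    have h1 := sum_nonneg_of_common_field π i j hij hfrac (Matrix.of fun k l => lift (G κ k l))
      (fun k l => i.injective (by simp only [of_apply, hα, hlift, hsymm κ k l]))
      (fun c => by
        rw [hα]
        have h2 := hf _ (hG κ fun k => q (c k))
        simpa [hlift] using h2)
      (fun k => ((fun a => v a k : (Fin N → ℝ) → ℝ) : S))
    have h3 : ∑ k, ∑ l, ((fun a => v a k : (Fin N → ℝ) → ℝ) : S) *
        j (π ((Matrix.of fun k l => lift (G κ k l)) k l)) * ((fun a => v a l : (Fin N → ℝ) → ℝ) : S)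
        = ((fun a => ∑ k, ∑ l, v a k * MvPolynomial.eval a (lift (G κ k l)) * v a l :
          (Fin N → ℝ) → ℝ) : S) := by
      simp only [hj]
      have hsum : ∀ (F : Fin m → (Fin N → ℝ) → ℝ),
          ∑ k, (F k : S) = ((fun a => ∑ k, F k a : (Fin N → ℝ) → ℝ) : S) := by
        intro F
        rw [show (fun a => ∑ k, F k a : (Fin N → ℝ) → ℝ) = ∑ k, F k by ext; simp]
        exact (map_sum (Germ.coeRingHom (U : Filter (Fin N → ℝ))) F Finset.univ).symm
      rw [← hsum]
      refine Finset.sum_congr rfl fun k _ => ?_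
      rw [← hsum]
      refine Finset.sum_congr rfl fun l _ => ?_
      rfl
    rw [h3] at h1
    have h4 := (germ_sign_eq_iff U _ (-1)).2 (hv.mono fun a ha => sign_neg ha)
    rw [sign_eq_neg_one_iff] at h4
    exact absurd h1 (not_le.2 h4)
  obtain ⟨gens, hgens⟩ := (isNoetherianRing_iff_ideal_fg _).1
    (inferInstance : IsNoetherianRing (MvPolynomial (Fin N) ℝ)) (RingHom.ker q)
  have hker : ∀ᶠ a in (U : Filter (Fin N → ℝ)), ∀ F ∈ gens, MvPolynomial.eval a F = 0 := by
    rw [Filter.eventually_all_finset]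
    intro F hF
    refine (hU F).mono fun a ha => ?_
    have : q F = 0 := by
      have : F ∈ RingHom.ker q := hgens ▸ Ideal.subset_span hF
      exact this
    rw [hx, this, map_zero, sign_zero, sign_eq_zero_iff] at ha
    exact ha
  obtain ⟨a, ha, hak⟩ := ((Filter.eventually_all.2 hpsd).and hker).exists
  have hle : RingHom.ker q ≤
      RingHom.ker (MvPolynomial.aeval a : MvPolynomial (Fin N) ℝ →ₐ[ℝ] ℝ) := by
    rw [← hgens, Ideal.span_le]
    intro F hF
    have := hak F hF
    rwa [← MvPolynomial.coe_aeval_eq_eval] at this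
  let φ : C →ₐ[ℝ] ℝ := (Ideal.Quotient.liftₐ (RingHom.ker q) (MvPolynomial.aeval a) hle).comp
    (Ideal.quotientKerAlgEquivOfSurjective (f := q) fun c => ⟨lift c, hlift c⟩).symm.toAlgHom
  have hφ : ∀ F, φ (q F) = MvPolynomial.eval a F := by
    intro F
    have : (Ideal.quotientKerAlgEquivOfSurjective (f := q) fun c => ⟨lift c, hlift c⟩).symm (q F)
        = Ideal.Quotient.mk _ F := by
      rw [AlgEquiv.symm_apply_eq]
      rfl
    change Ideal.Quotient.liftₐ (RingHom.ker q) (MvPolynomial.aeval a) hle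
      ((Ideal.quotientKerAlgEquivOfSurjective (f := q) fun c => ⟨lift c, hlift c⟩).symm (q F)) = _
    rw [this, ← MvPolynomial.coe_aeval_eq_eval]
    rfl
  refine ⟨φ, fun κ v => ?_⟩
  have := ha κ v
  simpa [← hφ, hlift] using this

end PosSemidefTransfer

section TraceRingBasics

variable {n g : ℕ}

/-- The algebra generated by the traces of words in the generic matrices and their transposes. -/
def traceCenter (n g : ℕ) : Subalgebra ℝ (PolyRing n g) :=
  Algebra.adjoin ℝ {p | ∃ w ∈ Submonoid.closure (genSet n g), p = trace w}

theorem trace_mem_traceCenter_of_word {w : MatP n g} (hw : w ∈ Submonoid.closure (genSet n g)) :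
    trace w ∈ traceCenter n g :=
  Algebra.subset_adjoin ⟨w, hw, rfl⟩

theorem mem_traceRing_of_word {w : MatP n g} (hw : w ∈ Submonoid.closure (genSet n g)) :
    w ∈ traceRing n g := by
  have : Submonoid.closure (genSet n g) ≤ (traceRing n g).toSubmonoid :=
    Submonoid.closure_le.2 fun x hx => Algebra.subset_adjoin (Or.inl hx)
  exact this hw

theorem smul_one_mem_traceRing {c : PolyRing n g} (hc : c ∈ traceCenter n g) :
    c • (1 : MatP n g) ∈ traceRing n g := by
  induction hc using Algebra.adjoin_induction with
  | mem x hx =>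
    obtain ⟨w, hw, rfl⟩ := hx
    exact Algebra.subset_adjoin (Or.inr ⟨w, hw, rfl⟩)
  | algebraMap r =>
    rw [algebraMap_smul]
    exact (traceRing n g).smul_mem (one_mem _) r
  | add x y _ _ hx hy =>
    rw [add_smul]
    exact add_mem hx hy
  | mul x y _ _ hx hy =>
    have : (x * y) • (1 : MatP n g) = (x • (1 : MatP n g)) * (y • (1 : MatP n g)) := by
      rw [smul_mul_smul_comm, one_mul]
    rw [this]
    exact mul_mem hx hy

theorem smul_mem_traceRing {c : PolyRing n g} (hc : c ∈ traceCenter n g) {h : MatP n g}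
    (hh : h ∈ traceRing n g) : c • h ∈ traceRing n g := by
  have := mul_mem (smul_one_mem_traceRing hc) hh
  rwa [smul_one_mul] at this

theorem traceRing_induction {P : MatP n g → Prop} (hadd : ∀ x y, P x → P y → P (x + y))
    (hzero : P 0)
    (hword : ∀ c ∈ traceCenter n g, ∀ w ∈ Submonoid.closure (genSet n g), P (c • w))
    {h : MatP n g} (hh : h ∈ traceRing n g) : P h := by
  let S : Set (MatP n g) :=
    {m | ∃ c ∈ traceCenter n g, ∃ w ∈ Submonoid.closure (genSet n g), m = c • w}
  have hP : ∀ x ∈ AddSubmonoid.closure S, P x := by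
    intro x hx
    induction hx using AddSubmonoid.closure_induction with
    | mem x hx =>
      obtain ⟨c, hc, w, hw, rfl⟩ := hx
      exact hword c hc w hw
    | zero => exact hzero
    | add x y _ _ hx hy => exact hadd x y hx hy
  have hmul : ∀ x ∈ AddSubmonoid.closure S, ∀ y ∈ AddSubmonoid.closure S,
      x * y ∈ AddSubmonoid.closure S := by
    intro x hx y hy
    induction hx using AddSubmonoid.closure_induction with
    | mem x hx =>
      obtain ⟨c, hc, w, hw, rfl⟩ := hx
      induction hy using AddSubmonoid.closure_induction with
      | mem y hy =>
        obtain ⟨c', hc', w', hw', rfl⟩ := hy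
        exact AddSubmonoid.subset_closure
          ⟨_, mul_mem hc hc', _, mul_mem hw hw', smul_mul_smul_comm _ _ _ _⟩
      | zero => rw [mul_zero]; exact zero_mem _
      | add y z _ _ hy hz => rw [mul_add]; exact add_mem hy hz
    | zero => rw [zero_mul]; exact zero_mem _
    | add x z _ _ hx hz => rw [add_mul]; exact add_mem hx hz
  refine hP h ?_
  induction hh using Algebra.adjoin_induction with
  | mem x hx =>
    rcases hx with hx | ⟨w, hw, rfl⟩
    · exact AddSubmonoid.subset_closure
        ⟨1, one_mem _, x, Submonoid.subset_closure hx, (one_smul _ x).symm⟩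
    · exact AddSubmonoid.subset_closure
        ⟨_, trace_mem_traceCenter_of_word hw, 1, one_mem _, rfl⟩
  | algebraMap r =>
    refine AddSubmonoid.subset_closure ⟨_, (traceCenter n g).algebraMap_mem r, 1, one_mem _, ?_⟩
    rw [algebraMap_smul, Algebra.algebraMap_eq_smul_one]
  | add x y _ _ hx hy => exact add_mem hx hy
  | mul x y _ _ hx hy => exact hmul x hx y hy

theorem transpose_mem_words {w : MatP n g} (hw : w ∈ Submonoid.closure (genSet n g)) :
    wᵀ ∈ Submonoid.closure (genSet n g) := by
  induction hw using Submonoid.closure_induction with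
  | mem x hx =>
    refine Submonoid.subset_closure ?_
    rcases hx with ⟨j, rfl⟩ | ⟨j, rfl⟩
    · exact Or.inr ⟨j, rfl⟩
    · exact Or.inl ⟨j, rfl⟩
  | one => rw [transpose_one]; exact one_mem _
  | mul x y _ _ hx hy => rw [transpose_mul]; exact mul_mem hy hx

theorem transpose_mem_traceRing {h : MatP n g} (hh : h ∈ traceRing n g) :
    hᵀ ∈ traceRing n g := by
  refine traceRing_induction (P := fun h => hᵀ ∈ traceRing n g) ?_ ?_ ?_ hh
  · intro x y hx hy
    rw [transpose_add]
    exact add_mem hx hy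
  · rw [transpose_zero]
    exact zero_mem _
  · intro c hc w hw
    rw [transpose_smul]
    exact smul_mem_traceRing hc (mem_traceRing_of_word (transpose_mem_words hw))

theorem trace_mem_traceCenter {h : MatP n g} (hh : h ∈ traceRing n g) :
    trace h ∈ traceCenter n g := by
  refine traceRing_induction (P := fun h => trace h ∈ traceCenter n g) ?_ ?_ ?_ hh
  · intro x y hx hy
    rw [trace_add]
    exact add_mem hx hy
  · rw [trace_zero]
    exact zero_mem _
  · intro c hc w hw
    rw [trace_smul, smul_eq_mul]
    exact mul_mem hc (trace_mem_traceCenter_of_word hw)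

end TraceRingBasics

section Derivative

open MvPolynomial

variable {n g : ℕ}

/-- The span of the four-index tensors `G₁ₑₐ G₂_cb`, `G₁ₑ_c G₂ₐ_b` and `G₁ₐ_c G₂ₑ_b` with
`G₁`, `G₂` in the trace ring. -/
def tensorSpan (n g : ℕ) : Submodule ℝ (Fin n → Fin n → Fin n → Fin n → PolyRing n g) :=
  Submodule.span ℝ {t | ∃ G ∈ traceRing n g, ∃ H ∈ traceRing n g,
    (t = fun a c e b => G e a * H c b) ∨ (t = fun a c e b => G e c * H a b) ∨
    (t = fun a c e b => G a c * H e b)}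

theorem tensorSpan_mul_right {t : Fin n → Fin n → Fin n → Fin n → PolyRing n g}
    (ht : t ∈ tensorSpan n g) {K : MatP n g} (hK : K ∈ traceRing n g) :
    (fun a c e b => ∑ f, t a c e f * K f b) ∈ tensorSpan n g := by
  induction ht using Submodule.span_induction with
  | mem x hx =>
    obtain ⟨G, hG, H, hH, hx⟩ := hx
    refine Submodule.subset_span ⟨G, hG, H * K, mul_mem hH hK, ?_⟩
    refine hx.imp ?_ (Or.imp ?_ ?_) <;>
    · rintro rfl
      simp only [mul_apply, Finset.mul_sum, mul_assoc]
  | zero => simp only [Pi.zero_apply, zero_mul, Finset.sum_const_zero]; exact zero_mem _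
  | add x y _ _ hx hy =>
    simp only [Pi.add_apply, add_mul, Finset.sum_add_distrib]
    exact add_mem hx hy
  | smul r x _ hx =>
    simp only [Pi.smul_apply, smul_mul_assoc, ← Finset.smul_sum]
    exact Submodule.smul_mem _ r hx

theorem tensorSpan_mul_left {t : Fin n → Fin n → Fin n → Fin n → PolyRing n g}
    (ht : t ∈ tensorSpan n g) {K : MatP n g} (hK : K ∈ traceRing n g) :
    (fun a c e b => ∑ f, K e f * t a c f b) ∈ tensorSpan n g := by
  induction ht using Submodule.span_induction with
  | mem x hx =>
    obtain ⟨G, hG, H, hH, hx⟩ := hx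
    rcases hx with hx | hx | hx
    · refine Submodule.subset_span ⟨K * G, mul_mem hK hG, H, hH, Or.inl ?_⟩
      simp only [hx, mul_apply, Finset.sum_mul, mul_assoc]
    · refine Submodule.subset_span ⟨K * G, mul_mem hK hG, H, hH, Or.inr (Or.inl ?_)⟩
      simp only [hx, mul_apply, Finset.sum_mul, mul_assoc]
    · refine Submodule.subset_span ⟨G, hG, K * H, mul_mem hK hH, Or.inr (Or.inr ?_)⟩
      simp only [hx, mul_apply, Finset.mul_sum, mul_left_comm]
  | zero => simp only [Pi.zero_apply, mul_zero, Finset.sum_const_zero]; exact zero_mem _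
  | add x y _ _ hx hy =>
    simp only [Pi.add_apply, mul_add, Finset.sum_add_distrib]
    exact add_mem hx hy
  | smul r x _ hx =>
    simp only [Pi.smul_apply, mul_smul_comm, ← Finset.smul_sum]
    exact Submodule.smul_mem _ r hx

/-- A contraction of four-index tensors maps `tensorSpan` into the trace ring as soon as it does
so for the generators. -/
theorem contraction_mem_traceRing
    (L : (Fin n → Fin n → Fin n → Fin n → PolyRing n g) →ₗ[ℝ] MatP n g)
    (h1 : ∀ G ∈ traceRing n g, ∀ H ∈ traceRing n g,
      L (fun a c e b => G e a * H c b) ∈ traceRing n g)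
    (h2 : ∀ G ∈ traceRing n g, ∀ H ∈ traceRing n g,
      L (fun a c e b => G e c * H a b) ∈ traceRing n g)
    (h3 : ∀ G ∈ traceRing n g, ∀ H ∈ traceRing n g,
      L (fun a c e b => G a c * H e b) ∈ traceRing n g)
    {t : Fin n → Fin n → Fin n → Fin n → PolyRing n g} (ht : t ∈ tensorSpan n g) :
    L t ∈ traceRing n g := by
  have : tensorSpan n g ≤ (Subalgebra.toSubmodule (traceRing n g)).comap L := by
    refine Submodule.span_le.2 ?_
    rintro x ⟨G, hG, H, hH, rfl | rfl | rfl⟩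
    · exact h1 G hG H hH
    · exact h2 G hG H hH
    · exact h3 G hG H hH
  exact this ht

theorem sum_right_mem_traceRing {t : Fin n → Fin n → Fin n → Fin n → PolyRing n g}
    (ht : t ∈ tensorSpan n g) :
    (of fun a c => ∑ e, t a c e e : MatP n g) ∈ traceRing n g := by
  let L : (Fin n → Fin n → Fin n → Fin n → PolyRing n g) →ₗ[ℝ] MatP n g :=
    { toFun := fun t => of fun a c => ∑ e, t a c e e
      map_add' := fun x y => by ext1 a c; simp [Finset.sum_add_distrib]
      map_smul' := fun r x => by ext1 a c; simp [Finset.smul_sum] }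
  refine contraction_mem_traceRing L ?_ ?_ ?_ ht
  · intro G hG H hH
    convert transpose_mem_traceRing (mul_mem hH hG) using 1
    ext1 a c
    simp [L, mul_apply, mul_comm]
  · intro G hG H hH
    convert mul_mem hH hG using 1
    ext1 a c
    simp [L, mul_apply, mul_comm]
  · intro G hG H hH
    convert smul_mem_traceRing (trace_mem_traceCenter hH) hG using 1
    ext1 a c
    simp [L, trace, mul_comm, Finset.mul_sum]

theorem sum_left_mem_traceRing {t : Fin n → Fin n → Fin n → Fin n → PolyRing n g}
    (ht : t ∈ tensorSpan n g) :
    (of fun c b => ∑ a, t a c a b : MatP n g) ∈ traceRing n g := by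
  let L : (Fin n → Fin n → Fin n → Fin n → PolyRing n g) →ₗ[ℝ] MatP n g :=
    { toFun := fun t => of fun c b => ∑ a, t a c a b
      map_add' := fun x y => by ext1 a c; simp [Finset.sum_add_distrib]
      map_smul' := fun r x => by ext1 a c; simp [Finset.smul_sum] }
  refine contraction_mem_traceRing L ?_ ?_ ?_ ht
  · intro G hG H hH
    convert smul_mem_traceRing (trace_mem_traceCenter hG) hH using 1
    ext1 a c
    simp [L, trace, Finset.sum_mul]
  · intro G hG H hH
    convert mul_mem (transpose_mem_traceRing hG) hH using 1
    ext1 a c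
    simp [L, mul_apply]
  · intro G hG H hH
    convert mul_mem (transpose_mem_traceRing hG) hH using 1
    ext1 a c
    simp [L, mul_apply]

theorem sum_left_mem_traceRing' {t : Fin n → Fin n → Fin n → Fin n → PolyRing n g}
    (ht : t ∈ tensorSpan n g) :
    (of fun c b => ∑ a, t c a a b : MatP n g) ∈ traceRing n g := by
  let L : (Fin n → Fin n → Fin n → Fin n → PolyRing n g) →ₗ[ℝ] MatP n g :=
    { toFun := fun t => of fun c b => ∑ a, t c a a b
      map_add' := fun x y => by ext1 a c; simp [Finset.sum_add_distrib]
      map_smul' := fun r x => by ext1 a c; simp [Finset.smul_sum] }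
  refine contraction_mem_traceRing L ?_ ?_ ?_ ht
  · intro G hG H hH
    convert mul_mem (transpose_mem_traceRing hG) hH using 1
    ext1 a c
    simp [L, mul_apply]
  · intro G hG H hH
    convert smul_mem_traceRing (trace_mem_traceCenter hG) hH using 1
    ext1 a c
    simp [L, trace, Finset.sum_mul]
  · intro G hG H hH
    convert mul_mem hG hH using 1
    ext1 a c
    simp [L, mul_apply]

theorem pderiv_mul_mem_tensorSpan {j : Fin g} {G H : MatP n g} (hG : G ∈ traceRing n g)
    (hH : H ∈ traceRing n g) (hG' : (fun a c e b => pderiv (j, a, c) (G e b)) ∈ tensorSpan n g)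
    (hH' : (fun a c e b => pderiv (j, a, c) (H e b)) ∈ tensorSpan n g) :
    (fun a c e b => pderiv (j, a, c) ((G * H) e b)) ∈ tensorSpan n g := by
  convert add_mem (tensorSpan_mul_right hG' hH) (tensorSpan_mul_left hH' hG) using 1
  ext1 a; ext1 c; ext1 e; ext1 b
  simp only [mul_apply, map_sum, Derivation.leibniz, Pi.add_apply, Finset.sum_add_distrib,
    smul_eq_mul]
  rw [add_comm]
  congr 1
  exact Finset.sum_congr rfl fun f _ => mul_comm _ _

theorem pderiv_genSet_mem_tensorSpan (j : Fin g) {x : MatP n g} (hx : x ∈ genSet n g) :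
    (fun a c e b => pderiv (j, a, c) (x e b)) ∈ tensorSpan n g := by
  rcases hx with ⟨k, rfl⟩ | ⟨k, rfl⟩
  · by_cases hjk : k = j
    · subst hjk
      refine Submodule.subset_span ⟨1, one_mem _, 1, one_mem _, Or.inl ?_⟩
      ext1 a; ext1 c; ext1 e; ext1 b
      by_cases h1 : e = a <;> by_cases h2 : c = b <;>
        simp [genMat, pderiv_X, one_apply, h1, h2, Ne.symm]
    · convert (tensorSpan n g).zero_mem using 1
      ext1 a; ext1 c; ext1 e; ext1 b
      simp [genMat, pderiv_X, hjk]
  · by_cases hjk : k = j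
    · subst hjk
      refine Submodule.subset_span ⟨1, one_mem _, 1, one_mem _, Or.inr (Or.inl ?_)⟩
      ext1 a; ext1 c; ext1 e; ext1 b
      by_cases h1 : e = c <;> by_cases h2 : a = b <;>
        simp [genMat, pderiv_X, one_apply, h1, h2, Ne.symm]
    · convert (tensorSpan n g).zero_mem using 1
      ext1 a; ext1 c; ext1 e; ext1 b
      simp [genMat, pderiv_X, hjk]

theorem pderiv_one_mem_tensorSpan (j : Fin g) :
    (fun a c e b => pderiv (j, a, c) ((1 : MatP n g) e b)) ∈ tensorSpan n g := by
  convert (tensorSpan n g).zero_mem using 1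
  ext1 a; ext1 c; ext1 e; ext1 b
  by_cases h : e = b <;> simp [one_apply, h]

theorem pderiv_mem_tensorSpan (j : Fin g) {G : MatP n g} (hG : G ∈ traceRing n g) :
    (fun a c e b => pderiv (j, a, c) (G e b)) ∈ tensorSpan n g := by
  have hword : ∀ w ∈ Submonoid.closure (genSet n g),
      (fun a c e b => pderiv (j, a, c) (w e b)) ∈ tensorSpan n g := by
    intro w hw
    induction hw using Submonoid.closure_induction with
    | mem x hx => exact pderiv_genSet_mem_tensorSpan j hx
    | one => exact pderiv_one_mem_tensorSpan j
    | mul x y hx hy hx' hy' =>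
      exact pderiv_mul_mem_tensorSpan (mem_traceRing_of_word hx) (mem_traceRing_of_word hy) hx' hy'
  induction hG using Algebra.adjoin_induction with
  | mem x hx =>
    rcases hx with hx | ⟨w, hw, rfl⟩
    · exact pderiv_genSet_mem_tensorSpan j hx
    · refine Submodule.subset_span ⟨_, sum_right_mem_traceRing (hword w hw), 1, one_mem _,
        Or.inr (Or.inr ?_)⟩
      ext1 a; ext1 c; ext1 e; ext1 b
      by_cases h : e = b <;> simp [h, trace, one_apply]
  | algebraMap r =>
    convert (tensorSpan n g).smul_mem r (pderiv_one_mem_tensorSpan j) using 1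
    ext1 a; ext1 c; ext1 e; ext1 b
    simp [Algebra.algebraMap_eq_smul_one]
  | add x y _ _ hx hy =>
    convert add_mem hx hy using 1
    ext1 a; ext1 c; ext1 e; ext1 b
    simp
  | mul x y hx hy hx' hy' => exact pderiv_mul_mem_tensorSpan hx hy hx' hy'

end Derivative

section Apolar

open MvPolynomial

variable {σ : Type*} [Fintype σ]

/-- The apolar inner product on real polynomials, for which multiplication by a variable is
adjoint to the partial derivative. -/
def apolar : MvPolynomial σ ℝ →ₗ[ℝ] MvPolynomial σ ℝ →ₗ[ℝ] ℝ :=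
  (basisMonomials σ ℝ).constr ℝ fun α => (∏ v, ((α v).factorial : ℝ)) • lcoeff ℝ α

theorem apolar_monomial (α : σ →₀ ℕ) (g : MvPolynomial σ ℝ) :
    apolar (monomial α 1) g = (∏ v, ((α v).factorial : ℝ)) * coeff α g := by
  have := (basisMonomials σ ℝ).constr_basis ℝ
    (fun α => (∏ v, ((α v).factorial : ℝ)) • lcoeff ℝ α) α
  rw [coe_basisMonomials] at this
  exact congrArg (fun L => L g) this

theorem apolar_apply (f g : MvPolynomial σ ℝ) :
    apolar f g = ∑ α ∈ f.support, (∏ v, ((α v).factorial : ℝ)) * coeff α f * coeff α g := by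
  conv_lhs => rw [f.as_sum]
  rw [map_sum, LinearMap.sum_apply]
  refine Finset.sum_congr rfl fun α _ => ?_
  have : monomial α (coeff α f) = coeff α f • monomial α (1 : ℝ) := by
    rw [smul_monomial, smul_eq_mul, mul_one]
  rw [this, map_smul, LinearMap.smul_apply, apolar_monomial, smul_eq_mul]
  ring

theorem apolar_comm (f g : MvPolynomial σ ℝ) : apolar f g = apolar g f := by
  classical
  have h1 : ∀ p q : MvPolynomial σ ℝ, p.support ⊆ f.support ∪ g.support → apolar p q =
      ∑ α ∈ f.support ∪ g.support, (∏ v, ((α v).factorial : ℝ)) * coeff α p * coeff α q := by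
    intro p q h
    rw [apolar_apply]
    refine Finset.sum_subset h fun α _ hα => ?_
    rw [notMem_support_iff.1 hα]
    ring
  rw [h1 f g Finset.subset_union_left, h1 g f Finset.subset_union_right]
  exact Finset.sum_congr rfl fun α _ => by ring

theorem eq_zero_of_apolar_self {f : MvPolynomial σ ℝ} (h : apolar f f = 0) : f = 0 := by
  rw [apolar_apply] at h
  have hpos : ∀ α : σ →₀ ℕ, (0 : ℝ) < ∏ v, ((α v).factorial : ℝ) := fun α =>
    Finset.prod_pos fun v _ => Nat.cast_pos.2 (Nat.factorial_pos _)
  rw [Finset.sum_eq_zero_iff_of_nonneg fun α _ => by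
    rw [mul_assoc]; exact mul_nonneg (hpos α).le (mul_self_nonneg _)] at h
  rw [← support_eq_empty, Finset.eq_empty_iff_forall_notMem]
  intro α hα
  have := h α hα
  rw [mul_assoc, mul_eq_zero, mul_self_eq_zero] at this
  exact mem_support_iff.1 hα (this.resolve_left (hpos α).ne')

theorem apolar_X_mul (v : σ) (f g : MvPolynomial σ ℝ) :
    apolar (X v * f) g = apolar f (pderiv v g) := by
  classical
  induction f using MvPolynomial.induction_on' with
  | monomial α a =>
    have h1 : monomial α a = a • monomial α (1 : ℝ) := by
      rw [smul_monomial, smul_eq_mul, mul_one]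
    have h2 : X v * monomial α (1 : ℝ) = monomial (α + Finsupp.single v 1) 1 := by
      rw [X, monomial_mul, one_mul, add_comm]
    rw [h1, mul_smul_comm, map_smul, map_smul, LinearMap.smul_apply, LinearMap.smul_apply, h2,
      apolar_monomial, apolar_monomial, coeff_pderiv,
      ← Finset.mul_prod_erase _ _ (Finset.mem_univ v),
      ← Finset.mul_prod_erase Finset.univ (fun w => ((α w).factorial : ℝ)) (Finset.mem_univ v)]
    have h3 : ∏ x ∈ Finset.univ.erase v, (((α + Finsupp.single v 1 : σ →₀ ℕ) x).factorial : ℝ)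
        = ∏ x ∈ Finset.univ.erase v, ((α x).factorial : ℝ) := by
      refine Finset.prod_congr rfl fun w hw => ?_
      rw [Finsupp.add_apply, Finsupp.single_apply, if_neg (Finset.ne_of_mem_erase hw).symm,
        add_zero]
    rw [h3]
    simp only [Finsupp.add_apply, Finsupp.single_eq_same, Nat.factorial_succ, Nat.cast_mul,
      Nat.cast_add, Nat.cast_one, smul_eq_mul]
    ring
  | add f₁ f₂ h₁ h₂ => rw [mul_add, map_add, map_add, LinearMap.add_apply, LinearMap.add_apply,
      h₁, h₂]

theorem apolar_homogeneousComponent {f : MvPolynomial σ ℝ} {d : ℕ} (hf : f.IsHomogeneous d)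
    (g : MvPolynomial σ ℝ) : apolar f (homogeneousComponent d g) = apolar f g := by
  rw [apolar_apply, apolar_apply]
  refine Finset.sum_congr rfl fun α hα => ?_
  rw [coeff_homogeneousComponent, if_pos]
  by_contra h
  exact mem_support_iff.1 hα (hf.coeff_eq_zero h)

/-- Orthogonal projection onto a graded subspace for the apolar inner product. -/
theorem exists_apolar_projection (A : Submodule ℝ (MvPolynomial σ ℝ))
    (hA : ∀ c ∈ A, ∀ d, homogeneousComponent d c ∈ A) (f : MvPolynomial σ ℝ) :
    ∃ r ∈ A, ∀ c ∈ A, apolar (f - r) c = 0 := by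
  have hhom : ∀ d, ∃ r ∈ A, ∀ c ∈ A, apolar (homogeneousComponent d f - r) c = 0 := by
    intro d
    let V : Submodule ℝ (homogeneousSubmodule σ ℝ d) := A.comap (Submodule.subtype _)
    have : Module.Finite ℝ (homogeneousSubmodule σ ℝ d) :=
      Module.Finite.iff_fg.2 (homogeneousSubmodule_fg _ _ d)
    let β : LinearMap.BilinForm ℝ (homogeneousSubmodule σ ℝ d) :=
      (apolar (σ := σ)).compl₁₂ (Submodule.subtype _) (Submodule.subtype _)
    have hβ : β.IsRefl := fun x y h => by
      change apolar (y : MvPolynomial σ ℝ) x = 0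
      rw [apolar_comm]
      exact h
    have hc := (LinearMap.BilinForm.isCompl_orthogonal_iff_disjoint (W := V) hβ).2 (by
      rw [Submodule.disjoint_def]
      intro x hx hx'
      have := hx' x hx
      exact Subtype.ext (eq_zero_of_apolar_self this))
    obtain ⟨r, u, hr, hu, hru⟩ := Submodule.codisjoint_iff_exists_add_eq.1 hc.codisjoint
      ⟨homogeneousComponent d f, homogeneousComponent_isHomogeneous d f⟩
    refine ⟨r, hr, fun c hc => ?_⟩
    have h1 : homogeneousComponent d f - r = u := by
      rw [sub_eq_iff_eq_add']
      exact (congrArg Subtype.val hru).symm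
    rw [h1, ← apolar_homogeneousComponent u.2, apolar_comm]
    exact hu ⟨homogeneousComponent d c, homogeneousComponent_isHomogeneous d c⟩ (hA c hc d)
  choose r hr hr' using hhom
  refine ⟨∑ d ∈ Finset.range (f.totalDegree + 1), r d, sum_mem fun d _ => hr d, fun c hc => ?_⟩
  have : f - ∑ d ∈ Finset.range (f.totalDegree + 1), r d
      = ∑ d ∈ Finset.range (f.totalDegree + 1), (homogeneousComponent d f - r d) := by
    rw [Finset.sum_sub_distrib, sum_homogeneousComponent]
  rw [this, map_sum, LinearMap.sum_apply]
  exact Finset.sum_eq_zero fun d _ => hr' d c hc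

theorem homogeneousComponent_mul_of_isHomogeneous {τ R : Type*} [CommSemiring R]
    (f : MvPolynomial τ R) {s : MvPolynomial τ R} {e : ℕ} (hs : s.IsHomogeneous e) (d : ℕ) :
    homogeneousComponent d (f * s) = if e ≤ d then homogeneousComponent (d - e) f * s else 0 := by
  have h1 : ∀ k, homogeneousComponent d (homogeneousComponent k f * s)
      = if d = k + e then homogeneousComponent k f * s else 0 := fun k =>
    homogeneousComponent_of_mem ((homogeneousComponent_isHomogeneous k f).mul hs)
  conv_lhs => rw [← sum_homogeneousComponent f]
  rw [Finset.sum_mul, map_sum]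
  simp only [h1]
  split_ifs with hed
  · by_cases hlt : d - e < f.totalDegree + 1
    · rw [Finset.sum_eq_single (d - e), if_pos (by omega)]
      · intro k _ hk
        rw [if_neg (by omega)]
      · intro h
        exact absurd (Finset.mem_range.2 hlt) h
    · rw [homogeneousComponent_eq_zero _ _ (by omega), zero_mul]
      refine Finset.sum_eq_zero fun k hk => ?_
      have := Finset.mem_range.1 hk
      rw [if_neg (by omega)]
  · refine Finset.sum_eq_zero fun k hk => ?_
    rw [if_neg (by omega)]

/-- Hilbert's finiteness theorem for graded subalgebras whose orthogonal complement is stable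
under multiplication. -/
theorem subalgebra_fg_of_apolar (A : Subalgebra ℝ (MvPolynomial σ ℝ))
    (hA : ∀ c ∈ A, ∀ d, homogeneousComponent d c ∈ A)
    (hmul : ∀ c ∈ A, ∀ u, (∀ a ∈ A, apolar u a = 0) → ∀ a ∈ A, apolar (c * u) a = 0) :
    A.FG := by
  classical
  let S : Set (MvPolynomial σ ℝ) := {c | c ∈ A ∧ ∃ d, 0 < d ∧ c.IsHomogeneous d}
  obtain ⟨s, hs, hspan⟩ := Submodule.fg_span_iff_fg_span_finset_subset S |>.1
    (IsNoetherian.noetherian (Ideal.span S))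
  refine ⟨s, le_antisymm (Algebra.adjoin_le fun c hc => (hs hc).1) ?_⟩
  have key : ∀ d, ∀ c ∈ A, c.IsHomogeneous d → c ∈ Algebra.adjoin ℝ (s : Set _) := by
    intro d
    induction d using Nat.strong_induction_on with
    | _ d ih =>
      intro c hc hcd
      rcases Nat.eq_zero_or_pos d with rfl | hd
      · rw [← homogeneousComponent_eq_self hcd, homogeneousComponent_zero]
        exact Subalgebra.algebraMap_mem _ _
      have hcS : c ∈ Submodule.span (MvPolynomial σ ℝ) (s : Set (MvPolynomial σ ℝ)) := by
        rw [← hspan]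
        exact Submodule.subset_span ⟨hc, d, hd, hcd⟩
      obtain ⟨f, -, hf⟩ := Submodule.mem_span_finset.1 hcS
      choose r hr hr' using exists_apolar_projection (Subalgebra.toSubmodule A) hA
      have hsum : c = ∑ a ∈ s, r (f a) * a := by
        rw [← sub_eq_zero]
        refine eq_zero_of_apolar_self ?_
        have hmem : c - ∑ a ∈ s, r (f a) * a ∈ A :=
          sub_mem hc (sum_mem fun a ha => mul_mem (hr _) (hs ha).1)
        have hex : c - ∑ a ∈ s, r (f a) * a = ∑ a ∈ s, a * (f a - r (f a)) := by
          rw [← hf, ← Finset.sum_sub_distrib]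
          exact Finset.sum_congr rfl fun a _ => by rw [smul_eq_mul]; ring
        conv_lhs => arg 1; rw [hex]
        rw [map_sum, LinearMap.sum_apply]
        exact Finset.sum_eq_zero fun a ha => hmul a (hs ha).1 _ (hr' _) _ hmem
      rw [← homogeneousComponent_eq_self hcd, hsum, map_sum]
      refine sum_mem fun a ha => ?_
      obtain ⟨haA, e, he, hae⟩ := hs ha
      rw [homogeneousComponent_mul_of_isHomogeneous _ hae]
      split_ifs with hed
      · exact mul_mem (ih _ (by omega) _ (hA _ (hr _) _) (homogeneousComponent_isHomogeneous _ _))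
          (Algebra.subset_adjoin ha)
      · exact zero_mem _
  intro c hc
  rw [← sum_homogeneousComponent c]
  exact sum_mem fun d _ => key d _ (hA c hc d) (homogeneousComponent_isHomogeneous _ _)

end Apolar

section TraceRingFinite

open MvPolynomial

variable {n g : ℕ}

theorem isHomogeneous_of_word {w : MatP n g} (hw : w ∈ Submonoid.closure (genSet n g)) :
    ∃ d, ∀ a b, (w a b).IsHomogeneous d := by
  induction hw using Submonoid.closure_induction with
  | mem x hx =>
    refine ⟨1, fun a b => ?_⟩
    rcases hx with ⟨j, rfl⟩ | ⟨j, rfl⟩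
    · exact isHomogeneous_X _ _
    · exact isHomogeneous_X _ _
  | one =>
    refine ⟨0, fun a b => ?_⟩
    rw [one_apply]
    split_ifs
    · exact isHomogeneous_one _ _
    · exact isHomogeneous_zero _ _ _
  | mul x y _ _ hx hy =>
    obtain ⟨d, hd⟩ := hx
    obtain ⟨e, he⟩ := hy
    exact ⟨d + e, fun a b => IsHomogeneous.sum _ _ _ fun c _ => (hd a c).mul (he c b)⟩

theorem homogeneousComponent_mem_traceCenter {c : PolyRing n g} (hc : c ∈ traceCenter n g)
    (d : ℕ) : homogeneousComponent d c ∈ traceCenter n g := by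
  have h1 : c ∈ Subalgebra.toSubmodule (traceCenter n g) := hc
  rw [traceCenter, Algebra.adjoin_eq_span] at h1
  induction h1 using Submodule.span_induction with
  | mem x hx =>
    have h2 : ∃ d, x.IsHomogeneous d := by
      clear hc
      induction hx using Submonoid.closure_induction with
      | mem x hx =>
        obtain ⟨w, hw, rfl⟩ := hx
        obtain ⟨d, hd⟩ := isHomogeneous_of_word hw
        exact ⟨d, IsHomogeneous.sum _ _ _ fun a _ => hd a a⟩
      | one => exact ⟨0, isHomogeneous_one _ _⟩
      | mul x y _ _ hx hy =>
        obtain ⟨d, hd⟩ := hx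
        obtain ⟨e, he⟩ := hy
        exact ⟨d + e, hd.mul he⟩
    obtain ⟨e, he⟩ := h2
    rw [homogeneousComponent_of_mem he]
    split_ifs
    · exact hc
    · exact zero_mem _
  | zero => rw [map_zero]; exact zero_mem _
  | add x y hx hy hx' hy' =>
    rw [← Algebra.adjoin_eq_span] at hx hy
    rw [map_add]
    exact add_mem (hx' hx) (hy' hy)
  | smul r x hx hx' =>
    rw [← Algebra.adjoin_eq_span] at hx
    rw [map_smul]
    exact Subalgebra.smul_mem _ (hx' hx) r

/-- The apolar inner product of matrices of polynomials. -/
def matApolar (G F : MatP n g) : ℝ := ∑ a, ∑ b, apolar (G a b) (F a b)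

theorem matApolar_genMat_mul (j : Fin g) (G F : MatP n g) :
    matApolar (genMat n g j * G) F =
      matApolar G (of fun c b => ∑ a, pderiv (j, a, c) (F a b)) := by
  simp only [matApolar, mul_apply, map_sum, LinearMap.sum_apply, genMat, of_apply, apolar_X_mul]
  calc _ = ∑ b, ∑ a, ∑ c, apolar (G c b) (pderiv (j, a, c) (F a b)) := Finset.sum_comm
    _ = ∑ b, ∑ c, ∑ a, apolar (G c b) (pderiv (j, a, c) (F a b)) :=
      Finset.sum_congr rfl fun b _ => Finset.sum_comm
    _ = _ := Finset.sum_comm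

theorem matApolar_genMat_transpose_mul (j : Fin g) (G F : MatP n g) :
    matApolar ((genMat n g j)ᵀ * G) F =
      matApolar G (of fun c b => ∑ a, pderiv (j, c, a) (F a b)) := by
  simp only [matApolar, mul_apply, map_sum, LinearMap.sum_apply, genMat, of_apply, apolar_X_mul,
    transpose_apply]
  calc _ = ∑ b, ∑ a, ∑ c, apolar (G c b) (pderiv (j, c, a) (F a b)) := Finset.sum_comm
    _ = ∑ b, ∑ c, ∑ a, apolar (G c b) (pderiv (j, c, a) (F a b)) :=
      Finset.sum_congr rfl fun b _ => Finset.sum_comm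
    _ = _ := Finset.sum_comm

theorem matApolar_word_mul {G : MatP n g} (hG : ∀ F ∈ traceRing n g, matApolar G F = 0)
    {w : MatP n g} (hw : w ∈ Submonoid.closure (genSet n g)) :
    ∀ F ∈ traceRing n g, matApolar (w * G) F = 0 := by
  induction hw using Submonoid.closure_induction generalizing G with
  | mem x hx =>
    intro F hF
    rcases hx with ⟨j, rfl⟩ | ⟨j, rfl⟩
    · rw [matApolar_genMat_mul]
      exact hG _ (sum_left_mem_traceRing (pderiv_mem_tensorSpan j hF))
    · change matApolar ((genMat n g j)ᵀ * G) F = 0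
      rw [matApolar_genMat_transpose_mul]
      exact hG _ (sum_left_mem_traceRing' (pderiv_mem_tensorSpan j hF))
  | one => simpa using hG
  | mul x y _ _ hx hy => rw [mul_assoc]; exact hx (hy hG)

theorem apolar_mul_traceCenter {c : PolyRing n g} (hc : c ∈ traceCenter n g) (u : PolyRing n g)
    (hu : ∀ a ∈ traceCenter n g, apolar u a = 0) :
    ∀ a ∈ traceCenter n g, apolar (c * u) a = 0 := by
  induction hc using Algebra.adjoin_induction generalizing u with
  | mem x hx =>
    obtain ⟨w, hw, rfl⟩ := hx
    intro a ha
    have h1 : ∀ F ∈ traceRing n g, matApolar (u • (1 : MatP n g)) F = 0 := by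
      intro F hF
      have : matApolar (u • (1 : MatP n g)) F = apolar u (trace F) := by
        simp only [matApolar, trace, map_sum, diag_apply, Matrix.smul_apply, one_apply, smul_eq_mul,
          mul_ite, mul_one, mul_zero]
        refine Finset.sum_congr rfl fun a _ => ?_
        rw [Finset.sum_eq_single a]
        · rw [if_pos rfl]
        · intro b _ hb
          rw [if_neg hb.symm, map_zero, LinearMap.zero_apply]
        · simp
      rw [this]
      exact hu _ (trace_mem_traceCenter hF)
    have h2 := matApolar_word_mul h1 hw _ (smul_one_mem_traceRing ha)
    rw [← h2]
    simp only [matApolar, trace, diag_apply, Matrix.smul_apply, one_apply, smul_eq_mul,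
      mul_ite, mul_one, mul_zero, Finset.sum_mul, map_sum, LinearMap.sum_apply,
      mul_smul_comm]
    refine Finset.sum_congr rfl fun i _ => ?_
    rw [Finset.sum_eq_single i]
    · rw [if_pos rfl, mul_comm]
    · intro b _ hb
      rw [if_neg hb.symm, map_zero]
    · simp
  | algebraMap r =>
    intro a ha
    rw [← Algebra.smul_def, map_smul, LinearMap.smul_apply, hu a ha, smul_zero]
  | add x y _ _ hx hy =>
    intro a ha
    rw [add_mul, map_add, LinearMap.add_apply, hx u hu a ha, hy u hu a ha, add_zero]
  | mul x y _ _ hx hy =>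
    rw [mul_assoc]
    exact hx _ (hy u hu)

theorem traceCenter_fg : (traceCenter n g).FG :=
  subalgebra_fg_of_apolar _ (fun _ hc d => homogeneousComponent_mem_traceCenter hc d)
    fun _ hc u hu => apolar_mul_traceCenter hc u hu

theorem exists_traceCenter_projection (f : PolyRing n g) :
    ∃ r ∈ traceCenter n g, ∀ c ∈ traceCenter n g, apolar (f - r) c = 0 :=
  exists_apolar_projection (Subalgebra.toSubmodule (traceCenter n g))
    (fun _ hc d => homogeneousComponent_mem_traceCenter hc d) f

theorem eq_zero_of_trace_mul_transpose {h : MatP n g} (hh : trace (h * hᵀ) = 0) : h = 0 := by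
  ext1 a b
  refine MvPolynomial.funext fun x => ?_
  have h1 : ∑ a, ∑ b, MvPolynomial.eval x (h a b) ^ 2 = 0 := by
    have := congrArg (MvPolynomial.eval x) hh
    simpa [trace, mul_apply, sq] using this
  rw [Finset.sum_eq_zero_iff_of_nonneg fun a _ => Finset.sum_nonneg fun b _ => sq_nonneg _] at h1
  have h2 := h1 a (Finset.mem_univ a)
  rw [Finset.sum_eq_zero_iff_of_nonneg fun b _ => sq_nonneg _] at h2
  simpa using h2 b (Finset.mem_univ b)

/-- The trace ring is a finite module over the algebra of traces. -/
theorem exists_generators_traceRing (n g : ℕ) :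
    ∃ (m : ℕ) (e : Fin m → MatP n g), (∀ i, e i ∈ traceRing n g) ∧
      ∀ h ∈ traceRing n g, ∃ r : Fin m → PolyRing n g,
        (∀ i, r i ∈ traceCenter n g) ∧ h = ∑ i, r i • e i := by
  classical
  obtain ⟨s, hs, hspan⟩ := Submodule.fg_span_iff_fg_span_finset_subset
    (R := PolyRing n g) (traceRing n g : Set (MatP n g)) |>.1 (IsNoetherian.noetherian _)
  refine ⟨s.card, fun i => s.equivFin.symm i, fun i => hs (s.equivFin.symm i).2, fun h hh => ?_⟩
  have hmem : h ∈ Submodule.span (PolyRing n g) (s : Set (MatP n g)) := by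
    rw [← hspan]
    exact Submodule.subset_span hh
  obtain ⟨f, -, hf⟩ := Submodule.mem_span_finset.1 hmem
  choose r hr hr' using exists_traceCenter_projection (n := n) (g := g)
  refine ⟨fun i => r (f (s.equivFin.symm i)), fun i => hr _, ?_⟩
  have hre : ∑ i, r (f (s.equivFin.symm i)) • (s.equivFin.symm i : MatP n g)
      = ∑ x ∈ s, r (f x) • x := by
    rw [s.equivFin.symm.sum_comp fun x : s => r (f x) • (x : MatP n g)]
    exact Finset.sum_coe_sort s fun x => r (f x) • x
  rw [hre, ← sub_eq_zero]
  set δ := h - ∑ x ∈ s, r (f x) • x with hδ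
  have hδmem : δ ∈ traceRing n g :=
    sub_mem hh (sum_mem fun x hx => smul_mem_traceRing (hr _) (hs hx))
  have hδ' : δ = ∑ x ∈ s, (f x - r (f x)) • x := by
    rw [hδ, ← hf, ← Finset.sum_sub_distrib]
    simp only [sub_smul]
  refine eq_zero_of_trace_mul_transpose (eq_zero_of_apolar_self ?_)
  have hexp : trace (δ * δᵀ) = ∑ x ∈ s, trace (x * δᵀ) * (f x - r (f x)) := by
    have : δ * δᵀ = ∑ x ∈ s, (f x - r (f x)) • (x * δᵀ) := by
      conv_lhs => arg 1; rw [hδ']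
      rw [Finset.sum_mul]
      simp only [smul_mul]
    rw [this, trace_sum]
    exact Finset.sum_congr rfl fun x _ => by rw [trace_smul, smul_eq_mul, mul_comm]
  conv_lhs => arg 1; rw [hexp]
  rw [map_sum, LinearMap.sum_apply]
  exact Finset.sum_eq_zero fun x hx => apolar_mul_traceCenter
    (trace_mem_traceCenter (mul_mem (hs hx) (transpose_mem_traceRing hδmem))) _ (hr' _) _
    (trace_mem_traceCenter (mul_mem hδmem (transpose_mem_traceRing hδmem)))

end TraceRingFinite

section ComplexPoint

open MvPolynomial

variable {n g : ℕ}

theorem one_notMem_span_ker (φ : traceCenter n g →ₐ[ℝ] ℝ) :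
    (1 : PolyRing n g) ∉ Ideal.map (traceCenter n g).val (RingHom.ker φ) := by
  intro h
  obtain ⟨s, hs, f, hf⟩ := (Submodule.mem_span_image_iff_exists_fun (PolyRing n g)).1 h
  choose r hr hr' using exists_traceCenter_projection (n := n) (g := g)
  have h1 : (1 : traceCenter n g) = ∑ x : s, (⟨r (f x), hr _⟩ : traceCenter n g) * x := by
    refine Subtype.ext ?_
    rw [← sub_eq_zero]
    have hexp : (1 : PolyRing n g) - ∑ x : s, r (f x) * (x : traceCenter n g)
        = ∑ x : s, ((x : traceCenter n g) : PolyRing n g) * (f x - r (f x)) := by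
      rw [← hf, ← Finset.sum_sub_distrib]
      exact Finset.sum_congr rfl fun x _ => by simp; ring
    have hmem : (1 : PolyRing n g) - ∑ x : s, r (f x) * (x : traceCenter n g)
        ∈ traceCenter n g :=
      sub_mem (one_mem _) (sum_mem fun x _ => mul_mem (hr _) (x : traceCenter n g).2)
    have h0 : (1 : PolyRing n g) - ∑ x : s, r (f x) * (x : traceCenter n g) = 0 := by
      refine eq_zero_of_apolar_self ?_
      conv_lhs => arg 1; rw [hexp]
      rw [map_sum, LinearMap.sum_apply]
      exact Finset.sum_eq_zero fun x _ =>
        apolar_mul_traceCenter (x : traceCenter n g).2 _ (hr' _) _ hmem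
    simpa using h0
  have h2 := congrArg φ h1
  rw [map_one, map_sum] at h2
  refine one_ne_zero (h2.trans (Finset.sum_eq_zero fun x _ => ?_))
  rw [map_mul, (RingHom.mem_ker (f := φ)).1 (hs x.2), mul_zero]

/-- Every real character of the algebra of traces is evaluation at a complex point. -/
theorem exists_complex_point (φ : traceCenter n g →ₐ[ℝ] ℝ) :
    ∃ p : Fin g × Fin n × Fin n → ℂ, ∀ c : traceCenter n g,
      aeval p (c : PolyRing n g) = (φ c : ℂ) := by
  obtain ⟨M, hM, hle⟩ := Ideal.exists_le_maximal _
    ((Ideal.ne_top_iff_one _).2 (one_notMem_span_ker φ))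
  let _ : Field (PolyRing n g ⧸ M) := Ideal.Quotient.field M
  have hfin : Module.Finite ℝ (PolyRing n g ⧸ M) :=
    finite_of_finite_type_of_isJacobsonRing ℝ (PolyRing n g ⧸ M)
  let l : (PolyRing n g ⧸ M) →ₐ[ℝ] ℂ := IsAlgClosed.lift
  refine ⟨fun v => l (Ideal.Quotient.mk M (X v)), fun c => ?_⟩
  have h1 : aeval (fun v => l (Ideal.Quotient.mk M (X v))) =
      l.comp (Ideal.Quotient.mkₐ ℝ M) := by
    apply MvPolynomial.algHom_ext
    intro v
    rw [aeval_X]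
    rfl
  rw [h1]
  have h2 : (c : PolyRing n g) - algebraMap ℝ _ (φ c) ∈ M := by
    refine hle (Ideal.mem_map_of_mem (traceCenter n g).val
      (x := c - algebraMap ℝ _ (φ c)) ?_)
    rw [RingHom.mem_ker, map_sub, AlgHom.commutes, sub_eq_zero]
    rfl
  have h3 : Ideal.Quotient.mk M (c : PolyRing n g) = algebraMap ℝ _ (φ c) :=
    (Ideal.Quotient.eq).2 h2
  change l (Ideal.Quotient.mk M (c : PolyRing n g)) = _
  rw [h3, AlgHom.commutes]
  rfl

end ComplexPoint

section HermitianFunctionalCalculus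

open Polynomial ComplexOrder

variable {𝕜 : Type} [RCLike 𝕜] {n : ℕ}

theorem exists_unitary_diagonal {M : Matrix (Fin n) (Fin n) 𝕜} (hM : M.IsHermitian) :
    ∃ U : Matrix (Fin n) (Fin n) 𝕜, U * Uᴴ = 1 ∧ Uᴴ * U = 1 ∧
      M = U * diagonal (fun i => (hM.eigenvalues i : 𝕜)) * Uᴴ := by
  refine ⟨hM.eigenvectorUnitary, ?_, ?_, ?_⟩
  · exact Unitary.coe_mul_star_self hM.eigenvectorUnitary
  · exact Unitary.coe_star_mul_self hM.eigenvectorUnitary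
  · have := hM.spectral_theorem
    rw [Unitary.conjStarAlgAut_apply] at this
    exact this

theorem aeval_unitary_diagonal {U : Matrix (Fin n) (Fin n) 𝕜} (h1 : U * Uᴴ = 1)
    (h2 : Uᴴ * U = 1) (d : Fin n → ℝ) (f : ℝ[X]) :
    aeval (U * diagonal (fun i => (d i : 𝕜)) * Uᴴ) f =
      U * diagonal (fun i => ((f.eval (d i) : ℝ) : 𝕜)) * Uᴴ := by
  have hpow : ∀ k : ℕ, (U * diagonal (fun i => (d i : 𝕜)) * Uᴴ) ^ k =
      U * diagonal (fun i => (d i : 𝕜) ^ k) * Uᴴ := by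
    intro k
    induction k with
    | zero => simp [h1]
    | succ k ih =>
      rw [pow_succ, ih]
      calc _ = U * diagonal (fun i => (d i : 𝕜) ^ k) * (Uᴴ * U) *
            diagonal (fun i => (d i : 𝕜)) * Uᴴ := by simp only [Matrix.mul_assoc]
        _ = _ := by
          rw [h2, Matrix.mul_one, Matrix.mul_assoc U, diagonal_mul_diagonal]
          simp only [pow_succ]
  induction f using Polynomial.induction_on' with
  | add p q hp hq =>
    rw [map_add, hp, hq, ← Matrix.add_mul, ← Matrix.mul_add, diagonal_add]
    simp
  | monomial k a =>
    rw [aeval_monomial, hpow, ← Algebra.smul_def, ← Matrix.smul_mul, ← Matrix.mul_smul,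
      ← diagonal_smul]
    congr 3
    ext i
    simp [RCLike.real_smul_eq_coe_mul]

theorem exists_eval_eq (d : Fin n → ℝ) (F : ℝ → ℝ) : ∃ f : ℝ[X], ∀ i, f.eval (d i) = F (d i) := by
  refine ⟨Lagrange.interpolate (Finset.univ.image d) id F, fun i => ?_⟩
  exact Lagrange.eval_interpolate_at_node F (Set.injOn_id _)
    (Finset.mem_image_of_mem d (Finset.mem_univ i))

/-- A polynomial inverse square root of a positive definite matrix. -/
theorem exists_inv_sqrt {M : Matrix (Fin n) (Fin n) 𝕜} (hM : M.PosDef) :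
    ∃ f : ℝ[X], (aeval M f).PosDef ∧ aeval M f * aeval M f * M = 1 := by
  obtain ⟨U, h1, h2, h3⟩ := exists_unitary_diagonal hM.1
  obtain ⟨f, hf⟩ := exists_eval_eq hM.1.eigenvalues fun t => (Real.sqrt t)⁻¹
  have hpos := fun i => hM.eigenvalues_pos i
  have hfM := aeval_unitary_diagonal h1 h2 hM.1.eigenvalues f
  rw [← h3] at hfM
  refine ⟨f, ?_, ?_⟩
  · rw [hfM]
    have hU : IsUnit (Uᴴ) := ⟨⟨Uᴴ, U, h2, h1⟩, rfl⟩
    have hd : (diagonal fun i => ((f.eval (hM.1.eigenvalues i) : ℝ) : 𝕜)).PosDef := by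
      refine PosDef.diagonal fun i => ?_
      rw [hf]
      exact_mod_cast inv_pos.2 (Real.sqrt_pos.2 (hpos i))
    have := hd.conjTranspose_mul_mul_same (B := Uᴴ) (Matrix.mulVec_injective_of_isUnit hU)
    rwa [conjTranspose_conjTranspose] at this
  · have hmul : ∀ a b : Fin n → 𝕜, (U * diagonal a * Uᴴ) * (U * diagonal b * Uᴴ) =
        U * diagonal (fun i => a i * b i) * Uᴴ := by
      intro a b
      calc _ = U * diagonal a * (Uᴴ * U) * diagonal b * Uᴴ := by simp only [Matrix.mul_assoc]
        _ = _ := by rw [h2, Matrix.mul_one, Matrix.mul_assoc U, diagonal_mul_diagonal]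
    rw [hfM]
    conv_lhs => arg 2; rw [h3]
    rw [hmul, hmul]
    have : (fun i => ((f.eval (hM.1.eigenvalues i) : ℝ) : 𝕜) *
        ((f.eval (hM.1.eigenvalues i) : ℝ) : 𝕜) * (hM.1.eigenvalues i : 𝕜)) = fun _ => 1 := by
      ext i
      rw [hf]
      have h4 : (Real.sqrt (hM.1.eigenvalues i))⁻¹ * (Real.sqrt (hM.1.eigenvalues i))⁻¹ *
          hM.1.eigenvalues i = 1 := by
        rw [← mul_inv, Real.mul_self_sqrt (hpos i).le, inv_mul_cancel₀ (hpos i).ne']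
      exact_mod_cast h4
    rw [this, diagonal_one, Matrix.mul_one, h1]

theorem exists_posDef_sqrt {M : Matrix (Fin n) (Fin n) 𝕜} (hM : M.PosDef) :
    ∃ S : Matrix (Fin n) (Fin n) 𝕜, S.PosDef ∧ S * S = M := by
  obtain ⟨f, hf, h1⟩ := exists_inv_sqrt hM
  refine ⟨(aeval M f)⁻¹, hf.inv, ?_⟩
  rw [← Matrix.mul_inv_rev]
  exact Matrix.inv_eq_right_inv h1

theorem PosDef.eq_of_mul_self_eq {A B : Matrix (Fin n) (Fin n) 𝕜} (hA : A.PosDef)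
    (hB : B.PosDef) (h : A * A = B * B) : A = B := by
  have hX : A * (A - B) = -((A - B) * B) := by
    rw [Matrix.mul_sub, Matrix.sub_mul, h]; abel
  set X := A - B with hXdef
  have hA0 : 0 ≤ trace (Xᴴ * A * X) := (hA.posSemidef.conjTranspose_mul_mul_same X).trace_nonneg
  have hB0 : 0 ≤ trace (X * B * Xᴴ) := (hB.posSemidef.mul_mul_conjTranspose_same X).trace_nonneg
  have heq : trace (Xᴴ * A * X) = -trace (X * B * Xᴴ) := by
    rw [Matrix.mul_assoc, hX, Matrix.mul_neg, trace_neg, trace_mul_comm]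
  have h0 : trace (Xᴴ * A * X) = 0 := le_antisymm (heq ▸ neg_nonpos.2 hB0) hA0
  have h1 := (hA.posSemidef.conjTranspose_mul_mul_same X).trace_eq_zero_iff.1 h0
  have h2 : X = 0 := by
    ext i j
    by_contra hne
    have hv : X.col j ≠ 0 := fun h => hne (congrFun h i)
    have h3 := hA.dotProduct_mulVec_pos hv
    have h4 : star (X.col j) ⬝ᵥ (A *ᵥ X.col j) = (Xᴴ * A * X) j j := by
      rw [Matrix.mul_assoc]
      rfl
    rw [h4, h1] at h3
    exact lt_irrefl _ h3
  exact sub_eq_zero.1 h2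

end HermitianFunctionalCalculus

section RealStructure

open Polynomial ComplexOrder

variable {n : ℕ}

/-- Entrywise complex conjugation of matrices. -/
def conjMat (n : ℕ) : Matrix (Fin n) (Fin n) ℂ →ₐ[ℝ] Matrix (Fin n) (Fin n) ℂ :=
  (Complex.conjAe : ℂ →ₐ[ℝ] ℂ).mapMatrix

theorem conjMat_eq_transpose (a : Matrix (Fin n) (Fin n) ℂ) : conjMat n a = (aᴴ)ᵀ := by
  ext i j
  simp [conjMat]

theorem conjMat_transpose (a : Matrix (Fin n) (Fin n) ℂ) : conjMat n aᵀ = aᴴ := by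
  ext i j
  simp [conjMat]

theorem conjMat_conjMat (a : Matrix (Fin n) (Fin n) ℂ) : conjMat n (conjMat n a) = a := by
  ext i j
  simp [conjMat]

theorem PosDef.conjMat {a : Matrix (Fin n) (Fin n) ℂ} (ha : a.PosDef) :
    (conjMat n a).PosDef := by
  rw [conjMat_eq_transpose, ha.1.eq]
  exact ha.transpose

theorem aeval_mul_comm_of_semiconj {A B H : Matrix (Fin n) (Fin n) ℂ} (h : B * H = H * A)
    (f : ℝ[X]) : aeval B f * H = H * aeval A f := by
  induction f using Polynomial.induction_on' with
  | add p q hp hq => rw [map_add, map_add, Matrix.add_mul, Matrix.mul_add, hp, hq]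
  | monomial k a =>
    have hpow : ∀ k : ℕ, B ^ k * H = H * A ^ k := by
      intro k
      induction k with
      | zero => simp
      | succ k ih => rw [pow_succ, Matrix.mul_assoc, h, ← Matrix.mul_assoc, ih, pow_succ,
          Matrix.mul_assoc]
    rw [aeval_monomial, aeval_monomial, ← Algebra.smul_def, ← Algebra.smul_def,
      Matrix.smul_mul, Matrix.mul_smul, hpow]

theorem exists_balanced_posDef {R : Set (Matrix (Fin n) (Fin n) ℂ)}
    {H : Matrix (Fin n) (Fin n) ℂ} (hH : H.PosDef) (hR : ∀ a ∈ R, conjMat n a * H = H * a) :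
    ∃ K : Matrix (Fin n) (Fin n) ℂ, K.PosDef ∧ conjMat n K * K = 1 ∧
      ∀ a ∈ R, conjMat n a * K = K * a := by
  obtain ⟨S, hS, hSS⟩ := exists_posDef_sqrt hH
  set H' := conjMat n H with hH'
  have hM : (S * H' * S).PosDef := by
    have := (PosDef.conjMat hH).conjTranspose_mul_mul_same (B := S)
      (Matrix.mulVec_injective_of_isUnit hS.isUnit)
    rwa [hS.1.eq] at this
  obtain ⟨f, hf, h1⟩ := exists_inv_sqrt hM
  have hsemi : aeval (S * H' * S) f * S = S * aeval (H' * H) f := by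
    refine aeval_mul_comm_of_semiconj ?_ f
    rw [← hSS]
    simp only [Matrix.mul_assoc]
  have hsemi2 : aeval (H * H') f * H = H * aeval (H' * H) f :=
    aeval_mul_comm_of_semiconj (by simp only [Matrix.mul_assoc]) f
  have hK : H * aeval (H' * H) f = S * aeval (S * H' * S) f * S := by
    rw [Matrix.mul_assoc, hsemi, ← Matrix.mul_assoc, hSS]
  have hinv : (H' * H) * aeval (H' * H) f * aeval (H' * H) f = 1 := by
    have h2 : S * (aeval (H' * H) f * aeval (H' * H) f * (H' * H)) = S := by
      calc _ = (S * aeval (H' * H) f) * aeval (H' * H) f * (H' * H) := by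
            simp only [Matrix.mul_assoc]
        _ = aeval (S * H' * S) f * (S * aeval (H' * H) f) * (H' * H) := by
          conv_lhs => rw [← hsemi]
          simp only [Matrix.mul_assoc]
        _ = aeval (S * H' * S) f * aeval (S * H' * S) f * (S * H' * S) * S := by
          rw [← hsemi, ← hSS]; simp only [Matrix.mul_assoc]
        _ = S := by rw [h1, Matrix.one_mul]
    have h3 : aeval (H' * H) f * aeval (H' * H) f * (H' * H) = 1 :=
      hS.isUnit.mul_left_cancel (h2.trans (Matrix.mul_one S).symm)
    have h4 : aeval (H' * H) f * (H' * H) = (H' * H) * aeval (H' * H) f :=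
      aeval_mul_comm_of_semiconj rfl f
    rw [← h4, Matrix.mul_assoc, ← h4, ← Matrix.mul_assoc, h3]
  refine ⟨H * aeval (H' * H) f, ?_, ?_, ?_⟩
  · rw [hK]
    have := hf.conjTranspose_mul_mul_same (B := S) (Matrix.mulVec_injective_of_isUnit hS.isUnit)
    rwa [hS.1.eq] at this
  · rw [map_mul, ← Polynomial.aeval_algHom_apply, map_mul, ← hH', hH', conjMat_conjMat, ← hH',
      ← hinv]
    calc _ = H' * (aeval (H * H') f * H) * aeval (H' * H) f := by simp only [Matrix.mul_assoc]
      _ = _ := by rw [hsemi2]; simp only [Matrix.mul_assoc]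
  · intro a ha
    have h5 : a * H' = H' * conjMat n a := by
      have := congrArg (conjMat n) (hR a ha)
      rwa [map_mul, map_mul, conjMat_conjMat] at this
    have h6 : aeval (H' * H) f * a = a * aeval (H' * H) f := by
      refine aeval_mul_comm_of_semiconj ?_ f
      rw [Matrix.mul_assoc, ← hR a ha, ← Matrix.mul_assoc, ← h5, Matrix.mul_assoc]
    rw [← Matrix.mul_assoc, hR a ha, Matrix.mul_assoc, Matrix.mul_assoc, h6]

/-- Matrices that intertwine with their conjugates through a positive definite matrix become
real under a complex orthogonal change of basis. -/
theorem exists_orthogonal_real {R : Set (Matrix (Fin n) (Fin n) ℂ)}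
    {H : Matrix (Fin n) (Fin n) ℂ} (hH : H.PosDef) (hR : ∀ a ∈ R, conjMat n a * H = H * a) :
    ∃ Q : Matrix (Fin n) (Fin n) ℂ, Qᵀ * Q = 1 ∧
      ∀ a ∈ R, conjMat n (Qᵀ * a * Q) = Qᵀ * a * Q := by
  obtain ⟨K, hK, hKK, hRK⟩ := exists_balanced_posDef hH hR
  obtain ⟨S, hS, hSS⟩ := exists_posDef_sqrt hK
  have hdet : IsUnit S.det := (Matrix.isUnit_iff_isUnit_det S).1 hS.isUnit
  have hS1 : S * S⁻¹ = 1 := Matrix.mul_nonsing_inv S hdet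
  have hS2 : S⁻¹ * S = 1 := Matrix.nonsing_inv_mul S hdet
  have hK1 : K⁻¹ = S⁻¹ * S⁻¹ := by rw [← hSS, Matrix.mul_inv_rev]
  have hconj : conjMat n S = S⁻¹ := by
    refine PosDef.eq_of_mul_self_eq (PosDef.conjMat hS) hS.inv ?_
    rw [← map_mul, hSS, ← hK1]
    exact (Matrix.inv_eq_left_inv hKK).symm
  have hST : Sᵀ = S⁻¹ := by
    rw [← hconj, conjMat_eq_transpose, hS.1.eq]
  have hconj' : conjMat n S⁻¹ = S := by rw [← hconj, conjMat_conjMat]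
  refine ⟨S⁻¹, ?_, fun a ha => ?_⟩
  · rw [← hST, transpose_transpose, hST, hS1]
  · have h1 : (S⁻¹)ᵀ = S := by rw [← hST, transpose_transpose]
    rw [h1, map_mul, map_mul, hconj, hconj']
    have h2 : conjMat n a = S * S * a * (S⁻¹ * S⁻¹) := by
      rw [hSS, ← hK1, ← hRK a ha, Matrix.mul_assoc, hK1, ← hSS,
        Matrix.mul_assoc S, ← Matrix.mul_assoc S S⁻¹, hS1, Matrix.one_mul, hS1, Matrix.mul_one]
    rw [h2]
    calc _ = (S⁻¹ * S) * S * a * S⁻¹ * (S⁻¹ * S) := by simp only [Matrix.mul_assoc]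
      _ = _ := by rw [hS2, Matrix.one_mul, Matrix.mul_one]

end RealStructure

section Intertwiner

open ComplexOrder

variable {n : ℕ}

/-- The real part of the trace form on a real algebra of complex matrices. -/
def traceForm (R : Subalgebra ℝ (Matrix (Fin n) (Fin n) ℂ)) : LinearMap.BilinForm ℝ R :=
  LinearMap.mk₂ ℝ
    (fun a b => (trace ((a : Matrix (Fin n) (Fin n) ℂ) * (b : Matrix (Fin n) (Fin n) ℂ)ᵀ)).re)
    (fun a b c => by simp [Matrix.add_mul])
    (fun r a b => by simp)
    (fun a b c => by simp [Matrix.mul_add])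
    (fun r a b => by simp)

theorem traceForm_apply {R : Subalgebra ℝ (Matrix (Fin n) (Fin n) ℂ)} (a b : R) :
    traceForm R a b =
      (trace ((a : Matrix (Fin n) (Fin n) ℂ) * (b : Matrix (Fin n) (Fin n) ℂ)ᵀ)).re := rfl

theorem traceForm_comm {R : Subalgebra ℝ (Matrix (Fin n) (Fin n) ℂ)} (a b : R) :
    traceForm R a b = traceForm R b a := by
  rw [traceForm_apply, traceForm_apply, ← trace_transpose, transpose_mul, transpose_transpose]

theorem traceForm_mul_left {R : Subalgebra ℝ (Matrix (Fin n) (Fin n) ℂ)} (a x y : R)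
    (ha : (a : Matrix (Fin n) (Fin n) ℂ)ᵀ ∈ R) :
    traceForm R (a * x) y = traceForm R (⟨_, ha⟩ * y) x := by
  rw [traceForm_apply, traceForm_apply, ← trace_transpose]
  simp only [MulMemClass.coe_mul, transpose_mul, transpose_transpose]
  rw [trace_mul_comm, Matrix.mul_assoc, ← trace_mul_comm]

theorem traceForm_self_pos {R : Subalgebra ℝ (Matrix (Fin n) (Fin n) ℂ)}
    (hT : ∀ a ∈ R, aᵀ ∈ R) (hreal : ∀ a ∈ R, (trace a).im = 0)
    (hpos : ∀ a ∈ R, 0 ≤ (trace (a * aᵀ)).re)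
    (hnd : ∀ a ∈ R, (∀ b ∈ R, trace (a * b) = 0) → a = 0) {a : R} (ha : a ≠ 0) :
    0 < traceForm R a a := by
  refine lt_of_le_of_ne (hpos _ a.2) fun h0 => ha (Subtype.ext (hnd _ a.2 fun b hb => ?_))
  have hCS : ∀ c : R, traceForm R a c = 0 := by
    intro c
    by_contra hne
    have hc := hpos _ c.2
    rw [← traceForm_apply] at hc
    have hexp : ∀ t : ℝ, 0 ≤ 2 * t * traceForm R a c + traceForm R c c := by
      intro t
      have h1 := hpos _ (t • a + c).2
      rw [← traceForm_apply] at h1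
      simp only [map_add, map_smul, LinearMap.add_apply, LinearMap.smul_apply, smul_eq_mul] at h1
      rw [← h0, traceForm_comm c a] at h1
      linarith
    have h2 := hexp (-(traceForm R c c + 1) / (2 * traceForm R a c))
    have h3 : 2 * (-(traceForm R c c + 1) / (2 * traceForm R a c)) * traceForm R a c =
        -(traceForm R c c + 1) := by field_simp
    rw [h3] at h2
    linarith
  have h4 := hCS ⟨_, hT b hb⟩
  rw [traceForm_apply] at h4
  simp only [transpose_transpose] at h4
  exact Complex.ext h4 (hreal _ (mul_mem a.2 hb))

theorem exists_intertwiner {R : Subalgebra ℝ (Matrix (Fin n) (Fin n) ℂ)}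
    (hT : ∀ a ∈ R, aᵀ ∈ R) (hreal : ∀ a ∈ R, (trace a).im = 0)
    (hpos : ∀ a ∈ R, 0 ≤ (trace (a * aᵀ)).re)
    (hnd : ∀ a ∈ R, (∀ b ∈ R, trace (a * b) = 0) → a = 0) :
    ∃ H : Matrix (Fin n) (Fin n) ℂ, H.PosDef ∧ ∀ a ∈ R, conjMat n a * H = H * a := by
  have hfin : FiniteDimensional ℝ R :=
    FiniteDimensional.finiteDimensional_submodule (Subalgebra.toSubmodule R)
  obtain ⟨v, hv⟩ := LinearMap.BilinForm.exists_orthogonal_basis (B := traceForm R)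
    ⟨fun x y => traceForm_comm x y⟩
  set w : Fin (Module.finrank ℝ R) → ℝ := fun i => (traceForm R (v i) (v i))⁻¹ with hw
  have hvpos : ∀ i, 0 < traceForm R (v i) (v i) := fun i =>
    traceForm_self_pos hT hreal hpos hnd (v.ne_zero i)
  have hwpos : ∀ i, 0 < w i := fun i => inv_pos.2 (hvpos i)
  have hexp : ∀ x : R, x = ∑ i, (w i * traceForm R x (v i)) • v i := by
    intro x
    conv_lhs => rw [← v.sum_repr x]
    refine Finset.sum_congr rfl fun i _ => ?_
    congr 1
    conv_rhs => rw [← v.sum_repr x]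
    rw [map_sum, LinearMap.sum_apply, Finset.sum_eq_single i]
    · rw [map_smul, LinearMap.smul_apply, smul_eq_mul, hw]
      field_simp [(hvpos i).ne']
    · intro b _ hb
      rw [map_smul, LinearMap.smul_apply, LinearMap.isOrthoᵢ_def.1 hv b i hb, smul_zero]
    · simp
  have hexp' : ∀ (x : Matrix (Fin n) (Fin n) ℂ) (hx : x ∈ R),
      x = ∑ i, (w i * traceForm R ⟨x, hx⟩ (v i)) • (v i : Matrix (Fin n) (Fin n) ℂ) := by
    intro x hx
    have := congrArg R.val (hexp ⟨x, hx⟩)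
    simpa only [map_sum, map_smul, Subalgebra.coe_val] using this
  refine ⟨∑ i, w i • (conjMat n (v i) * (v i : Matrix (Fin n) (Fin n) ℂ)ᵀ), ?_, fun a ha => ?_⟩
  · have hterm : ∀ i, (w i • (conjMat n (v i) * (v i : Matrix (Fin n) (Fin n) ℂ)ᵀ)).PosSemidef := by
      intro i
      refine PosSemidef.smul ?_ (hwpos i).le
      have := posSemidef_conjTranspose_mul_self (v i : Matrix (Fin n) (Fin n) ℂ)ᵀ
      rwa [← conjMat_transpose, transpose_transpose] at this
    refine posDef_iff_dotProduct_mulVec.2 ⟨(posSemidef_sum _ fun i _ => hterm i).1, ?_⟩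
    intro x hx
    refine lt_of_le_of_ne ((posSemidef_sum _ fun i _ => hterm i).dotProduct_mulVec_nonneg x)
      fun h0 => hx ?_
    have hsum : ∑ i, star x ⬝ᵥ ((w i • (conjMat n (v i) *
        (v i : Matrix (Fin n) (Fin n) ℂ)ᵀ)) *ᵥ x) = 0 := by
      rw [← dotProduct_sum, ← sum_mulVec, ← h0]
    have hz := (Finset.sum_eq_zero_iff_of_nonneg fun i _ =>
      (hterm i).dotProduct_mulVec_nonneg x).1 hsum
    have hz' : ∀ i, (v i : Matrix (Fin n) (Fin n) ℂ)ᵀ *ᵥ x = 0 := by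
      intro i
      have h1 := hz i (Finset.mem_univ i)
      rw [smul_mulVec, dotProduct_smul, smul_eq_zero] at h1
      have h2 := h1.resolve_left (hwpos i).ne'
      rw [← mulVec_mulVec, conjMat_eq_transpose, dotProduct_mulVec, vecMul_transpose] at h2
      have h3 : ((v i : Matrix (Fin n) (Fin n) ℂ)ᴴ) *ᵥ star x =
          star ((v i : Matrix (Fin n) (Fin n) ℂ)ᵀ *ᵥ x) := by
        rw [star_mulVec, ← mulVec_transpose]
        rfl
      rw [h3] at h2
      exact dotProduct_star_self_eq_zero.1 h2
    have h1 := hexp' 1 (one_mem R)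
    have h2 := congrArg (fun M => Mᵀ *ᵥ x) h1
    simp only [transpose_one, one_mulVec, transpose_sum, sum_mulVec, transpose_smul, smul_mulVec,
      hz', smul_zero, Finset.sum_const_zero] at h2
    exact h2
  · have hL : conjMat n a * ∑ i, w i • (conjMat n (v i) * (v i : Matrix (Fin n) (Fin n) ℂ)ᵀ) =
        ∑ i, ∑ k, (w i * (w k * traceForm R (⟨a, ha⟩ * v i) (v k))) •
          (conjMat n (v k) * (v i : Matrix (Fin n) (Fin n) ℂ)ᵀ) := by
      rw [Finset.mul_sum]
      refine Finset.sum_congr rfl fun i _ => ?_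
      rw [Matrix.mul_smul, ← Matrix.mul_assoc, ← map_mul]
      conv_lhs => rw [hexp' (a * v i) (mul_mem ha (v i).2)]
      rw [map_sum, Finset.sum_mul, Finset.smul_sum]
      refine Finset.sum_congr rfl fun k _ => ?_
      rw [map_smul, Matrix.smul_mul, smul_smul]
      rfl
    have hR : (∑ i, w i • (conjMat n (v i) * (v i : Matrix (Fin n) (Fin n) ℂ)ᵀ)) * a =
        ∑ i, ∑ k, (w i * (w k * traceForm R (⟨aᵀ, hT a ha⟩ * v i) (v k))) •
          (conjMat n (v i) * (v k : Matrix (Fin n) (Fin n) ℂ)ᵀ) := by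
      rw [Finset.sum_mul]
      refine Finset.sum_congr rfl fun i _ => ?_
      have h1 : (v i : Matrix (Fin n) (Fin n) ℂ)ᵀ * a =
          (aᵀ * (v i : Matrix (Fin n) (Fin n) ℂ))ᵀ := by
        rw [transpose_mul, transpose_transpose]
      rw [Matrix.smul_mul, Matrix.mul_assoc, h1]
      conv_lhs => rw [hexp' (aᵀ * v i) (mul_mem (hT a ha) (v i).2)]
      rw [transpose_sum, Finset.mul_sum, Finset.smul_sum]
      refine Finset.sum_congr rfl fun k _ => ?_
      rw [transpose_smul, Matrix.mul_smul, smul_smul]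
      rfl
    rw [hL, hR, Finset.sum_comm]
    refine Finset.sum_congr rfl fun k _ => Finset.sum_congr rfl fun i _ => ?_
    rw [traceForm_mul_left ⟨a, ha⟩ (v i) (v k) (hT a ha)]
    congr 1
    ring

end Intertwiner

section TraceRadical

open Polynomial ComplexOrder

variable {n : ℕ}

theorem isNilpotent_of_trace_pow {b : Matrix (Fin n) (Fin n) ℂ}
    (hb : ∀ k : ℕ, trace (b ^ (k + 1)) = 0) : ∃ k : ℕ, b ^ k = 0 := by
  obtain ⟨r, hr, hdvd⟩ := Polynomial.exists_eq_pow_rootMultiplicity_mul_and_not_dvd b.charpoly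
    b.charpoly_monic.ne_zero 0
  rw [C_0, sub_zero] at hr hdvd
  set k := b.charpoly.rootMultiplicity 0
  have hcop : IsCoprime (X ^ (k + 1)) r :=
    ((Polynomial.irreducible_X.coprime_iff_not_dvd).2 hdvd).pow_left
  obtain ⟨u, v, huv⟩ := hcop
  have hzero : aeval b (X ^ (k + 1) * r) = 0 := by
    have h1 : (X ^ (k + 1) * r : ℂ[X]) = X * b.charpoly := by rw [hr]; ring
    rw [h1, map_mul, Matrix.aeval_self_charpoly, mul_zero]
  set e := aeval b (u * X ^ (k + 1)) with he
  have hidem : IsIdempotentElem e := by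
    have h1 : u * X ^ (k + 1) * (u * X ^ (k + 1)) =
        u * X ^ (k + 1) - u * v * (X ^ (k + 1) * r) := by
      have : v * r = 1 - u * X ^ (k + 1) := by rw [← huv]; ring
      linear_combination (u * X ^ (k + 1)) * this
    rw [IsIdempotentElem, he, ← map_mul, h1, map_sub, map_mul _ (u * v), hzero, mul_zero, sub_zero]
  have htr : ∀ q : ℂ[X], trace (aeval b (q * X)) = 0 := by
    intro q
    induction q using Polynomial.induction_on' with
    | add p q hp hq => rw [add_mul, map_add, trace_add, hp, hq, add_zero]
    | monomial m a =>
      rw [Polynomial.monomial_mul_X, aeval_monomial, ← Algebra.smul_def, trace_smul, hb, smul_zero]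
  have htre : trace e = 0 := by
    rw [he, pow_succ, ← mul_assoc]
    exact htr _
  have he0 : e = 0 := by
    have h1 : IsIdempotentElem (Matrix.toLin' e) := by
      rw [IsIdempotentElem, Module.End.mul_eq_comp, ← Matrix.toLin'_mul, hidem.eq]
    have h2 := LinearMap.IsIdempotentElem.eq_zero_of_trace_eq_zero h1
      (by rw [Matrix.trace_toLin'_eq, htre])
    exact Matrix.toLin'.map_eq_zero_iff.1 h2
  refine ⟨k + 1, ?_⟩
  have h3 : (X ^ (k + 1) : ℂ[X]) = X ^ (k + 1) * (u * X ^ (k + 1)) + v * (X ^ (k + 1) * r) := by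
    linear_combination (-(X ^ (k + 1))) * huv
  have h4 := congrArg (aeval b) h3
  rwa [map_add, map_mul, map_mul _ v, hzero, mul_zero, add_zero, ← he, he0, mul_zero, map_pow,
    aeval_X] at h4

theorem exists_projection_matrix (W : Submodule ℂ (Fin n → ℂ)) :
    ∃ P : Matrix (Fin n) (Fin n) ℂ, P.IsHermitian ∧ (∀ v ∈ W, P *ᵥ v = v) ∧
      ∀ v, P *ᵥ v ∈ W := by
  let W' : Submodule ℂ (EuclideanSpace ℂ (Fin n)) :=
    W.comap (WithLp.linearEquiv 2 ℂ (Fin n → ℂ)).toLinearMap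
  let P :=
    Matrix.toEuclideanLin.symm
      (W'.starProjection : EuclideanSpace ℂ (Fin n) →ₗ[ℂ] EuclideanSpace ℂ (Fin n))
  have hP : Matrix.toEuclideanLin P =
      (W'.starProjection : EuclideanSpace ℂ (Fin n) →ₗ[ℂ] EuclideanSpace ℂ (Fin n)) :=
    LinearEquiv.apply_symm_apply _ _
  have happ : ∀ v, P *ᵥ v = WithLp.ofLp (W'.starProjection (WithLp.toLp 2 v)) := fun v =>
    congrArg WithLp.ofLp (LinearMap.congr_fun hP (WithLp.toLp 2 v))
  refine ⟨P, ?_, fun v hv => ?_, fun v => ?_⟩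
  · rw [← Matrix.isSymmetric_toEuclideanLin_iff, hP]
    exact W'.starProjection_isSymmetric
  · have h1 : W'.starProjection (WithLp.toLp 2 v) = WithLp.toLp 2 v :=
      Submodule.starProjection_eq_self_iff.2 hv
    rw [happ, h1]
  · rw [happ]
    exact W'.starProjection_apply_mem (WithLp.toLp 2 v)

variable {R : Subalgebra ℝ (Matrix (Fin n) (Fin n) ℂ)}

/-- The radical of the trace form of an algebra of matrices. -/
def traceRadical (R : Subalgebra ℝ (Matrix (Fin n) (Fin n) ℂ)) :
    Set (Matrix (Fin n) (Fin n) ℂ) :=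
  {j | j ∈ R ∧ ∀ b ∈ R, trace (j * b) = 0}

theorem mul_mem_traceRadical_left {a j : Matrix (Fin n) (Fin n) ℂ} (ha : a ∈ R)
    (hj : j ∈ traceRadical R) : a * j ∈ traceRadical R :=
  ⟨mul_mem ha hj.1, fun b hb => by
    rw [Matrix.mul_assoc, trace_mul_comm, Matrix.mul_assoc]
    exact hj.2 _ (mul_mem hb ha)⟩

theorem mul_mem_traceRadical_right {a j : Matrix (Fin n) (Fin n) ℂ} (ha : a ∈ R)
    (hj : j ∈ traceRadical R) : j * a ∈ traceRadical R :=
  ⟨mul_mem hj.1 ha, fun b hb => by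
    rw [Matrix.mul_assoc]
    exact hj.2 _ (mul_mem ha hb)⟩

theorem transpose_mem_traceRadical (hT : ∀ a ∈ R, aᵀ ∈ R) {j : Matrix (Fin n) (Fin n) ℂ}
    (hj : j ∈ traceRadical R) : jᵀ ∈ traceRadical R :=
  ⟨hT _ hj.1, fun b hb => by
    rw [← trace_transpose, transpose_mul, transpose_transpose, trace_mul_comm]
    exact hj.2 _ (hT b hb)⟩

theorem isNilpotent_of_mem_traceRadical {j : Matrix (Fin n) (Fin n) ℂ}
    (hj : j ∈ traceRadical R) : ∃ k : ℕ, j ^ k = 0 :=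
  isNilpotent_of_trace_pow fun k => by
    rw [pow_succ']
    exact hj.2 _ (pow_mem hj.1 k)

/-- The complex span of the images of the elements of the trace radical. -/
def radicalImage (R : Subalgebra ℝ (Matrix (Fin n) (Fin n) ℂ)) : Submodule ℂ (Fin n → ℂ) :=
  Submodule.span ℂ {u | ∃ j ∈ traceRadical R, ∃ v, u = j *ᵥ v}

theorem mulVec_mem_radicalImage {j : Matrix (Fin n) (Fin n) ℂ} (hj : j ∈ traceRadical R)
    (v : Fin n → ℂ) : j *ᵥ v ∈ radicalImage R :=
  Submodule.subset_span ⟨j, hj, v, rfl⟩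

/-- The vectors of the radical image that are annihilated by the trace radical. -/
def isotropicPart (R : Subalgebra ℝ (Matrix (Fin n) (Fin n) ℂ)) : Submodule ℂ (Fin n → ℂ) where
  carrier := {v | v ∈ radicalImage R ∧ ∀ j ∈ traceRadical R, j *ᵥ v = 0}
  add_mem' := fun hu hv => ⟨add_mem hu.1 hv.1, fun j hj => by
    rw [mulVec_add, hu.2 j hj, hv.2 j hj, add_zero]⟩
  zero_mem' := ⟨zero_mem _, fun j _ => mulVec_zero j⟩
  smul_mem' := fun c v hv => ⟨Submodule.smul_mem _ c hv.1, fun j hj => by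
    rw [mulVec_smul, hv.2 j hj, smul_zero]⟩

theorem mulVec_mem_isotropicPart {a : Matrix (Fin n) (Fin n) ℂ} (ha : a ∈ R)
    {v : Fin n → ℂ} (hv : v ∈ isotropicPart R) : a *ᵥ v ∈ isotropicPart R := by
  refine ⟨?_, fun j hj => ?_⟩
  · have h1 : radicalImage R ≤ (radicalImage R).comap (Matrix.mulVecLin a) := by
      refine Submodule.span_le.2 ?_
      rintro _ ⟨j, hj, v, rfl⟩
      change a *ᵥ (j *ᵥ v) ∈ radicalImage R
      rw [mulVec_mulVec]
      exact mulVec_mem_radicalImage (mul_mem_traceRadical_left ha hj) v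
    exact h1 hv.1
  · rw [mulVec_mulVec]
    exact hv.2 _ (mul_mem_traceRadical_right ha hj)

theorem dotProduct_eq_zero_of_mem_radicalImage (hT : ∀ a ∈ R, aᵀ ∈ R) {w : Fin n → ℂ}
    (hw : ∀ j ∈ traceRadical R, j *ᵥ w = 0) {u : Fin n → ℂ} (hu : u ∈ radicalImage R) :
    u ⬝ᵥ w = 0 := by
  refine Submodule.span_induction (p := fun u _ => u ⬝ᵥ w = 0) ?_ ?_ ?_ ?_ hu
  · rintro _ ⟨j, hj, v, rfl⟩
    rw [dotProduct_comm, dotProduct_mulVec, ← mulVec_transpose,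
      hw _ (transpose_mem_traceRadical hT hj), zero_dotProduct]
  · exact zero_dotProduct w
  · intro x y _ _ hx hy
    rw [add_dotProduct, hx, hy, add_zero]
  · intro c x _ hx
    rw [smul_dotProduct, hx, smul_zero]

theorem isotropicPart_eq_bot (hT : ∀ a ∈ R, aᵀ ∈ R)
    (hproj : ∀ P : Matrix (Fin n) (Fin n) ℂ, P.IsHermitian → P * P = P → P * Pᵀ = 0 →
      (∀ a ∈ R, a * P = P * a * P) → ∀ a ∈ R, a * Pᵀ = Pᵀ * a)
    {w : Fin n → ℂ} (hw : w ∈ isotropicPart R) : w = 0 := by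
  obtain ⟨P, hP, hPW, hPmem⟩ := exists_projection_matrix (isotropicPart R)
  have hcol : ∀ (a : Matrix (Fin n) (Fin n) ℂ), (∀ v, a *ᵥ v ∈ isotropicPart R) → P * a = a := by
    intro a ha
    refine Matrix.ext_of_mulVec_single fun i => ?_
    rw [← mulVec_mulVec, hPW _ (ha _)]
  have hPP : P * P = P := hcol P hPmem
  have hiso : Pᵀ * P = 0 := by
    ext i j
    have := dotProduct_eq_zero_of_mem_radicalImage hT (hPmem (Pi.single j 1)).2
      (hPmem (Pi.single i 1)).1
    rw [mulVec_single_one, mulVec_single_one] at this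
    exact this
  have hiso' : P * Pᵀ = 0 := by
    have := congrArg conjTranspose hiso
    rwa [conjTranspose_mul, conjTranspose_zero, hP.eq, hP.transpose.eq] at this
  have hst : ∀ a ∈ R, a * P = P * a * P := by
    intro a ha
    rw [Matrix.mul_assoc]
    refine (hcol (a * P) fun v => ?_).symm
    rw [← mulVec_mulVec]
    exact mulVec_mem_isotropicPart ha (hPmem v)
  have hcomm := hproj P hP hPP hiso' hst
  have hJP : ∀ j ∈ traceRadical R, j * Pᵀ = 0 := by
    intro j hj
    rw [hcomm j hj.1, ← transpose_transpose j, ← transpose_mul]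
    have : jᵀ * P = 0 := by
      refine Matrix.ext_of_mulVec_single fun i => ?_
      rw [← mulVec_mulVec, zero_mulVec]
      exact (hPmem _).2 _ (transpose_mem_traceRadical hT hj)
    rw [this, transpose_zero]
  have hstar : Pᵀ *ᵥ star w = star w := by
    conv_rhs => rw [← hPW w hw]
    rw [star_mulVec, hP.eq, mulVec_transpose]
  have hann : ∀ j ∈ traceRadical R, j *ᵥ star w = 0 := by
    intro j hj
    rw [← hstar, mulVec_mulVec, hJP j hj, zero_mulVec]
  exact dotProduct_self_star_eq_zero.1 (dotProduct_eq_zero_of_mem_radicalImage hT hann hw.1)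

/-- The real orbit of a vector under an algebra of matrices. -/
def orbit (R : Subalgebra ℝ (Matrix (Fin n) (Fin n) ℂ)) (v : Fin n → ℂ) :
    Submodule ℝ (Fin n → ℂ) :=
  (Subalgebra.toSubmodule R).map ((Matrix.mulVecBilin ℝ ℝ).flip v)

theorem mem_orbit {v u : Fin n → ℂ} : u ∈ orbit R v ↔ ∃ a ∈ R, a *ᵥ v = u := Iff.rfl

theorem radicalImage_eq_bot
    (hbot : ∀ w ∈ isotropicPart R, w = 0) {v : Fin n → ℂ} (hv : v ∈ radicalImage R) : v = 0 := by
  by_contra hne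
  obtain ⟨s, ⟨hs, hs0⟩, hmin⟩ := WellFounded.has_min
    (InvImage.wf (fun v : Fin n → ℂ => Module.finrank ℝ (orbit R v)) Nat.lt_wfRel.wf)
    {v | v ∈ radicalImage R ∧ v ≠ 0} ⟨v, hv, hne⟩
  refine hs0 (hbot s ⟨hs, fun j hj => ?_⟩)
  by_contra hjs
  have hle : orbit R (j *ᵥ s) ≤ orbit R s := by
    intro u hu
    obtain ⟨a, ha, rfl⟩ := mem_orbit.1 hu
    exact mem_orbit.2 ⟨a * j, mul_mem ha hj.1, (mulVec_mulVec _ _ _).symm⟩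
  have heq : orbit R (j *ᵥ s) = orbit R s :=
    Submodule.eq_of_le_of_finrank_le hle
      (not_lt.1 (hmin (j *ᵥ s) ⟨mulVec_mem_radicalImage hj s, hjs⟩))
  have hmem : s ∈ orbit R (j *ᵥ s) := by
    rw [heq]
    exact mem_orbit.2 ⟨1, one_mem R, one_mulVec s⟩
  obtain ⟨a, ha, has⟩ := mem_orbit.1 hmem
  rw [mulVec_mulVec] at has
  obtain ⟨k, hk⟩ := isNilpotent_of_mem_traceRadical (mul_mem_traceRadical_left ha hj)
  have hpow : ∀ m : ℕ, (a * j) ^ m *ᵥ s = s := by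
    intro m
    induction m with
    | zero => rw [pow_zero, one_mulVec]
    | succ m ih => rw [pow_succ, ← mulVec_mulVec, has, ih]
  have := hpow k
  rw [hk, zero_mulVec] at this
  exact hs0 this.symm

theorem traceRadical_eq_zero (hT : ∀ a ∈ R, aᵀ ∈ R)
    (hproj : ∀ P : Matrix (Fin n) (Fin n) ℂ, P.IsHermitian → P * P = P → P * Pᵀ = 0 →
      (∀ a ∈ R, a * P = P * a * P) → ∀ a ∈ R, a * Pᵀ = Pᵀ * a)
    {j : Matrix (Fin n) (Fin n) ℂ} (hj : j ∈ traceRadical R) : j = 0 := by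
  refine Matrix.ext_of_mulVec_single fun i => ?_
  rw [zero_mulVec]
  exact radicalImage_eq_bot (fun w hw => isotropicPart_eq_bot hT hproj hw)
    (mulVec_mem_radicalImage hj _)

end TraceRadical

section MinimalTuple

open ComplexOrder

variable {n : ℕ}

theorem trace_eq_of_projections {A C : Matrix (Fin n) (Fin n) ℂ} (hA : A.IsHermitian)
    (hAA : A * A = A) (hC : C.IsHermitian) (hCC : C * C = C) (x : Matrix (Fin n) (Fin n) ℂ) :
    trace (A * x * C * xᴴ) = trace ((A * x * C) * (A * x * C)ᴴ) := by
  rw [conjTranspose_mul, conjTranspose_mul, hA.eq, hC.eq]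
  calc _ = trace (A * (A * x * C * xᴴ)) := by
        simp only [← Matrix.mul_assoc, hAA]
    _ = trace (A * x * (C * C) * xᴴ * A) := by rw [hCC, trace_mul_comm]
    _ = _ := by simp only [Matrix.mul_assoc]

theorem re_trace_nonneg_of_projections {A C : Matrix (Fin n) (Fin n) ℂ} (hA : A.IsHermitian)
    (hAA : A * A = A) (hC : C.IsHermitian) (hCC : C * C = C) (x : Matrix (Fin n) (Fin n) ℂ) :
    0 ≤ (trace (A * x * C * xᴴ)).re := by
  rw [trace_eq_of_projections hA hAA hC hCC]
  exact (Complex.nonneg_iff.1 (posSemidef_self_mul_conjTranspose (A * x * C)).trace_nonneg).1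

theorem mul_mul_eq_zero_of_projections {A C : Matrix (Fin n) (Fin n) ℂ} (hA : A.IsHermitian)
    (hAA : A * A = A) (hC : C.IsHermitian) (hCC : C * C = C) {x : Matrix (Fin n) (Fin n) ℂ}
    (h : (trace (A * x * C * xᴴ)).re = 0) : A * x * C = 0 := by
  rw [trace_eq_of_projections hA hAA hC hCC] at h
  have h1 := Complex.nonneg_iff.1 (posSemidef_self_mul_conjTranspose (A * x * C)).trace_nonneg
  exact trace_mul_conjTranspose_self_eq_zero_iff.1 (Complex.ext h h1.2.symm)

theorem re_trace_scaled {P E B x : Matrix (Fin n) (Fin n) ℂ} (h1 : E * x * P = 0)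
    (h2 : B * x * P = 0) (h3 : B * x * E = 0) (hsum : P + E + B = 1) :
    (trace (((1 / 4 : ℝ) • P + E + (4 : ℝ) • B) * x * ((1 / 4 : ℝ) • B + E + (4 : ℝ) • P) *
      xᴴ)).re = (trace (x * xᴴ)).re - 3 / 4 * (trace (P * x * E * xᴴ)).re
        - 15 / 16 * (trace (P * x * B * xᴴ)).re - 3 / 4 * (trace (E * x * B * xᴴ)).re := by
  have hx : x * xᴴ = (P + E + B) * x * (P + E + B) * xᴴ := by
    rw [hsum, Matrix.one_mul, Matrix.mul_one]
  rw [hx]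
  simp only [Matrix.add_mul, Matrix.mul_add, Matrix.smul_mul, Matrix.mul_smul, trace_add,
    trace_smul, h1, h2, h3, Matrix.zero_mul, smul_zero, trace_zero, Complex.add_re,
    Complex.smul_re, Complex.zero_re, smul_eq_mul]
  ring

theorem mul_transpose_comm_of_minimal {ι : Type} [Fintype ι]
    {x : ι → Matrix (Fin n) (Fin n) ℂ}
    (hmin : ∀ Q : Matrix (Fin n) (Fin n) ℂ, Qᵀ * Q = 1 →
      ∑ j, (trace (x j * (x j)ᴴ)).re ≤
        ∑ j, (trace ((Qᵀ * x j * Q) * (Qᵀ * x j * Q)ᴴ)).re)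
    {P : Matrix (Fin n) (Fin n) ℂ} (hP : P.IsHermitian) (hPP : P * P = P) (hPB : P * Pᵀ = 0)
    (hx : ∀ j, x j * P = P * x j * P) (hxT : ∀ j, (x j)ᵀ * P = P * (x j)ᵀ * P) (j : ι) :
    x j * P = P * x j ∧ x j * Pᵀ = Pᵀ * x j := by
  set B := Pᵀ with hBdef
  have hB : B.IsHermitian := hP.transpose
  have hBT : Bᵀ = P := transpose_transpose P
  have hBB : B * B = B := by rw [hBdef, ← transpose_mul, hPP]
  have hBP : B * P = 0 := by
    have := congrArg conjTranspose hPB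
    rwa [conjTranspose_mul, conjTranspose_zero, hP.eq, hB.eq] at this
  set E := 1 - P - B with hEdef
  have hsum : P + E + B = 1 := by rw [hEdef]; abel
  have hE : E.IsHermitian := (isHermitian_one.sub hP).sub hB
  have hET : Eᵀ = E := by
    rw [hEdef, transpose_sub, transpose_sub, transpose_one, hBT, ← hBdef]; abel
  have hPE : P * E = 0 := by
    rw [hEdef, Matrix.mul_sub, Matrix.mul_sub, hPP, hPB, Matrix.mul_one]; abel
  have hEP : E * P = 0 := by
    rw [hEdef, Matrix.sub_mul, Matrix.sub_mul, hPP, hBP, Matrix.one_mul]; abel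
  have hBE : B * E = 0 := by
    rw [hEdef, Matrix.mul_sub, Matrix.mul_sub, hBB, hBP, Matrix.mul_one]; abel
  have hEB : E * B = 0 := by
    rw [hEdef, Matrix.sub_mul, Matrix.sub_mul, hBB, hPB, Matrix.one_mul]; abel
  have hEE : E * E = E := by
    have := congrArg (E * ·) hsum
    simpa only [Matrix.mul_add, hEP, hEB, zero_add, add_zero, Matrix.mul_one] using this
  have hxB : ∀ j, B * x j = B * x j * B := by
    intro j
    have := congrArg transpose (hxT j)
    simpa only [transpose_mul, transpose_transpose, ← Matrix.mul_assoc] using this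
  have h1 : ∀ j, E * x j * P = 0 := fun j => by
    rw [Matrix.mul_assoc, hx j, ← Matrix.mul_assoc, ← Matrix.mul_assoc, hEP, Matrix.zero_mul,
      Matrix.zero_mul]
  have h2 : ∀ j, B * x j * P = 0 := fun j => by
    rw [hxB j, Matrix.mul_assoc, hBP, Matrix.mul_zero]
  have h3 : ∀ j, B * x j * E = 0 := fun j => by
    rw [hxB j, Matrix.mul_assoc, hBE, Matrix.mul_zero]
  set Q : Matrix (Fin n) (Fin n) ℂ := (1 / 2 : ℝ) • B + E + (2 : ℝ) • P with hQ
  have hQT : Qᵀ = (1 / 2 : ℝ) • P + E + (2 : ℝ) • B := by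
    rw [hQ, transpose_add, transpose_add, transpose_smul, transpose_smul, hBT, hET]
  have hQQ : Qᵀ * Q = 1 := by
    rw [hQT, hQ, ← hsum]
    simp only [Matrix.add_mul, Matrix.mul_add, Matrix.smul_mul, Matrix.mul_smul, hPP, hBB, hEE,
      hPB, hBP, hPE, hEP, hBE, hEB, smul_zero, add_zero, zero_add, smul_smul]
    norm_num
    abel
  have hQ2 : Q * Q = (1 / 4 : ℝ) • B + E + (4 : ℝ) • P := by
    rw [hQ]
    simp only [Matrix.add_mul, Matrix.mul_add, Matrix.smul_mul, Matrix.mul_smul, hPP, hBB, hEE,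
      hPB, hBP, hPE, hEP, hBE, hEB, smul_zero, add_zero, zero_add, smul_smul]
    norm_num
  have hQT2 : Qᵀ * Qᵀ = (1 / 4 : ℝ) • P + E + (4 : ℝ) • B := by
    rw [hQT]
    simp only [Matrix.add_mul, Matrix.mul_add, Matrix.smul_mul, Matrix.mul_smul, hPP, hBB, hEE,
      hPB, hBP, hPE, hEP, hBE, hEB, smul_zero, add_zero, zero_add, smul_smul]
    norm_num
  have hQH : Qᴴ = Q := by
    rw [hQ, conjTranspose_add, conjTranspose_add, conjTranspose_smul, conjTranspose_smul, hB.eq,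
      hE.eq, hP.eq, star_trivial, star_trivial]
  have hQTH : (Qᵀ)ᴴ = Qᵀ := (show Q.IsHermitian from hQH).transpose
  have hN : ∀ j, (trace ((Qᵀ * x j * Q) * (Qᵀ * x j * Q)ᴴ)).re =
      (trace (x j * (x j)ᴴ)).re - 3 / 4 * (trace (P * x j * E * (x j)ᴴ)).re
        - 15 / 16 * (trace (P * x j * B * (x j)ᴴ)).re
        - 3 / 4 * (trace (E * x j * B * (x j)ᴴ)).re := by
    intro j
    rw [← re_trace_scaled (h1 j) (h2 j) (h3 j) hsum, ← hQ2, ← hQT2]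
    congr 1
    rw [conjTranspose_mul, conjTranspose_mul, hQTH, hQH]
    calc _ = trace ((Qᵀ * x j * Q * Q * (x j)ᴴ) * Qᵀ) := by simp only [Matrix.mul_assoc]
      _ = _ := by rw [trace_mul_comm]; simp only [Matrix.mul_assoc]
  have n1 := fun j => re_trace_nonneg_of_projections hP hPP hE hEE (x j)
  have n2 := fun j => re_trace_nonneg_of_projections hP hPP hB hBB (x j)
  have n3 := fun j => re_trace_nonneg_of_projections hE hEE hB hBB (x j)
  have hsum0 : ∑ j, (3 / 4 * (trace (P * x j * E * (x j)ᴴ)).re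
      + 15 / 16 * (trace (P * x j * B * (x j)ᴴ)).re
      + 3 / 4 * (trace (E * x j * B * (x j)ᴴ)).re) ≤ 0 := by
    have := hmin Q hQQ
    simp only [hN, Finset.sum_sub_distrib] at this
    simp only [Finset.sum_add_distrib]
    linarith
  have hterm : ∀ i, 0 ≤ 3 / 4 * (trace (P * x i * E * (x i)ᴴ)).re
      + 15 / 16 * (trace (P * x i * B * (x i)ᴴ)).re
      + 3 / 4 * (trace (E * x i * B * (x i)ᴴ)).re := fun i => by
    linarith [n1 i, n2 i, n3 i]
  have hz := (Finset.sum_eq_zero_iff_of_nonneg fun i _ => hterm i).1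
    (le_antisymm hsum0 (Finset.sum_nonneg fun i _ => hterm i)) j (Finset.mem_univ j)
  have z1 : P * x j * E = 0 := mul_mul_eq_zero_of_projections hP hPP hE hEE
    (by linarith [n1 j, n2 j, n3 j])
  have z2 : P * x j * B = 0 := mul_mul_eq_zero_of_projections hP hPP hB hBB
    (by linarith [n1 j, n2 j, n3 j])
  have z3 : E * x j * B = 0 := mul_mul_eq_zero_of_projections hE hEE hB hBB
    (by linarith [n1 j, n2 j, n3 j])
  constructor
  · have := congrArg (P * x j * ·) hsum
    simp only [Matrix.mul_add, z1, z2, add_zero, Matrix.mul_one] at this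
    rw [hx j, this]
  · have := congrArg (· * (x j * B)) hsum
    simp only [Matrix.add_mul, ← Matrix.mul_assoc, z2, z3, zero_add, Matrix.one_mul] at this
    rw [← this, ← hxB j]

end MinimalTuple

section RealPoint

variable {n g : ℕ}

/-- Evaluation of matrices of polynomials at a tuple of complex matrices. -/
def complexEval (x : Fin g → Matrix (Fin n) (Fin n) ℂ) :
    MatP n g →ₐ[ℝ] Matrix (Fin n) (Fin n) ℂ :=
  (MvPolynomial.aeval fun v : Fin g × Fin n × Fin n => x v.1 v.2.1 v.2.2).mapMatrix

theorem complexEval_apply (x : Fin g → Matrix (Fin n) (Fin n) ℂ) (h : MatP n g) (i j : Fin n) :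
    complexEval x h i j =
      MvPolynomial.aeval (fun v : Fin g × Fin n × Fin n => x v.1 v.2.1 v.2.2) (h i j) := rfl

theorem complexEval_transpose (x : Fin g → Matrix (Fin n) (Fin n) ℂ) (h : MatP n g) :
    complexEval x hᵀ = (complexEval x h)ᵀ := rfl

theorem complexEval_genMat (x : Fin g → Matrix (Fin n) (Fin n) ℂ) (j : Fin g) :
    complexEval x (genMat n g j) = x j := by
  ext a b
  simp [complexEval_apply, genMat]

theorem complexEval_smul (x : Fin g → Matrix (Fin n) (Fin n) ℂ) (c : PolyRing n g)
    (h : MatP n g) : complexEval x (c • h) =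
      MvPolynomial.aeval (fun v : Fin g × Fin n × Fin n => x v.1 v.2.1 v.2.2) c •
        complexEval x h := by
  ext a b
  simp [complexEval_apply]

theorem trace_complexEval (x : Fin g → Matrix (Fin n) (Fin n) ℂ) (h : MatP n g) :
    trace (complexEval x h) =
      MvPolynomial.aeval (fun v : Fin g × Fin n × Fin n => x v.1 v.2.1 v.2.2) (trace h) := by
  simp [trace, complexEval_apply]

theorem complexEval_conj_word (x : Fin g → Matrix (Fin n) (Fin n) ℂ)
    {Q : Matrix (Fin n) (Fin n) ℂ} (hQ : Qᵀ * Q = 1) {w : MatP n g}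
    (hw : w ∈ Submonoid.closure (genSet n g)) :
    complexEval (fun j => Qᵀ * x j * Q) w = Qᵀ * complexEval x w * Q := by
  have hQ' : Q * Qᵀ = 1 := mul_eq_one_comm.1 hQ
  induction hw using Submonoid.closure_induction with
  | mem y hy =>
    rcases hy with ⟨j, rfl⟩ | ⟨j, rfl⟩
    · rw [complexEval_genMat, complexEval_genMat]
    · simp only [complexEval_transpose, complexEval_genMat, transpose_mul, transpose_transpose,
        Matrix.mul_assoc]
  | one => rw [map_one, map_one, Matrix.mul_one, hQ]
  | mul y z _ _ hy hz =>
    rw [map_mul, map_mul, hy, hz]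
    calc _ = Qᵀ * complexEval x y * (Q * Qᵀ) * complexEval x z * Q := by
          simp only [Matrix.mul_assoc]
      _ = _ := by rw [hQ', Matrix.mul_one, Matrix.mul_assoc Qᵀ]

theorem aeval_conj_of_mem_traceCenter (x : Fin g → Matrix (Fin n) (Fin n) ℂ)
    {Q : Matrix (Fin n) (Fin n) ℂ} (hQ : Qᵀ * Q = 1) {c : PolyRing n g}
    (hc : c ∈ traceCenter n g) :
    MvPolynomial.aeval (fun v : Fin g × Fin n × Fin n => (Qᵀ * x v.1 * Q) v.2.1 v.2.2) c =
      MvPolynomial.aeval (fun v : Fin g × Fin n × Fin n => x v.1 v.2.1 v.2.2) c := by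
  have hQ' : Q * Qᵀ = 1 := mul_eq_one_comm.1 hQ
  induction hc using Algebra.adjoin_induction with
  | mem y hy =>
    obtain ⟨w, hw, rfl⟩ := hy
    rw [← trace_complexEval, ← trace_complexEval (fun j => Qᵀ * x j * Q),
      complexEval_conj_word x hQ hw, trace_mul_comm, ← Matrix.mul_assoc, hQ', Matrix.one_mul]
  | algebraMap r => rw [AlgHom.commutes, AlgHom.commutes]
  | add y z _ _ hy hz => rw [map_add, map_add, hy, hz]
  | mul y z _ _ hy hz => rw [map_mul, map_mul, hy, hz]

theorem re_trace_mul_conjTranspose (a : Matrix (Fin n) (Fin n) ℂ) :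
    (trace (a * aᴴ)).re = ∑ i, ∑ j, ‖a i j‖ ^ 2 := by
  simp only [trace, diag_apply, mul_apply, conjTranspose_apply, Complex.re_sum]
  refine Finset.sum_congr rfl fun i _ => Finset.sum_congr rfl fun j _ => ?_
  rw [← Complex.normSq_eq_norm_sq, Complex.star_def, Complex.mul_conj, Complex.ofReal_re]

/-- A real character of the algebra of traces is evaluation at a tuple of complex matrices that
has minimal norm in its complex orthogonal orbit. -/
theorem exists_minimal_complex_tuple (φ : traceCenter n g →ₐ[ℝ] ℝ) :
    ∃ x : Fin g → Matrix (Fin n) (Fin n) ℂ,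
      (∀ c : traceCenter n g, MvPolynomial.aeval
        (fun v : Fin g × Fin n × Fin n => x v.1 v.2.1 v.2.2) (c : PolyRing n g) = (φ c : ℂ)) ∧
      ∀ Q : Matrix (Fin n) (Fin n) ℂ, Qᵀ * Q = 1 →
        ∑ j, (trace (x j * (x j)ᴴ)).re ≤
          ∑ j, (trace ((Qᵀ * x j * Q) * (Qᵀ * x j * Q)ᴴ)).re := by
  let F : Set (EuclideanSpace ℂ (Fin g × Fin n × Fin n)) :=
    {p | ∀ c : traceCenter n g, MvPolynomial.aeval (p : Fin g × Fin n × Fin n → ℂ)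
      (c : PolyRing n g) = (φ c : ℂ)}
  have hclosed : IsClosed F := by
    simp only [F, Set.ofPred_forall]
    refine isClosed_iInter fun c => isClosed_eq ?_ continuous_const
    have h1 : ∀ p : Fin g × Fin n × Fin n → ℂ, MvPolynomial.aeval p (c : PolyRing n g) =
        MvPolynomial.eval p (MvPolynomial.map (algebraMap ℝ ℂ) (c : PolyRing n g)) := fun p => by
      rw [MvPolynomial.eval_map, MvPolynomial.aeval_def]
    simp only [h1]
    exact (MvPolynomial.continuous_eval _).comp (PiLp.continuous_ofLp 2 _)
  obtain ⟨p, hp⟩ := exists_complex_point φ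
  have hne : F.Nonempty := ⟨WithLp.toLp 2 p, hp⟩
  obtain ⟨y, hyF, hy⟩ := hclosed.exists_infDist_eq_dist hne 0
  have hmin : ∀ z ∈ F, ‖y‖ ≤ ‖z‖ := by
    intro z hz
    have h1 := Metric.infDist_le_dist_of_mem (x := (0 : EuclideanSpace ℂ _)) hz
    rwa [hy, dist_zero_left, dist_zero_left] at h1
  refine ⟨fun j => Matrix.of fun a b => y (j, a, b), hyF, fun Q hQ => ?_⟩
  set x : Fin g → Matrix (Fin n) (Fin n) ℂ := fun j => Matrix.of fun a b => y (j, a, b) with hx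
  have h2 := hmin (WithLp.toLp 2 fun v : Fin g × Fin n × Fin n => (Qᵀ * x v.1 * Q) v.2.1 v.2.2)
    fun c => (aeval_conj_of_mem_traceCenter x hQ c.2).trans (hyF c)
  have h3 := pow_le_pow_left₀ (norm_nonneg _) h2 2
  rw [EuclideanSpace.norm_sq_eq, EuclideanSpace.norm_sq_eq] at h3
  simp only [re_trace_mul_conjTranspose, Fintype.sum_prod_type] at h3 ⊢
  exact h3

theorem evalMat_eval_trace (A : Fin g → Matrix (Fin n) (Fin n) ℝ) (h : MatP n g) :
    MvPolynomial.eval (fun v : Fin g × Fin n × Fin n => A v.1 v.2.1 v.2.2) (trace h) =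
      trace (evalMat n g A h) := by
  simp [trace, evalMat]

/-- A real character of the algebra of traces that is nonnegative on hermitian squares is
evaluation at a tuple of real matrices. -/
theorem exists_real_point (φ : traceCenter n g →ₐ[ℝ] ℝ)
    (hφ : ∀ c : traceCenter n g, (∃ h ∈ traceRing n g, (c : PolyRing n g) = trace (h * hᵀ)) →
      0 ≤ φ c) :
    ∃ A : Fin g → Matrix (Fin n) (Fin n) ℝ, ∀ c : traceCenter n g,
      MvPolynomial.eval (fun v : Fin g × Fin n × Fin n => A v.1 v.2.1 v.2.2) (c : PolyRing n g) =
        φ c := by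
  obtain ⟨x, hx, hmin⟩ := exists_minimal_complex_tuple φ
  let R : Subalgebra ℝ (Matrix (Fin n) (Fin n) ℂ) := (traceRing n g).map (complexEval x)
  have hgen : ∀ j, x j ∈ R := fun j =>
    ⟨genMat n g j, Algebra.subset_adjoin (Or.inl (Or.inl ⟨j, rfl⟩)), complexEval_genMat x j⟩
  have htr : ∀ h (hh : h ∈ traceRing n g), trace (complexEval x h) =
      (φ ⟨trace h, trace_mem_traceCenter hh⟩ : ℂ) := fun h hh =>
    (trace_complexEval x h).trans (hx ⟨trace h, trace_mem_traceCenter hh⟩)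
  have hT : ∀ a ∈ R, aᵀ ∈ R := by
    rintro _ ⟨h, hh, rfl⟩
    exact ⟨hᵀ, transpose_mem_traceRing hh, rfl⟩
  have hreal : ∀ a ∈ R, (trace a).im = 0 := by
    rintro _ ⟨h, hh, rfl⟩
    exact (congrArg Complex.im (htr h hh)).trans (Complex.ofReal_im _)
  have hpos : ∀ a ∈ R, 0 ≤ (trace (a * aᵀ)).re := by
    rintro _ ⟨h, hh, rfl⟩
    have h1 := htr (h * hᵀ) (mul_mem hh (transpose_mem_traceRing hh))
    rw [map_mul, complexEval_transpose] at h1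
    refine le_of_le_of_eq (hφ ⟨_, trace_mem_traceCenter
      (mul_mem hh (transpose_mem_traceRing hh))⟩ ⟨h, hh, rfl⟩) ?_
    exact ((congrArg Complex.re h1).trans (Complex.ofReal_re _)).symm
  have hproj : ∀ P : Matrix (Fin n) (Fin n) ℂ, P.IsHermitian → P * P = P → P * Pᵀ = 0 →
      (∀ a ∈ R, a * P = P * a * P) → ∀ a ∈ R, a * Pᵀ = Pᵀ * a := by
    intro P hP hPP hPT hst
    have hc := mul_transpose_comm_of_minimal hmin hP hPP hPT (fun j => hst _ (hgen j))
      (fun j => hst _ (hT _ (hgen j)))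
    have hw : ∀ w ∈ Submonoid.closure (genSet n g),
        complexEval x w * Pᵀ = Pᵀ * complexEval x w := by
      intro w hw
      induction hw using Submonoid.closure_induction with
      | mem y hy =>
        rcases hy with ⟨j, rfl⟩ | ⟨j, rfl⟩
        · rw [complexEval_genMat, (hc j).2]
        · rw [complexEval_transpose, complexEval_genMat, ← transpose_mul, ← transpose_mul,
            (hc j).1]
      | one => rw [map_one, Matrix.one_mul, Matrix.mul_one]
      | mul y z _ _ hy hz =>
        rw [map_mul, Matrix.mul_assoc, hz, ← Matrix.mul_assoc, hy, Matrix.mul_assoc]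
    rintro _ ⟨h, hh, rfl⟩
    refine traceRing_induction (P := fun h => complexEval x h * Pᵀ = Pᵀ * complexEval x h)
      ?_ ?_ ?_ hh
    · intro y z hy hz
      rw [map_add, Matrix.add_mul, Matrix.mul_add, hy, hz]
    · rw [map_zero, Matrix.zero_mul, Matrix.mul_zero]
    · intro c _ w hw'
      rw [complexEval_smul, Matrix.smul_mul, Matrix.mul_smul, hw w hw']
  obtain ⟨H, hH, hHR⟩ := exists_intertwiner hT hreal hpos fun a ha hab =>
    traceRadical_eq_zero hT hproj ⟨ha, hab⟩
  obtain ⟨Q, hQ, hQR⟩ := exists_orthogonal_real (R := (R : Set (Matrix (Fin n) (Fin n) ℂ))) hH hHR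
  refine ⟨fun j => (Qᵀ * x j * Q).map Complex.re, fun c => ?_⟩
  have hre : ∀ j a b, (((Qᵀ * x j * Q) a b).re : ℂ) = (Qᵀ * x j * Q) a b := fun j a b =>
    Complex.conj_eq_iff_re.1 (congrFun (congrFun (hQR (x j) (hgen j)) a) b)
  have h1 := (aeval_conj_of_mem_traceCenter x hQ c.2).trans (hx c)
  have h2 : (fun v : Fin g × Fin n × Fin n => (Qᵀ * x v.1 * Q) v.2.1 v.2.2) =
      algebraMap ℝ ℂ ∘ fun v : Fin g × Fin n × Fin n => ((Qᵀ * x v.1 * Q) v.2.1 v.2.2).re :=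
    funext fun v => (hre _ _ _).symm
  rw [h2, MvPolynomial.aeval_algebraMap_apply] at h1
  exact Complex.ofReal_injective h1

end RealPoint

section Positivity

open Polynomial

variable {n g : ℕ}

/-- Evaluation of matrices of polynomials at a tuple of real matrices, as an algebra map. -/
def evalMatHom (A : Fin g → Matrix (Fin n) (Fin n) ℝ) : MatP n g →ₐ[ℝ] Matrix (Fin n) (Fin n) ℝ :=
  (MvPolynomial.aeval fun v : Fin g × Fin n × Fin n => A v.1 v.2.1 v.2.2).mapMatrix

theorem evalMatHom_apply (A : Fin g → Matrix (Fin n) (Fin n) ℝ) (h : MatP n g) :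
    evalMatHom A h = evalMat n g A h := by
  ext1 i j
  simp [evalMatHom, evalMat, MvPolynomial.aeval_eq_eval]

theorem evalMat_mul (A : Fin g → Matrix (Fin n) (Fin n) ℝ) (h k : MatP n g) :
    evalMat n g A (h * k) = evalMat n g A h * evalMat n g A k := by
  simp only [← evalMatHom_apply, map_mul]

theorem evalMat_transpose (A : Fin g → Matrix (Fin n) (Fin n) ℝ) (h : MatP n g) :
    evalMat n g A hᵀ = (evalMat n g A h)ᵀ := rfl

theorem evalMat_smul_one (A : Fin g → Matrix (Fin n) (Fin n) ℝ) (c : PolyRing n g) :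
    evalMat n g A (c • 1) =
      MvPolynomial.eval (fun v : Fin g × Fin n × Fin n => A v.1 v.2.1 v.2.2) c •
        (1 : Matrix (Fin n) (Fin n) ℝ) := by
  ext1 i j
  by_cases h : i = j <;> simp [evalMat, one_apply, h]

/-- A real symmetric matrix is positive semidefinite as soon as its compressions by polynomials in
the matrix have nonnegative trace. -/
theorem posSemidef_of_trace_aeval_nonneg {S : Matrix (Fin n) (Fin n) ℝ} (hS : S.IsHermitian)
    (h : ∀ f : ℝ[X], 0 ≤ trace (aeval S f * S * (aeval S f)ᵀ)) : S.PosSemidef := by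
  rw [hS.posSemidef_iff_eigenvalues_nonneg]
  intro i
  by_contra hi
  rw [Pi.zero_apply, not_le] at hi
  obtain ⟨U, h1, h2, hU⟩ := exists_unitary_diagonal hS
  obtain ⟨f, hf⟩ := exists_eval_eq hS.eigenvalues fun t => if t = hS.eigenvalues i then 1 else 0
  have h3 : aeval S f = U * diagonal (fun j => f.eval (hS.eigenvalues j)) * Uᴴ := by
    have := aeval_unitary_diagonal h1 h2 hS.eigenvalues f
    rw [← hU] at this
    exact this
  have hT : (aeval S f)ᵀ = aeval S f := by
    rw [h3, ← conjTranspose_eq_transpose_of_trivial]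
    simp [Matrix.mul_assoc]
  have h4 : aeval S f * S * aeval S f = aeval S (f * X * f) := by simp
  have h5 := h f
  rw [hT, h4] at h5
  have h6 : aeval S (f * X * f) =
      U * diagonal (fun j => (f * X * f).eval (hS.eigenvalues j)) * Uᴴ := by
    have := aeval_unitary_diagonal h1 h2 hS.eigenvalues (f * X * f)
    rw [← hU] at this
    exact this
  rw [h6, trace_mul_comm, ← Matrix.mul_assoc, h2, Matrix.one_mul, trace_diagonal] at h5
  refine absurd h5 (not_le.2 (Finset.sum_neg' (fun j _ => ?_) ⟨i, Finset.mem_univ i, ?_⟩))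
  · simp only [eval_mul, hf, eval_X]
    split_ifs with hj
    · rw [hj]; linarith
    · simp
  · simp only [eval_mul, hf, eval_X]
    simpa using hi

theorem evalMat_posSemidef {s : MatP n g} (hsT : s ∈ traceRing n g) (hs : sᵀ = s)
    {A : Fin g → Matrix (Fin n) (Fin n) ℝ}
    (h : ∀ h ∈ traceRing n g, 0 ≤ trace (evalMat n g A (h * s * hᵀ))) :
    (evalMat n g A s).PosSemidef := by
  refine posSemidef_of_trace_aeval_nonneg ?_ fun f => ?_
  · rw [IsHermitian, conjTranspose_eq_transpose_of_trivial, ← evalMat_transpose, hs]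
  · have h1 := h (aeval s f) (Algebra.adjoin_le (Set.singleton_subset_iff.2 hsT)
      (aeval_mem_adjoin_singleton ℝ s))
    rwa [evalMat_mul, evalMat_mul, evalMat_transpose, ← evalMatHom_apply A (aeval s f),
      ← aeval_algHom_apply, evalMatHom_apply] at h1

end Positivity

section Certificate

variable {n g : ℕ}

/-- The traces of the hermitian squares `h * s * hᵀ` weighted by `s`, with `h` in the
trace ring. -/
def traceSquares (s : MatP n g) : Set (PolyRing n g) :=
  {c | ∃ h ∈ traceRing n g, c = trace (h * s * hᵀ)}

theorem smul_one_mem_OmegaSet {c : PolyRing n g}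
    (hc : c ∈ Submonoid.closure (traceSquares (1 : MatP n g))) :
    c • (1 : MatP n g) ∈ OmegaSet n g := by
  refine AddSubmonoid.subset_closure ?_
  induction hc using Submonoid.closure_induction with
  | mem x hx =>
    obtain ⟨h, hh, rfl⟩ := hx
    exact Submonoid.subset_closure ⟨h, hh, by rw [Matrix.mul_one]⟩
  | one => rw [one_smul]; exact one_mem _
  | mul x y _ _ hx hy =>
    have : (x * y) • (1 : MatP n g) = (x • (1 : MatP n g)) * (y • (1 : MatP n g)) := by
      rw [smul_mul_smul_comm, one_mul]
    rw [this]
    exact mul_mem hx hy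

theorem exists_prod_trace {s : MatP n g} {c : PolyRing n g}
    (hc : c ∈ Submonoid.closure (traceSquares s)) :
    ∃ (m : ℕ) (h : Fin m → MatP n g), (∀ j, h j ∈ traceRing n g) ∧
      c = ∏ j, trace (h j * s * (h j)ᵀ) := by
  obtain ⟨l, hl, rfl⟩ := Submonoid.exists_list_of_mem_closure hc
  choose h hh hhl using fun j : Fin l.length => hl _ (l.getElem_mem j.2)
  refine ⟨l.length, h, hh, ?_⟩
  rw [← Fin.prod_univ_getElem]
  exact Finset.prod_congr rfl fun j _ => hhl j

theorem exists_certificate {s : MatP n g} {c : PolyRing n g}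
    (hc : c ∈ Subsemiring.closure (traceSquares (1 : MatP n g) ∪ traceSquares s)) :
    ∃ (k : ℕ) (ω : Fin k → MatP n g) (m : Fin k → ℕ) (h : (i : Fin k) → Fin (m i) → MatP n g),
      (∀ i, ω i ∈ OmegaSet n g) ∧ (∀ i j, h i j ∈ traceRing n g) ∧
      c • (1 : MatP n g) =
        ∑ i, ω i * ((∏ j, trace (h i j * s * (h i j)ᵀ)) • (1 : MatP n g)) := by
  rw [Subsemiring.mem_closure_iff] at hc
  obtain ⟨l, hl, rfl⟩ := AddSubmonoid.exists_list_of_mem_closure hc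
  have hterm : ∀ i : Fin l.length, ∃ (ω : MatP n g) (m : ℕ) (h : Fin m → MatP n g),
      ω ∈ OmegaSet n g ∧ (∀ j, h j ∈ traceRing n g) ∧
      l[i] • (1 : MatP n g) = ω * ((∏ j, trace (h j * s * (h j)ᵀ)) • (1 : MatP n g)) := by
    intro i
    have hi := hl _ (l.getElem_mem i.2)
    rw [SetLike.mem_coe, Submonoid.closure_union, Submonoid.mem_sup] at hi
    obtain ⟨x, hx, y, hy, hxy⟩ := hi
    obtain ⟨m, h, hh, rfl⟩ := exists_prod_trace hy
    refine ⟨x • 1, m, h, smul_one_mem_OmegaSet hx, hh, ?_⟩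
    rw [smul_mul_smul_comm, one_mul, hxy]
    rfl
  choose ω m h hω hh hl' using hterm
  refine ⟨l.length, ω, m, h, hω, hh, ?_⟩
  rw [← Fin.sum_univ_getElem, Finset.sum_smul]
  exact Finset.sum_congr rfl fun i _ => hl' i

theorem trace_evalMat_nonneg {s : MatP n g} {A : Fin g → Matrix (Fin n) (Fin n) ℝ}
    (hA : (evalMat n g A s).PosSemidef) (h : MatP n g) :
    0 ≤ trace (evalMat n g A (h * s * hᵀ)) := by
  have := (hA.mul_mul_conjTranspose_same (evalMat n g A h)).trace_nonneg
  rwa [conjTranspose_eq_transpose_of_trivial, ← evalMat_transpose, ← evalMat_mul,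
    ← evalMat_mul] at this

theorem evalMat_one_posSemidef (A : Fin g → Matrix (Fin n) (Fin n) ℝ) :
    (evalMat n g A 1).PosSemidef := by
  rw [← evalMatHom_apply, map_one]
  exact PosSemidef.one

theorem evalMat_eq_smul_one_of_mem_OmegaSet (A : Fin g → Matrix (Fin n) (Fin n) ℝ) {ω : MatP n g}
    (hω : ω ∈ OmegaSet n g) :
    ∃ r : ℝ, 0 ≤ r ∧ evalMat n g A ω = r • (1 : Matrix (Fin n) (Fin n) ℝ) := by
  simp only [← evalMatHom_apply]
  refine AddSubmonoid.closure_induction (fun x hx => ?_) ⟨0, le_rfl, by simp⟩ ?_ hω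
  · refine Submonoid.closure_induction ?_ ⟨1, zero_le_one, by simp⟩ ?_ hx
    · rintro _ ⟨h, hh, rfl⟩
      refine ⟨trace (evalMat n g A (h * hᵀ)), ?_, ?_⟩
      · simpa using trace_evalMat_nonneg (evalMat_one_posSemidef A) h
      · rw [evalMatHom_apply, evalMat_smul_one, evalMat_eval_trace]
    · rintro x y _ _ ⟨a, ha, hx⟩ ⟨b, hb, hy⟩
      exact ⟨a * b, mul_nonneg ha hb, by rw [map_mul, hx, hy, smul_mul_smul_comm, one_mul]⟩
  · rintro x y _ _ ⟨a, ha, hx⟩ ⟨b, hb, hy⟩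
    exact ⟨a + b, add_nonneg ha hb, by rw [map_add, hx, hy, add_smul]⟩

theorem certificate_ne_neg_one (hn : 0 < n) {s : MatP n g}
    {A : Fin g → Matrix (Fin n) (Fin n) ℝ} (hA : (evalMat n g A s).PosSemidef) {k : ℕ}
    {ω : Fin k → MatP n g} {m : Fin k → ℕ} {h : (i : Fin k) → Fin (m i) → MatP n g}
    (hω : ∀ i, ω i ∈ OmegaSet n g) :
    (-1 : MatP n g) ≠
      ∑ i, ω i * ((∏ j, trace (h i j * s * (h i j)ᵀ)) • (1 : MatP n g)) := by
  intro heq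
  choose r hr hrω using fun i => evalMat_eq_smul_one_of_mem_OmegaSet A (hω i)
  have h1 := congrArg (evalMatHom A) heq
  simp only [map_neg, map_one, map_sum, map_mul, evalMatHom_apply, hrω, evalMat_smul_one,
    map_prod, evalMat_eval_trace, smul_mul_smul_comm, one_mul, ← Finset.sum_smul] at h1
  have h2 := congrFun (congrFun h1 ⟨0, hn⟩) ⟨0, hn⟩
  rw [Matrix.neg_apply, Matrix.smul_apply, one_apply_eq, smul_eq_mul, mul_one] at h2
  have h3 : 0 ≤ ∑ i, r i * ∏ j, trace (evalMat n g A (h i j * s * (h i j)ᵀ)) :=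
    Finset.sum_nonneg fun i _ => mul_nonneg (hr i)
      (Finset.prod_nonneg fun j _ => trace_evalMat_nonneg hA _)
  linarith

theorem trace_mul_transpose_mem_traceCenter {s : MatP n g} (hs : s ∈ traceRing n g)
    {h k : MatP n g} (hh : h ∈ traceRing n g) (hk : k ∈ traceRing n g) :
    trace (h * s * kᵀ) ∈ traceCenter n g :=
  trace_mem_traceCenter (mul_mem (mul_mem hh hs) (transpose_mem_traceRing hk))

theorem trace_sum_smul {m : ℕ} (e : Fin m → MatP n g) (s : MatP n g) (r : Fin m → PolyRing n g) :
    trace ((∑ i, r i • e i) * s * (∑ i, r i • e i)ᵀ) =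
      ∑ k, ∑ l, r k * trace (e k * s * (e l)ᵀ) * r l := by
  simp only [transpose_sum, transpose_smul, Finset.sum_mul, Finset.mul_sum, trace_sum,
    Matrix.smul_mul, Matrix.mul_smul, trace_smul, smul_eq_mul]
  rw [Finset.sum_comm]
  exact Finset.sum_congr rfl fun k _ => Finset.sum_congr rfl fun l _ => by ring

theorem exists_evalMat_posSemidef (hn : 0 < n) {s : MatP n g} (hsT : s ∈ traceRing n g)
    (hs : sᵀ = s)
    (hneg : -1 ∉ Subsemiring.closure (traceSquares (1 : MatP n g) ∪ traceSquares s)) :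
    ∃ A : Fin g → Matrix (Fin n) (Fin n) ℝ, (evalMat n g A s).PosSemidef := by
  obtain ⟨m, e, he, hspan⟩ := exists_generators_traceRing n g
  have : Algebra.FiniteType ℝ (traceCenter n g) :=
    (Subalgebra.fg_iff_finiteType _).1 traceCenter_fg
  let T : Subsemiring (traceCenter n g) :=
    (Subsemiring.closure (traceSquares (1 : MatP n g) ∪ traceSquares s)).comap
      ((traceCenter n g).val : traceCenter n g →+* PolyRing n g)
  let S : Bool → MatP n g := fun b => if b then 1 else s
  have hS : ∀ b, S b ∈ traceRing n g := by
    rintro (_ | _)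
    exacts [hsT, one_mem _]
  have hSsymm : ∀ b, (S b)ᵀ = S b := by
    rintro (_ | _)
    exacts [hs, transpose_one]
  have hST : ∀ b, ∀ h ∈ traceRing n g, trace (h * S b * hᵀ) ∈
      Subsemiring.closure (traceSquares (1 : MatP n g) ∪ traceSquares s) := by
    rintro (_ | _) h hh
    exacts [Subsemiring.subset_closure (Or.inr ⟨h, hh, rfl⟩),
      Subsemiring.subset_closure (Or.inl ⟨h, hh, rfl⟩)]
  let G : Bool → Matrix (Fin m) (Fin m) (traceCenter n g) := fun b => of fun k l =>
    ⟨trace (e k * S b * (e l)ᵀ), trace_mul_transpose_mem_traceCenter (hS b) (he k) (he l)⟩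
  have hsq : ∀ a, a * a ∈ T := by
    intro a
    have h1 := hST true ((Real.sqrt n)⁻¹ • ((a : PolyRing n g) • (1 : MatP n g)))
      ((traceRing n g).smul_mem (smul_one_mem_traceRing a.2) _)
    have hn' : (n : ℝ) ≠ 0 := Nat.cast_ne_zero.2 hn.ne'
    have h2 : (Real.sqrt n)⁻¹ * (Real.sqrt n)⁻¹ * (n : ℝ) = 1 := by
      rw [← mul_inv, Real.mul_self_sqrt n.cast_nonneg, inv_mul_cancel₀ hn']
    have h3 : trace (((Real.sqrt n)⁻¹ • ((a : PolyRing n g) • (1 : MatP n g))) * S true *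
        ((Real.sqrt n)⁻¹ • ((a : PolyRing n g) • (1 : MatP n g)))ᵀ) =
        (a : PolyRing n g) * (a : PolyRing n g) := by
      have : ((n : ℕ) : PolyRing n g) = MvPolynomial.C (n : ℝ) := by simp
      simp only [S, if_true, Matrix.mul_one, transpose_smul, transpose_one,
        Matrix.mul_smul, trace_smul, trace_one, Fintype.card_fin, smul_eq_mul, this]
      simp only [MvPolynomial.smul_eq_C_mul]
      calc _ = MvPolynomial.C ((Real.sqrt n)⁻¹ * (Real.sqrt n)⁻¹ * (n : ℝ)) *
            ((a : PolyRing n g) * (a : PolyRing n g)) := by rw [map_mul, map_mul]; ring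
        _ = _ := by rw [h2, map_one, one_mul]
    rw [h3] at h1
    exact h1
  have hsymm : ∀ b k l, G b k l = G b l k := by
    intro b k l
    refine Subtype.ext ?_
    change trace (e k * S b * (e l)ᵀ) = trace (e l * S b * (e k)ᵀ)
    rw [← trace_transpose]
    simp only [transpose_mul, transpose_transpose, hSsymm, Matrix.mul_assoc]
  have hG : ∀ b (c : Fin m → traceCenter n g), ∑ k, ∑ l, c k * G b k l * c l ∈ T := by
    intro b c
    have h1 := hST b (∑ i, (c i : PolyRing n g) • e i)
      (sum_mem fun i _ => smul_mem_traceRing (c i).2 (he i))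
    rw [trace_sum_smul] at h1
    refine Subsemiring.mem_comap.2 ?_
    simp only [map_sum, map_mul]
    exact h1
  obtain ⟨φ, hφ⟩ := exists_real_point_posSemidef T hsq
    (fun h => hneg (by simpa [T] using h)) G hsymm hG
  have hpos : ∀ b, ∀ h ∈ traceRing n g, ∀ c : traceCenter n g,
      (c : PolyRing n g) = trace (h * S b * hᵀ) → 0 ≤ φ c := by
    intro b h hh c hc
    obtain ⟨r, hr, rfl⟩ := hspan h hh
    have h1 : c = ∑ k, ∑ l, (⟨r k, hr k⟩ : traceCenter n g) * G b k l * ⟨r l, hr l⟩ := by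
      refine Subtype.ext ?_
      change (c : PolyRing n g) = (traceCenter n g).val _
      rw [hc, trace_sum_smul]
      simp only [map_sum, map_mul]
      rfl
    rw [h1]
    simpa only [map_sum, map_mul] using hφ b fun k => φ ⟨r k, hr k⟩
  obtain ⟨A, hA⟩ := exists_real_point φ fun c ⟨h, hh, hc⟩ =>
    hpos true h hh c (hc.trans (by simp [S]))
  refine ⟨A, evalMat_posSemidef hsT hs fun h hh => ?_⟩
  have hc := trace_mul_transpose_mem_traceCenter hsT hh hh
  rw [← evalMat_eval_trace, hA ⟨_, hc⟩]
  exact hpos false h hh _ rfl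

end Certificate

/-- Infeasibility certificate for a single constraint. -/
theorem stmt12 (n g : ℕ) (hn : 0 < n) (hg : 0 < g)
    (s : MatP n g) (hsT : s ∈ traceRing n g) (hsSym : sᵀ = s) :
    (¬ ∃ A : Fin g → Matrix (Fin n) (Fin n) ℝ, (evalMat n g A s).PosSemidef) ↔
      ∃ (k : ℕ) (ω : Fin k → MatP n g) (m : Fin k → ℕ)
        (h : (i : Fin k) → Fin (m i) → MatP n g),
        (∀ i, ω i ∈ OmegaSet n g) ∧ (∀ i j, h i j ∈ traceRing n g) ∧
        (-1 : MatP n g) =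
          ∑ i, ω i *
            ((∏ j, Matrix.trace (h i j * s * (h i j)ᵀ)) • (1 : MatP n g)) := by
  constructor
  · intro hA
    obtain ⟨k, ω, m, h, hω, hh, heq⟩ := exists_certificate
      (of_not_not fun hneg => hA (exists_evalMat_posSemidef hn hsT hsSym hneg))
    exact ⟨k, ω, m, h, hω, hh, by rw [← heq, neg_smul, one_smul]⟩
  · rintro ⟨k, ω, m, h, hω, _, heq⟩ ⟨A, hA⟩
    exact certificate_ne_neg_one hn hA hω heq
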